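/- For every integer d ≥ 2 there exists a constant c > 0 such that for every positive integer w, the number κ'(d,w) of equivalence classes of d-dimensional convex lattice polytopes P with |P ∩ ℤ^d| = w and having at least one lattice point in the interior of P is finite and satisfies κ'(d,w) ≤ exp(c·w^{(d−1)/(d+1)}). -/

import Mathlib

open MeasureTheory

noncomputable section

/-- The canonical embedding of integer vectors into real vectors. -/
def intVec {d : ℕ} (x : Fin d → ℤ) : Fin d → ℝ := fun i => (x i : ℝ)

/-- `P` is a convex lattice polytope: the convex hull of a finite set of lattice points. -/
def IsConvexLatticePolytope (d : ℕ) (P : Set (Fin d → ℝ)) : Prop :=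
  ∃ V : Finset (Fin d → ℤ), P = convexHull ℝ (intVec '' (V : Set (Fin d → ℤ)))

/-- `P` is `d`-dimensional: its affine span is all of `ℝ^d`. -/
def IsFullDim (d : ℕ) (P : Set (Fin d → ℝ)) : Prop :=
  affineSpan ℝ P = ⊤

/-- The set of lattice points of `P`. -/
def latticePts (d : ℕ) (P : Set (Fin d → ℝ)) : Set (Fin d → ℤ) :=
  {x | intVec x ∈ P}

/-- The lattice `ℤ^d` viewed inside `ℝ^d`. -/
def latticeSet (d : ℕ) : Set (Fin d → ℝ) := Set.range (intVec (d := d))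

/-- Two subsets of `ℝ^d` are lattice-equivalent if some affine bijection of `ℝ^d`
preserving `ℤ^d` maps one onto the other. -/
def LatticeEquiv (d : ℕ) (P₁ P₂ : Set (Fin d → ℝ)) : Prop :=
  ∃ σ : (Fin d → ℝ) ≃ᵃ[ℝ] (Fin d → ℝ), σ '' latticeSet d = latticeSet d ∧ P₂ = σ '' P₁

/-- The type of equivalence classes of `d`-dimensional convex lattice polytopes
satisfying the predicate `Q`, modulo lattice equivalence. -/
def ClassesType (d : ℕ) (Q : Set (Fin d → ℝ) → Prop) : Type :=
  Quot (fun P₁ P₂ : {P : Set (Fin d → ℝ) // IsConvexLatticePolytope d P ∧ IsFullDim d P ∧ Q P} =>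
    LatticeEquiv d P₁.1 P₂.1)

/-- `P` is centrally symmetric (with some center `c`, i.e. `P = 2c - P`). -/
def IsCentrallySymmetric (d : ℕ) (P : Set (Fin d → ℝ)) : Prop :=
  ∃ c : Fin d → ℝ, ∀ x, x ∈ P ↔ (2 : ℝ) • c - x ∈ P


-- part Dioph

section

theorem dirichlet_sim {ι : Type} [Fintype ι] [DecidableEq ι] (I : Finset ι) (z : ι → ℝ) (M : ℕ) (hM : 1 ≤ M) :
    ∃ q : ℕ, 1 ≤ q ∧ q ≤ M ^ I.card ∧ ∃ r : ι → ℤ, ∀ i ∈ I, |(q : ℝ) * z i - r i| ≤ 1 / M := by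
  classical
  have hM0 : (0 : ℝ) < M := by exact_mod_cast hM
  let g : ℕ → (I → Fin M) := fun q i => ⟨⌊Int.fract ((q : ℝ) * z i) * M⌋₊, by
    have h1 := Int.fract_lt_one ((q : ℝ) * z i)
    have h0 := Int.fract_nonneg ((q : ℝ) * z i)
    rw [Nat.floor_lt (by positivity)]
    nlinarith⟩
  have hcard : (Finset.univ : Finset (I → Fin M)).card < (Finset.range (M ^ I.card + 1)).card := by
    simp
  obtain ⟨a, ha, b, hb, hab, hg⟩ := Finset.exists_ne_map_eq_of_card_lt_of_maps_to hcard
    (f := g) (fun _ _ => Finset.mem_univ _)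
  have key : ∀ a b : ℕ, a < b → b ∈ Finset.range (M ^ I.card + 1) → g a = g b →
      ∃ q : ℕ, 1 ≤ q ∧ q ≤ M ^ I.card ∧ ∃ r : ι → ℤ, ∀ i ∈ I, |(q : ℝ) * z i - r i| ≤ 1 / M := by
    intro a b hlt hb hg
    rw [Finset.mem_range] at hb
    refine ⟨b - a, by omega, by omega, fun i => ⌊(b : ℝ) * z i⌋ - ⌊(a : ℝ) * z i⌋, ?_⟩
    intro i hi
    have h := congrFun hg ⟨i, hi⟩
    simp only [g, Fin.mk.injEq] at h
    have ea := Nat.floor_le (a := Int.fract ((a : ℝ) * z i) * M) (mul_nonneg (Int.fract_nonneg _) hM0.le)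
    have ea' := Nat.lt_floor_add_one (Int.fract ((a : ℝ) * z i) * M)
    have eb := Nat.floor_le (a := Int.fract ((b : ℝ) * z i) * M) (mul_nonneg (Int.fract_nonneg _) hM0.le)
    have eb' := Nat.lt_floor_add_one (Int.fract ((b : ℝ) * z i) * M)
    rw [h] at ea ea'
    have : ((b - a : ℕ) : ℝ) * z i - ((⌊(b : ℝ) * z i⌋ - ⌊(a : ℝ) * z i⌋ : ℤ) : ℝ)
        = Int.fract ((b : ℝ) * z i) - Int.fract ((a : ℝ) * z i) := by
      rw [Nat.cast_sub hlt.le]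
      simp only [Int.fract]
      push_cast
      ring
    rw [this, abs_le, le_div_iff₀ hM0, ← neg_div, div_le_iff₀ hM0]
    constructor <;> nlinarith
  rcases lt_or_gt_of_ne hab with h | h
  · exact key a b h hb hg
  · exact key b a h ha hg.symm

theorem dioph_step (N : ℕ) (η : ℝ) (hη : 0 < η) : ∃ η' : ℝ, 0 < η' ∧
    ∀ (ι : Type) [Fintype ι], Fintype.card ι ≤ N → ∀ y : ι → ℝ, (∀ i, 0 < y i) → ∑ i, y i = 1 →
    ∀ I : Finset ι, I.card < Fintype.card ι → (∀ i ∈ I, η ≤ y i) →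
    ∃ (m : ℤ) (n : ι → ℤ), (∀ i, 0 < m * y i + n i) ∧ ∑ i, (m * y i + n i) = 1 ∧
      ∃ I' : Finset ι, I'.card = I.card + 1 ∧ ∀ i ∈ I', η' ≤ m * y i + n i := by
  classical
  obtain ⟨M, hM⟩ := exists_nat_gt (2 / η + 4 * N + 1)
  have hM1 : 1 ≤ M := by
    have : (1:ℝ) < M := by
      have : 0 < 2 / η := by positivity
      have : (0:ℝ) ≤ 4 * N := by positivity
      linarith
    exact_mod_cast this.le
  have hM0 : (0 : ℝ) < M := by exact_mod_cast hM1
  have hMη : 1 / (M:ℝ) ≤ η / 2 := by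
    rw [div_le_div_iff₀ hM0 (by norm_num)]
    have : 2 / η < M := by
      have : (0:ℝ) ≤ 4 * N := by positivity
      linarith
    rw [div_lt_iff₀ hη] at this
    linarith
  have hMN : (N : ℝ) * (1 / M) ≤ 1 / 4 := by
    rw [mul_one_div, div_le_div_iff₀ hM0 (by norm_num)]
    have : 0 < 2 / η := by positivity
    linarith
  set δ : ℝ := min (η / 2) (1 / (8 * (N + 1) * M ^ N)) with hδ
  have hδ0 : 0 < δ := by positivity
  have hδη : δ ≤ η / 2 := min_le_left _ _
  have hδM : N * ((M : ℝ) ^ N * (2 * δ)) ≤ 1 / 4 := by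
    have h1 : δ ≤ 1 / (8 * (N + 1) * M ^ N) := min_le_right _ _
    have h2 : (0:ℝ) < M ^ N := by positivity
    rw [le_div_iff₀ (by positivity)] at h1
    nlinarith [mul_pos hδ0 h2]
  refine ⟨δ, hδ0, ?_⟩
  intro ι _ hN y hy hsum I hI hIη
  have hne : (Finset.univ \ I).Nonempty := by
    rw [← Finset.card_pos, Finset.card_sdiff_of_subset (Finset.subset_univ _), Finset.card_univ]
    omega
  obtain ⟨j, hj, hjmax⟩ := Finset.exists_max_image (Finset.univ \ I) y hne
  have hjI : j ∉ I := by simpa using hj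
  by_cases hcase : δ ≤ y j
  · refine ⟨1, 0, by simpa using hy, by simpa using hsum, insert j I, Finset.card_insert_of_notMem hjI, ?_⟩
    intro i hi
    rcases Finset.mem_insert.1 hi with rfl | hi
    · simpa using hcase
    · have := hIη i hi
      simp
      linarith
  · push Not at hcase
    set X : ℕ := ⌈δ / y j⌉₊ with hX
    have hyj := hy j
    have hX1 : δ ≤ X * y j := by
      have := Nat.le_ceil (δ / y j)
      rwa [div_le_iff₀ hyj] at this
    have hX2 : X * y j ≤ 2 * δ := by
      have := Nat.ceil_lt_add_one (a := δ / y j) (by positivity)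
      have h2 : (X : ℝ) * y j < (δ / y j + 1) * y j := by
        apply mul_lt_mul_of_pos_right this hyj
      rw [add_mul, div_mul_cancel₀ _ hyj.ne'] at h2
      linarith
    obtain ⟨q, hq1, hqM, r, hr⟩ := dirichlet_sim I (fun i => X * y i) M hM1
    have hqM' : (q : ℝ) ≤ M ^ N := by
      calc (q : ℝ) ≤ (M ^ I.card : ℕ) := by exact_mod_cast hqM
        _ ≤ (M ^ N : ℕ) := by
          exact_mod_cast Nat.pow_le_pow_right hM1 (by omega)
        _ = M ^ N := by push_cast; rfl
    have hq1' : (1 : ℝ) ≤ q := by exact_mod_cast hq1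
    let r' : ι → ℤ := fun i => if i ∈ I then r i else 0
    have hin : ∀ i ∈ I, |(q : ℝ) * (X * y i) - r' i| ≤ 1 / M := by
      intro i hi
      simpa [r', hi] using hr i hi
    have hout : ∀ i, i ∉ I → (q : ℝ) * (X * y i) - r' i ≤ M ^ N * (2 * δ) ∧ 0 ≤ (q : ℝ) * (X * y i) - r' i := by
      intro i hi
      have h1 : y i ≤ y j := hjmax i (by simpa using hi)
      have h2 : (X : ℝ) * y i ≤ 2 * δ := le_trans (mul_le_mul_of_nonneg_left h1 (by positivity)) hX2
      have h3 := hy i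
      simp only [r', hi, if_false, Int.cast_zero, sub_zero]
      refine ⟨mul_le_mul hqM' h2 (by positivity) (by positivity), by positivity⟩
    -- sum is an integer of small absolute value
    have habs : |∑ i, ((q : ℝ) * (X * y i) - r' i)| ≤ 1 / 2 := by
      have hb : ∀ i, |(q : ℝ) * (X * y i) - r' i| ≤ (if i ∈ I then 1 / (M:ℝ) else 0) + M ^ N * (2 * δ) := by
        intro i
        have : (0:ℝ) ≤ M ^ N * (2 * δ) := by positivity
        by_cases hi : i ∈ I
        · simp only [hi, if_true]
          have := hin i hi
          linarith
        · simp only [hi, if_false]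
          obtain ⟨h1, h2⟩ := hout i hi
          rw [abs_of_nonneg h2]; linarith
      calc _ ≤ ∑ i, |(q : ℝ) * (X * y i) - r' i| := Finset.abs_sum_le_sum_abs _ _
        _ ≤ ∑ i, ((if i ∈ I then 1 / (M:ℝ) else 0) + M ^ N * (2 * δ)) := Finset.sum_le_sum (fun i _ => hb i)
        _ = I.card * (1 / (M:ℝ)) + Fintype.card ι * (M ^ N * (2 * δ)) := by
          rw [Finset.sum_add_distrib]
          simp
        _ ≤ N * (1 / (M:ℝ)) + N * (M ^ N * (2 * δ)) := by
          have h1 : (I.card : ℝ) ≤ N := by exact_mod_cast (by omega : I.card ≤ N)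
          have h2 : (Fintype.card ι : ℝ) ≤ N := by exact_mod_cast hN
          gcongr
        _ ≤ 1 / 2 := by linarith
    have hint : ∑ i, ((q : ℝ) * (X * y i) - r' i) = ((q * X - ∑ i, r' i : ℤ) : ℝ) := by
      rw [Finset.sum_sub_distrib]
      push_cast
      rw [← Finset.mul_sum, ← Finset.mul_sum, hsum]; ring
    have hzero : ∑ i, ((q : ℝ) * (X * y i) - r' i) = 0 := by
      rw [hint] at habs ⊢
      have : |(q * X - ∑ i, r' i : ℤ)| < 1 := by
        have h : ((|(q * X - ∑ i, r' i : ℤ)| : ℤ) : ℝ) < 1 := by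
          rw [Int.cast_abs]; linarith
        exact_mod_cast h
      rw [Int.abs_lt_one_iff] at this
      rw [this]; simp
    have heq : ∀ i, (((1 + q * X : ℤ) : ℝ) * y i + ((- r' i : ℤ) : ℝ)) = y i + ((q : ℝ) * (X * y i) - r' i) := by
      intro i; push_cast; ring
    have hI' : ∀ i ∈ I, δ ≤ y i + ((q : ℝ) * (X * y i) - r' i) := by
      intro i hi
      have h1 := (abs_le.1 (hin i hi)).1
      have h2 := hIη i hi
      linarith
    refine ⟨1 + q * X, fun i => - r' i, ?_, ?_, insert j I, Finset.card_insert_of_notMem hjI, ?_⟩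
    · intro i
      rw [heq]
      by_cases hi : i ∈ I
      · exact lt_of_lt_of_le hδ0 (hI' i hi)
      · have := (hout i hi).2
        have := hy i
        linarith
    · simp_rw [heq]
      rw [Finset.sum_add_distrib, hzero, hsum, add_zero]
    · intro i hi
      rw [heq]
      rcases Finset.mem_insert.1 hi with rfl | hi
      · simp only [r', hjI, if_false, Int.cast_zero, sub_zero]
        have : (1:ℝ) * (X * y i) ≤ q * (X * y i) := mul_le_mul_of_nonneg_right hq1' (by positivity)
        linarith
      · exact hI' i hi

theorem dioph_k (N : ℕ) (k : ℕ) : ∃ η : ℝ, 0 < η ∧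
    ∀ (ι : Type) [Fintype ι], Fintype.card ι ≤ N → k ≤ Fintype.card ι →
    ∀ y : ι → ℝ, (∀ i, 0 < y i) → ∑ i, y i = 1 →
    ∃ (m : ℤ) (n : ι → ℤ), (∀ i, 0 < m * y i + n i) ∧ ∑ i, (m * y i + n i) = 1 ∧
      ∃ I : Finset ι, I.card = k ∧ ∀ i ∈ I, η ≤ m * y i + n i := by
  induction k with
  | zero =>
    refine ⟨1, one_pos, ?_⟩
    intro ι _ _ _ y hy hs
    exact ⟨1, 0, by simpa using hy, by simpa using hs, ∅, by simp, by simp⟩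
  | succ k ih =>
    obtain ⟨η, hη, h⟩ := ih
    obtain ⟨η', hη', h'⟩ := dioph_step N η hη
    refine ⟨η', hη', ?_⟩
    intro ι _ hN hk y hy hs
    obtain ⟨m, n, h1, h2, I, hI, h3⟩ := h ι hN (by omega) y hy hs
    obtain ⟨m', n', h1', h2', I', hI', h3'⟩ := h' ι hN _ h1 h2 I (by omega) h3
    have heq : ∀ i, (((m' * m : ℤ) : ℝ) * y i + ((m' * n i + n' i : ℤ) : ℝ)) = m' * (m * y i + n i) + n' i := by
      intro i; push_cast; ring
    refine ⟨m' * m, fun i => m' * n i + n' i, ?_, ?_, I', by omega, ?_⟩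
    · intro i; rw [heq]; exact h1' i
    · simp_rw [heq]; exact h2'
    · intro i hi; rw [heq]; exact h3' i hi

theorem dioph (N : ℕ) : ∃ δ : ℝ, 0 < δ ∧
    ∀ (ι : Type) [Fintype ι], Fintype.card ι ≤ N →
    ∀ y : ι → ℝ, (∀ i, 0 < y i) → ∑ i, y i = 1 →
    ∃ (m : ℤ) (n : ι → ℤ), (∀ i, δ ≤ m * y i + n i) ∧ ∑ i, (m * y i + n i) = 1 := by
  have h := fun k => dioph_k N k
  choose η hη h using h
  have hne : (Finset.range (N + 1)).Nonempty := by simp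
  refine ⟨(Finset.range (N+1)).inf' hne η, ?_, ?_⟩
  · rw [Finset.lt_inf'_iff]; intro i _; exact hη i
  · intro ι _ hN y hy hs
    obtain ⟨m, n, h1, h2, I, hI, h3⟩ := h (Fintype.card ι) ι hN le_rfl y hy hs
    refine ⟨m, n, ?_, h2⟩
    intro i
    have : I = Finset.univ := Finset.eq_univ_of_card I hI
    refine le_trans (Finset.inf'_le _ (by simp; omega)) (h3 i (by simp [this]))

end

-- part Red

section

structure LNorm {M : Type} [AddCommGroup M] (N : M → ℝ) : Prop where
  add : ∀ x y, N (x + y) ≤ N x + N y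
  smul : ∀ (k : ℤ) x, N (k • x) = |(k:ℝ)| * N x
  fin : ∀ R : ℝ, {x | N x ≤ R}.Finite

namespace LNorm
variable {M : Type} [AddCommGroup M] {N : M → ℝ}

theorem zero (h : LNorm N) : N 0 = 0 := by
  have := h.smul 0 0
  simpa using this

theorem neg (h : LNorm N) (x : M) : N (-x) = N x := by
  have := h.smul (-1) x
  simpa using this

theorem nonneg (h : LNorm N) (x : M) : 0 ≤ N x := by
  have := h.add x (-x)
  rw [h.neg, add_neg_cancel, h.zero] at this
  linarith

theorem sum_le (h : LNorm N) {ι : Type} (s : Finset ι) (f : ι → M) : N (∑ i ∈ s, f i) ≤ ∑ i ∈ s, N (f i) := by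
  classical
  induction s using Finset.induction_on with
  | empty => simp [h.zero]
  | insert a s ha ih =>
    rw [Finset.sum_insert ha, Finset.sum_insert ha]
    linarith [h.add (f a) (∑ i ∈ s, f i)]

theorem pos [Module.IsTorsionFree ℤ M] (h : LNorm N) (x : M) (hx : x ≠ 0) : 0 < N x := by
  rcases (h.nonneg x).lt_or_eq with h1 | h1
  · exact h1
  exfalso
  have hinf : (Set.range (fun k : ℤ => k • x)).Infinite := by
    apply Set.infinite_range_of_injective
    intro a b hab
    exact smul_left_injective ℤ hx hab
  apply hinf
  apply (h.fin 0).subset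
  rintro _ ⟨k, rfl⟩
  simp [h.smul, ← h1]

theorem exists_min [Module.IsTorsionFree ℤ M] [Nontrivial M] (h : LNorm N) :
    ∃ b : M, b ≠ 0 ∧ ∀ x, x ≠ 0 → N b ≤ N x := by
  obtain ⟨x0, hx0⟩ := exists_ne (0 : M)
  have hf : ({x | N x ≤ N x0} \ {0}).Finite := (h.fin (N x0)).subset Set.sdiff_subset
  obtain ⟨b, hb, hmin⟩ := Set.exists_min_image _ N hf ⟨x0, by simp [hx0]⟩
  refine ⟨b, hb.2, ?_⟩
  intro x hx
  by_cases hc : N x ≤ N x0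
  · exact hmin x ⟨hc, hx⟩
  · exact le_trans hb.1 (le_of_not_ge hc)

/-- quotient norm -/
def qn (N : M → ℝ) (b : M) (y : M ⧸ Submodule.span ℤ {b}) : ℝ :=
  sInf {r | ∃ (k : ℕ) (x : M), 0 < k ∧ Submodule.Quotient.mk x = (k : ℤ) • y ∧ r = N x / k}

theorem qn_bdd (h : LNorm N) (b : M) (y : M ⧸ Submodule.span ℤ {b}) :
    BddBelow {r | ∃ (k : ℕ) (x : M), 0 < k ∧ Submodule.Quotient.mk x = (k : ℤ) • y ∧ r = N x / k} := by
  refine ⟨0, ?_⟩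
  rintro _ ⟨k, x, hk, _, rfl⟩
  exact div_nonneg (h.nonneg x) (by positivity)

theorem qn_ne (b : M) (y : M ⧸ Submodule.span ℤ {b}) :
    {r | ∃ (k : ℕ) (x : M), 0 < k ∧ Submodule.Quotient.mk x = (k : ℤ) • y ∧ r = N x / k}.Nonempty := by
  obtain ⟨x, rfl⟩ := Submodule.Quotient.mk_surjective _ y
  exact ⟨N x / (1:ℕ), 1, x, one_pos, by simp, rfl⟩

theorem qn_le (h : LNorm N) {b : M} {y : M ⧸ Submodule.span ℤ {b}} {k : ℕ} {x : M} (hk : 0 < k)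
    (hx : Submodule.Quotient.mk x = (k : ℤ) • y) : qn N b y ≤ N x / k :=
  csInf_le (h.qn_bdd b y) ⟨k, x, hk, hx, rfl⟩

theorem qn_mk_le (h : LNorm N) (b : M) (x : M) : qn N b (Submodule.Quotient.mk x) ≤ N x := by
  simpa using h.qn_le (b := b) (k := 1) (x := x) one_pos (by simp)

theorem qn_nonneg (h : LNorm N) (b : M) (y) : 0 ≤ qn N b y := by
  apply le_csInf (qn_ne b y)
  rintro _ ⟨k, x, hk, _, rfl⟩
  exact div_nonneg (h.nonneg x) (by positivity)

theorem qn_exists {b : M} (y : M ⧸ Submodule.span ℤ {b}) {ε : ℝ} (hε : 0 < ε) :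
    ∃ (k : ℕ) (x : M), 0 < k ∧ Submodule.Quotient.mk x = (k : ℤ) • y ∧ N x / k < qn N b y + ε := by
  obtain ⟨_, ⟨k, x, hk, hx, rfl⟩, h2⟩ := exists_lt_of_csInf_lt (qn_ne (N := N) b y) (lt_add_of_pos_right _ hε)
  exact ⟨k, x, hk, hx, h2⟩

theorem qn_add (h : LNorm N) (b : M) (y y' : M ⧸ Submodule.span ℤ {b}) : qn N b (y + y') ≤ qn N b y + qn N b y' := by
  apply le_of_forall_pos_le_add
  intro ε hε
  obtain ⟨k, x, hk, hx, h1⟩ := qn_exists (N := N) y (half_pos hε)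
  obtain ⟨k', x', hk', hx', h1'⟩ := qn_exists (N := N) y' (half_pos hε)
  have h2 := h.qn_le (b := b) (y := y + y') (k := k * k') (x := (k' : ℤ) • x + (k : ℤ) • x') (by positivity) (by
    rw [Submodule.Quotient.mk_add, Submodule.Quotient.mk_smul, Submodule.Quotient.mk_smul, hx, hx', smul_smul, smul_smul, smul_add]
    push_cast
    rw [mul_comm (k':ℤ)])
  have h3 := h.add ((k' : ℤ) • x) ((k : ℤ) • x')
  rw [h.smul, h.smul] at h3
  have hk0 : (0:ℝ) < k := by exact_mod_cast hk
  have hk0' : (0:ℝ) < k' := by exact_mod_cast hk'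
  simp only [Int.cast_natCast, abs_of_pos hk0, abs_of_pos hk0'] at h3
  have h4 : N ((k' : ℤ) • x + (k : ℤ) • x') / ((k * k' : ℕ) : ℝ) ≤ N x / k + N x' / k' := by
    push_cast
    rw [div_add_div _ _ hk0.ne' hk0'.ne']
    gcongr
    linarith
  linarith

theorem qn_smul_le (h : LNorm N) (b : M) (j : ℤ) (y : M ⧸ Submodule.span ℤ {b}) : qn N b (j • y) ≤ |(j:ℝ)| * qn N b y := by
  apply le_of_forall_pos_le_add
  intro ε hε
  obtain ⟨k, x, hk, hx, h1⟩ := qn_exists (N := N) y (ε := ε / (|(j:ℝ)| + 1)) (by positivity)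
  have h2 := h.qn_le (b := b) (y := j • y) (k := k) (x := j • x) hk (by
    rw [Submodule.Quotient.mk_smul, hx, smul_comm])
  rw [h.smul, mul_div_assoc] at h2
  have h3 : |(j:ℝ)| * (ε / (|(j:ℝ)| + 1)) ≤ ε := by
    rw [mul_div_assoc', div_le_iff₀ (by positivity)]
    nlinarith [abs_nonneg (j:ℝ)]
  have := mul_le_mul_of_nonneg_left h1.le (abs_nonneg (j:ℝ))
  linarith

theorem qn_smul (h : LNorm N) (b : M) (j : ℤ) (y : M ⧸ Submodule.span ℤ {b}) : qn N b (j • y) = |(j:ℝ)| * qn N b y := by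
  apply le_antisymm (h.qn_smul_le b j y)
  by_cases hj : j = 0
  · subst hj; simp [h.qn_nonneg]
  have hj' : 0 < |(j:ℝ)| := by positivity
  apply le_csInf (qn_ne b _)
  rintro _ ⟨k, x, hk, hx, rfl⟩
  have h2 := h.qn_le (b := b) (y := y) (k := k * j.natAbs) (x := (SignType.sign j : ℤ) • x)
    (Nat.mul_pos hk (Int.natAbs_pos.2 hj)) (by
    rw [Submodule.Quotient.mk_smul, hx, smul_smul, smul_smul]
    congr 1
    push_cast
    rw [← self_mul_sign]; ring)
  have h3 : |((SignType.sign j : ℤ) : ℝ)| = 1 := by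
    rcases lt_or_gt_of_ne hj with h | h
    · simp [sign_neg h]
    · simp [sign_pos h]
  rw [h.smul, h3, one_mul] at h2
  have hk0 : (0:ℝ) < k := by exact_mod_cast hk
  have h4 : ((k * j.natAbs : ℕ) : ℝ) = k * |(j:ℝ)| := by
    push_cast; rw [Nat.cast_natAbs]; push_cast; rfl
  rw [h4, ← div_div, le_div_iff₀ hj'] at h2
  linarith

theorem qn_lift (h : LNorm N) (b : M) (hb : 0 < N b) (y : M ⧸ Submodule.span ℤ {b}) :
    ∃ x : M, Submodule.Quotient.mk x = y ∧ N x ≤ qn N b y + 3 / 4 * N b := by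
  obtain ⟨k, x, hk, hx, h1⟩ := qn_exists (N := N) y (ε := N b / 4) (by positivity)
  obtain ⟨x0, rfl⟩ := Submodule.Quotient.mk_surjective _ y
  have hk0 : (0:ℝ) < k := by exact_mod_cast hk
  rw [← Submodule.Quotient.mk_smul, Submodule.Quotient.eq, Submodule.mem_span_singleton] at hx
  obtain ⟨m, hm⟩ := hx
  let q : ℤ := round ((m : ℝ) / k)
  refine ⟨x0 + q • b, ?_, ?_⟩
  · rw [Submodule.Quotient.eq]
    simp only [add_sub_cancel_left]
    exact Submodule.smul_mem _ _ (Submodule.mem_span_singleton_self b)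
  · have e : (k : ℤ) • (x0 + q • b) = x + ((k : ℤ) * q - m) • b := by
      rw [sub_smul, hm, smul_add, smul_smul]; abel
    have h2 : k * N (x0 + q • b) ≤ N x + |(k:ℝ) * q - m| * N b := by
      have h3 := h.smul k (x0 + q • b)
      rw [e] at h3
      have h4 := h.add x (((k : ℤ) * q - m) • b)
      rw [h3, h.smul] at h4
      simpa using h4
    have h5 : |(k:ℝ) * q - m| ≤ k / 2 := by
      have := abs_sub_round ((m : ℝ) / k)
      have e2 : (k:ℝ) * q - m = - (k * ((m : ℝ) / k - round ((m : ℝ) / k))) := by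
        field_simp
        simp [q]
      rw [e2, abs_neg, abs_mul, abs_of_pos hk0]
      nlinarith
    have h6 : N (x0 + q • b) ≤ N x / k + N b / 2 := by
      rw [div_add' _ _ _ hk0.ne', le_div_iff₀ hk0]
      nlinarith
    linarith

theorem qn_lnorm (h : LNorm N) (b : M) (hb : 0 < N b) : LNorm (qn N b) where
  add := h.qn_add b
  smul := h.qn_smul b
  fin := by
    intro R
    apply ((h.fin (R + 3 / 4 * N b)).image Submodule.Quotient.mk).subset
    intro y hy
    obtain ⟨x, hx, h1⟩ := h.qn_lift b hb y
    simp only [Set.mem_ofPred_eq] at hy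
    exact ⟨x, by simp only [Set.mem_ofPred_eq]; linarith, hx⟩

theorem quot_tf [Module.IsTorsionFree ℤ M] (h : LNorm N) (b : M) (hb : 0 < N b) (hmin : ∀ x, x ≠ 0 → N b ≤ N x) :
    Module.IsTorsionFree ℤ (M ⧸ Submodule.span ℤ {b}) := by
  constructor
  intro k hk
  have hk0 : k ≠ 0 := hk.ne_zero
  have key : ∀ y : M ⧸ Submodule.span ℤ {b}, k • y = 0 → y = 0 := by
    intro y hy
    obtain ⟨x0, rfl⟩ := Submodule.Quotient.mk_surjective _ y
    rw [← Submodule.Quotient.mk_smul, Submodule.Quotient.mk_eq_zero, Submodule.mem_span_singleton] at hy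
    obtain ⟨m, hm⟩ := hy
    let q : ℤ := round ((m : ℝ) / k)
    have hkr : (k:ℝ) ≠ 0 := by exact_mod_cast hk0
    have e : k • (x0 - q • b) = (m - k * q) • b := by
      rw [smul_sub, ← hm, smul_smul, sub_smul]
    have h1 : |(k:ℝ)| * N (x0 - q • b) = |(m:ℝ) - k * q| * N b := by
      rw [← h.smul, e, h.smul]; push_cast; rfl
    have h5 : |(m:ℝ) - k * q| ≤ |(k:ℝ)| / 2 := by
      have := abs_sub_round ((m : ℝ) / k)
      have e2 : (m:ℝ) - k * q = (k * ((m : ℝ) / k - round ((m : ℝ) / k))) := by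
        field_simp
        simp [q]
      rw [e2, abs_mul]
      nlinarith [abs_nonneg (k:ℝ)]
    have h6 : x0 - q • b = 0 := by
      by_contra hne
      have := hmin _ hne
      have hkp : 0 < |(k:ℝ)| := by positivity
      nlinarith
    rw [Submodule.Quotient.mk_eq_zero, sub_eq_zero.1 h6]
    exact Submodule.smul_mem _ _ (Submodule.mem_span_singleton_self b)
  intro y y' hyy
  have := key (y - y') (by rw [smul_sub]; exact sub_eq_zero.2 hyy)
  exact sub_eq_zero.1 this

end LNorm

theorem reduced_basis (d : ℕ) : ∃ c : ℝ, 0 < c ∧ ∀ (M : Type) [AddCommGroup M] [Module.Finite ℤ M]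
    [Module.IsTorsionFree ℤ M] (N : M → ℝ), LNorm N → Module.finrank ℤ M = d →
    ∃ b : Fin d → M, Submodule.span ℤ (Set.range b) = ⊤ ∧
      ∀ x : Fin d → ℤ, c * ∑ i, |(x i : ℝ)| * N (b i) ≤ N (∑ i, x i • b i) := by
  induction d with
  | zero =>
    refine ⟨1, one_pos, ?_⟩
    intro M _ _ _ N h hr
    have : Subsingleton M := Module.finrank_zero_iff.1 hr
    exact ⟨Fin.elim0, Subsingleton.elim _ _, by intro x; simp [h.zero]⟩
  | succ d ih =>
    obtain ⟨c, hc, ih⟩ := ih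
    refine ⟨1 / (1 + 8 / c), by positivity, ?_⟩
    intro M _ _ _ N h hr
    have : Nontrivial M := Module.nontrivial_of_finrank_pos (R := ℤ) (by omega)
    obtain ⟨b1, hb1, hmin⟩ := h.exists_min
    have hb := h.pos b1 hb1
    have htf := h.quot_tf b1 hb hmin
    have hrank : Module.finrank ℤ (M ⧸ Submodule.span ℤ {b1}) = d := by
      have h1 := Submodule.finrank_quotient_add_finrank (R := ℤ) (Submodule.span ℤ {b1})
      have h2 : Module.finrank ℤ (Submodule.span ℤ {b1}) = 1 := by
        have := finrank_span_eq_card (R := ℤ) (b := fun _ : Unit => b1) (LinearIndependent.of_subsingleton () hb1)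
        rw [Set.range_const] at this
        simpa using this
      omega
    obtain ⟨bb, hspan, hin⟩ := ih _ (LNorm.qn N b1) (h.qn_lnorm b1 hb) hrank
    have hl := fun i => h.qn_lift b1 hb (bb i)
    choose l hl1 hl2 using hl
    have hl3 : ∀ i, N (l i) ≤ 4 * LNorm.qn N b1 (bb i) := by
      intro i
      have h0 : l i ≠ 0 := by
        intro h0
        have h1 := hl1 i
        rw [h0, Submodule.Quotient.mk_zero] at h1
        have hli : LinearIndependent ℤ bb := by
          apply linearIndependent_of_top_le_span_of_card_eq_finrank hspan.ge
          simp [hrank]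
        exact hli.ne_zero i h1.symm
      have := hmin _ h0
      have := hl2 i
      linarith
    refine ⟨Fin.cons b1 l, ?_, ?_⟩
    · rw [eq_top_iff]
      intro x _
      have hx : (Submodule.Quotient.mk x : M ⧸ Submodule.span ℤ {b1}) ∈ Submodule.span ℤ (Set.range bb) := by
        rw [hspan]; trivial
      rw [Submodule.mem_span_range_iff_exists_fun] at hx
      obtain ⟨a, ha⟩ := hx
      have h1 : x - ∑ i, a i • l i ∈ Submodule.span ℤ {b1} := by
        rw [← Submodule.Quotient.eq, ← ha]
        rw [← Submodule.mkQ_apply, map_sum]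
        simp [hl1]
      rw [Submodule.mem_span_singleton] at h1
      obtain ⟨m, hm⟩ := h1
      rw [Submodule.mem_span_range_iff_exists_fun]
      refine ⟨Fin.cons m a, ?_⟩
      rw [Fin.sum_univ_succ]
      simp [hm]
    · intro x
      rw [Fin.sum_univ_succ, Fin.sum_univ_succ]
      simp only [Fin.cons_zero, Fin.cons_succ]
      set z := x 0 • b1 + ∑ i : Fin d, x i.succ • l i with hz
      have h1 := hin (fun i => x i.succ)
      have h2 : ∑ i : Fin d, x i.succ • bb i = Submodule.Quotient.mk z := by
        rw [hz, Submodule.Quotient.mk_add, (Submodule.Quotient.mk_eq_zero _).2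
          (Submodule.smul_mem _ _ (Submodule.mem_span_singleton_self b1)), zero_add,
          ← Submodule.mkQ_apply, map_sum]
        simp [hl1]
      rw [h2] at h1
      have h3 := h1.trans (h.qn_mk_le b1 z)
      set s := ∑ i : Fin d, |(x i.succ : ℝ)| * N (l i) with hs
      have h4 : s ≤ 4 * ∑ i : Fin d, |(x i.succ : ℝ)| * LNorm.qn N b1 (bb i) := by
        rw [hs, Finset.mul_sum]
        apply Finset.sum_le_sum
        intro i _
        have := mul_le_mul_of_nonneg_left (hl3 i) (abs_nonneg (x i.succ : ℝ))
        linarith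
      have h5 : c * s ≤ 4 * N z := by nlinarith
      have h6 : |(x 0 : ℝ)| * N b1 ≤ N z + s := by
        rw [← h.smul]
        have e : x 0 • b1 = z + -(∑ i : Fin d, x i.succ • l i) := by rw [hz]; abel
        rw [e]
        refine (h.add _ _).trans ?_
        rw [h.neg]
        have := h.sum_le Finset.univ (fun i : Fin d => x i.succ • l i)
        simp_rw [h.smul] at this
        linarith
      rw [one_div, inv_mul_le_iff₀ (by positivity)]
      have h7 : s ≤ 4 / c * N z := by
        rw [div_mul_eq_mul_div, le_div_iff₀ hc]; linarith
      have : (1 + 8 / c) * N z = N z + 2 * (4 / c * N z) := by ring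
      linarith

end

-- part Deep

section

theorem intVec_add {d : ℕ} (x y : Fin d → ℤ) : intVec (x + y) = intVec x + intVec y := by
  ext i; simp [intVec]
theorem intVec_smul {d : ℕ} (k : ℤ) (x : Fin d → ℤ) : intVec (k • x) = (k : ℝ) • intVec x := by
  ext i; simp [intVec]
theorem intVec_sum {d : ℕ} {ι : Type} (s : Finset ι) (f : ι → Fin d → ℤ) :
    intVec (∑ i ∈ s, f i) = ∑ i ∈ s, intVec (f i) := by
  ext j; simp [intVec, Finset.sum_apply]
theorem intVec_inj {d : ℕ} : Function.Injective (intVec (d := d)) := by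
  intro x y h
  ext i
  have := congrFun h i
  simpa [intVec] using this

/-- maximal simplex -/
theorem max_simplex (d : ℕ) (V : Finset (Fin d → ℤ))
    (hspan : affineSpan ℝ (intVec '' (V : Set (Fin d → ℤ))) = ⊤) :
    ∃ v : Fin (d+1) → (Fin d → ℤ), (∀ i, v i ∈ V) ∧ ∀ y ∈ V, ∃ β : Fin (d+1) → ℝ,
      (∀ i, β i ≤ 1) ∧ ∑ i, β i = 1 ∧ ∑ i, β i • intVec (v i) = intVec y := by
  classical
  let Q : (Fin d → ℤ) → Fin (d+1) → ℝ := fun y => Fin.cons 1 (intVec y)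
  let MM : (Fin (d+1) → V) → Matrix (Fin (d+1)) (Fin (d+1)) ℝ := fun v => Matrix.of fun i => Q (v i)
  -- a nondegenerate tuple
  obtain ⟨v0, hv0⟩ : ∃ v0 : Fin (d+1) → V, (MM v0).det ≠ 0 := by
    obtain ⟨t, hts, htspan, htind⟩ := exists_affineIndependent ℝ (Fin d → ℝ) (intVec '' (V : Set (Fin d → ℤ)))
    rw [hspan] at htspan
    have hfin : Finite t := (V.finite_toSet.image intVec).subset hts
    have := Fintype.ofFinite t
    have hcard : Fintype.card t = d + 1 := by
      have := htind.affineSpan_eq_top_iff_card_eq_finrank_add_one.1 (by simpa using htspan)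
      simpa using this
    let e : Fin (d+1) ≃ t := (Fintype.equivFinOfCardEq hcard).symm
    have hch : ∀ i, ∃ y : V, intVec (y : Fin d → ℤ) = e i := by
      intro i
      obtain ⟨y, hy, h⟩ := hts (e i).2
      exact ⟨⟨y, hy⟩, h⟩
    choose v0 hv0 using hch
    refine ⟨v0, ?_⟩
    intro hdet
    obtain ⟨g, hg, hg0⟩ := Matrix.exists_vecMul_eq_zero_iff.2 hdet
    have hind : AffineIndependent ℝ (fun i => (e i : Fin d → ℝ)) := htind.comp_embedding e.toEmbedding
    rw [affineIndependent_iff] at hind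
    have h1 : ∀ j, ∑ i, g i * Q (v0 i) j = 0 := by
      intro j
      have := congrFun hg0 j
      simpa [Matrix.vecMul, dotProduct, MM] using this
    apply hg
    ext i
    refine hind Finset.univ g ?_ ?_ i (Finset.mem_univ i)
    · simpa [Q] using h1 0
    · ext j
      have := h1 j.succ
      simp only [Q, Fin.cons_succ, hv0] at this
      simpa [Finset.sum_apply] using this
  have : Nonempty (Fin (d+1) → V) := ⟨v0⟩
  obtain ⟨v, -, hv⟩ := Finset.exists_max_image (Finset.univ : Finset (Fin (d+1) → V)) (fun v => |(MM v).det|) ⟨v0, Finset.mem_univ _⟩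
  have hdet : (MM v).det ≠ 0 := by
    have := hv v0 (Finset.mem_univ _)
    intro h
    rw [h, abs_zero] at this
    exact hv0 (abs_nonpos_iff.1 this)
  refine ⟨fun i => v i, fun i => (v i).2, ?_⟩
  intro y hy
  refine ⟨fun i => ((MM v).updateRow i (Q y)).det / (MM v).det, ?_, ?_⟩
  · intro i
    have h1 : (MM v).updateRow i (Q y) = MM (Function.update v i ⟨y, hy⟩) := by
      ext k l
      by_cases hk : k = i
      · subst hk; simp [MM]
      · simp [MM, Matrix.updateRow_ne hk, Function.update_of_ne hk]
    show ((MM v).updateRow i (Q y)).det / (MM v).det ≤ 1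
    rw [h1]
    have := hv (Function.update v i ⟨y, hy⟩) (Finset.mem_univ _)
    refine (le_abs_self _).trans ?_
    rw [abs_div, div_le_one (abs_pos.2 hdet)]
    exact this
  · have key : ∀ j, ∑ i, ((MM v).updateRow i (Q y)).det / (MM v).det * Q (v i) j = Q y j := by
      intro j
      have h1 := Matrix.mulVec_cramer (MM v).transpose (Q y)
      have h2 := congrFun h1 j
      rw [Matrix.det_transpose] at h2
      simp only [Matrix.mulVec, dotProduct, Matrix.transpose_apply, Matrix.cramer_transpose_apply, Pi.smul_apply, smul_eq_mul] at h2
      rw [eq_comm, ← mul_right_inj' hdet, ← h2, Finset.mul_sum]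
      apply Finset.sum_congr rfl
      intro i _
      change _ = (MM v).det * (_ / (MM v).det * MM v i j)
      field_simp
    constructor
    · simpa [Q] using key 0
    · ext j
      have := key j.succ
      simp only [Q, Fin.cons_succ] at this
      simpa [Finset.sum_apply] using this

theorem deep_point (d : ℕ) : ∃ δ : ℝ, 0 < δ ∧ ∀ (V : Finset (Fin d → ℤ)) (x0 : Fin d → ℤ),
    intVec x0 ∈ interior (convexHull ℝ (intVec '' (V : Set (Fin d → ℤ)))) →
    ∃ p : Fin d → ℤ, intVec p ∈ convexHull ℝ (intVec '' (V : Set (Fin d → ℤ))) ∧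
      ∀ y ∈ convexHull ℝ (intVec '' (V : Set (Fin d → ℤ))),
        intVec p - δ • (y - intVec p) ∈ convexHull ℝ (intVec '' (V : Set (Fin d → ℤ))) := by
  classical
  obtain ⟨δ, hδ, hD⟩ := dioph (2 * d + 2)
  refine ⟨δ, hδ, ?_⟩
  intro V x0 hx0
  set P := convexHull ℝ (intVec '' (V : Set (Fin d → ℤ))) with hP
  have hPc : Convex ℝ P := convex_convexHull ℝ _
  have hVP : ∀ v ∈ V, intVec v ∈ P := fun v hv => subset_convexHull ℝ _ ⟨v, hv, rfl⟩
  have hspan : affineSpan ℝ (intVec '' (V : Set (Fin d → ℤ))) = ⊤ :=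
    interior_convexHull_nonempty_iff_affineSpan_eq_top.1 ⟨_, hx0⟩
  obtain ⟨v, hvV, hv⟩ := max_simplex d V hspan
  let g : Fin d → ℝ := ∑ i, ((1:ℝ) / (d + 1)) • intVec (v i)
  -- extension beyond x0
  obtain ⟨ε, hε, hz⟩ : ∃ ε : ℝ, 0 < ε ∧ intVec x0 + ε • (intVec x0 - g) ∈ P := by
    have hc : Continuous (fun ε : ℝ => intVec x0 + ε • (intVec x0 - g)) := by fun_prop
    have h1 : ∀ᶠ ε in nhds (0:ℝ), intVec x0 + ε • (intVec x0 - g) ∈ P := by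
      have := hc.tendsto 0
      simp only [zero_smul, add_zero] at this
      exact this (mem_interior_iff_mem_nhds.1 hx0)
    have h2 : ∀ᶠ ε in nhdsWithin (0:ℝ) (Set.Ioi 0), intVec x0 + ε • (intVec x0 - g) ∈ P :=
      h1.filter_mono nhdsWithin_le_nhds
    obtain ⟨ε, h3, h4⟩ := (h2.and self_mem_nhdsWithin).exists
    exact ⟨ε, h4, h3⟩
  obtain ⟨ι, _, u, w, hu, huind, hw, hwsum, hwz⟩ := eq_pos_convex_span_of_mem_convexHull hz
  have hcard : Fintype.card ι ≤ d + 1 := by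
    have := huind.card_le_finrank_succ
    refine this.trans ?_
    gcongr
    exact (Submodule.finrank_le _).trans (by simp)
  have hch : ∀ i, ∃ y ∈ V, intVec y = u i := by
    intro i
    obtain ⟨y, hy, h⟩ := hu ⟨i, rfl⟩
    exact ⟨y, hy, h⟩
  choose u' hu'V hu' using hch
  let pt : Fin (d+1) ⊕ ι → (Fin d → ℤ) := Sum.elim v u'
  let wt : Fin (d+1) ⊕ ι → ℝ := Sum.elim (fun _ => ε / (1 + ε) * (1 / (d + 1))) (fun i => 1 / (1 + ε) * w i)
  have hptV : ∀ k, pt k ∈ V := by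
    rintro (i | i)
    · exact hvV i
    · exact hu'V i
  have hwt : ∀ k, 0 < wt k := by
    rintro (i | i)
    · simp only [wt, Sum.elim_inl]; positivity
    · have := hw i
      simp only [wt, Sum.elim_inr]; positivity
  have hwt1 : ∑ k, wt k = 1 := by
    rw [Fintype.sum_sum_type]
    simp only [wt, Sum.elim_inl, Sum.elim_inr]
    rw [← Finset.mul_sum, ← Finset.mul_sum, hwsum]
    simp
    field_simp
    ring
  have hwtx : ∑ k, wt k • intVec (pt k) = intVec x0 := by
    rw [Fintype.sum_sum_type]
    simp only [wt, pt, Sum.elim_inl, Sum.elim_inr, mul_smul, hu']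
    have hg : g = ∑ i, ((1:ℝ) / (d + 1)) • intVec (v i) := rfl
    rw [← Finset.smul_sum, ← Finset.smul_sum (r := 1 / (1 + ε)), hwz, ← hg]
    ext j
    simp
    field_simp
    ring
  obtain ⟨m, n, hmn, hsum⟩ := hD (Fin (d+1) ⊕ ι) (by simp; omega) wt hwt hwt1
  set yy : Fin (d+1) ⊕ ι → ℝ := fun k => m * wt k + n k with hyy
  let p : Fin d → ℤ := m • x0 + ∑ k, n k • pt k
  have hp : intVec p = ∑ k, yy k • intVec (pt k) := by
    simp only [p, intVec_add, intVec_smul, intVec_sum, ← hwtx, hyy, add_smul, mul_smul]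
    rw [Finset.sum_add_distrib, Finset.smul_sum]
  refine ⟨p, ?_, ?_⟩
  · rw [hp]
    exact hPc.sum_mem (fun k _ => hδ.le.trans (hmn k)) hsum (fun k _ => hVP _ (hptV k))
  · have hconv : Convex ℝ {y | intVec p - δ • (y - intVec p) ∈ P} := by
      intro a ha b hb s t hs ht hst
      simp only [Set.mem_ofPred_eq] at ha hb ⊢
      have := hPc ha hb hs ht hst
      convert this using 1
      ext j
      simp
      have : t = 1 - s := by linarith
      subst this
      ring
    intro y hy
    refine convexHull_min ?_ hconv hy
    rintro _ ⟨y, hyV, rfl⟩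
    simp only [Set.mem_ofPred_eq]
    obtain ⟨β, hβ, hβ1, hβy⟩ := hv y hyV
    let bb : Fin (d+1) ⊕ ι → ℝ := Sum.elim β 0
    have hbb : ∀ k, bb k ≤ 1 := by
      rintro (i | i)
      · exact hβ i
      · simp [bb]
    have hbb1 : ∑ k, bb k = 1 := by
      rw [Fintype.sum_sum_type]; simpa [bb] using hβ1
    have hbby : ∑ k, bb k • intVec (pt k) = intVec y := by
      rw [Fintype.sum_sum_type]; simpa [bb, pt] using hβy
    have e : intVec p - δ • (intVec y - intVec p) = ∑ k, ((1 + δ) * yy k - δ * bb k) • intVec (pt k) := by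
      simp only [sub_smul, mul_smul, Finset.sum_sub_distrib, ← Finset.smul_sum]
      rw [← hp, hbby]
      module
    rw [e]
    apply hPc.sum_mem
    · intro k _
      have h1 := hmn k
      have h2 := hbb k
      have h3 : δ ≤ yy k := h1
      nlinarith
    · rw [Finset.sum_sub_distrib, ← Finset.mul_sum, ← Finset.mul_sum, hbb1, hsum]; ring
    · intro k _; exact hVP _ (hptV k)

end

-- part Box

section

theorem intVec_norm_finite (d : ℕ) (R : ℝ) : {x : Fin d → ℤ | ‖intVec x‖ ≤ R}.Finite := by
  have : {x : Fin d → ℤ | ‖intVec x‖ ≤ R} ⊆ Set.Icc (fun _ => -⌈R⌉) (fun _ => ⌈R⌉) := by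
    intro x hx
    simp only [Set.mem_ofPred_eq] at hx
    have h : ∀ i, |(x i : ℝ)| ≤ ⌈R⌉ := fun i =>
      ((norm_le_pi_norm (intVec x) i).trans hx).trans (Int.le_ceil R)
    constructor
    · intro i
      have := (abs_le.1 (h i)).1
      exact_mod_cast this
    · intro i
      have := (abs_le.1 (h i)).2
      exact_mod_cast this
  exact (Set.finite_Icc _ _).subset this

theorem polytope_bdd {d : ℕ} (V : Finset (Fin d → ℤ)) :
    Bornology.IsBounded (convexHull ℝ (intVec '' (V : Set (Fin d → ℤ)))) :=
  isBounded_convexHull.2 (V.finite_toSet.image _).isBounded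

theorem latticePts_finite {d : ℕ} (V : Finset (Fin d → ℤ)) :
    (latticePts d (convexHull ℝ (intVec '' (V : Set (Fin d → ℤ))))).Finite := by
  obtain ⟨R, hR⟩ := (polytope_bdd V).exists_norm_le
  exact (intVec_norm_finite d R).subset fun x hx => hR _ hx

theorem box_lemma (d : ℕ) : ∃ C : ℝ, 0 < C ∧ ∀ (V : Finset (Fin d → ℤ)) (x0 : Fin d → ℤ),
    intVec x0 ∈ interior (convexHull ℝ (intVec '' (V : Set (Fin d → ℤ)))) →
    ∃ (p : Fin d → ℤ) (b : Fin d → Fin d → ℤ) (t : Fin d → ℕ),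
      Submodule.span ℤ (Set.range b) = ⊤ ∧ (∀ i, 1 ≤ t i) ∧
      (∏ i, (t i : ℝ) ≤ C * (latticePts d (convexHull ℝ (intVec '' (V : Set (Fin d → ℤ))))).ncard) ∧
      ∀ x : Fin d → ℤ, p + ∑ i, x i • b i ∈ V → ∀ i, |x i| ≤ t i := by
  classical
  obtain ⟨δ, hδ, hdeep⟩ := deep_point d
  obtain ⟨c, hc, hred⟩ := reduced_basis d
  set δ' := min δ 1 with hδ'
  have hδ'0 : 0 < δ' := lt_min hδ one_pos
  set C1 := 1 / (δ' * c) with hC1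
  have hC1p : 0 < C1 := by positivity
  refine ⟨(C1 * (d + 1) + 1) ^ d, by positivity, ?_⟩
  intro V x0 hx0
  obtain ⟨p, hpP, hp⟩ := hdeep V x0 hx0
  set P := convexHull ℝ (intVec '' (V : Set (Fin d → ℤ))) with hP
  have hPc : Convex ℝ P := convex_convexHull ℝ _
  have hpint : intVec p ∈ interior P := by
    have h1 := hp _ (interior_subset hx0)
    have h2 := hPc.combo_self_interior_mem_interior h1 hx0 (a := 1 / (1 + δ)) (b := δ / (1 + δ))
      (by positivity) (by positivity) (by field_simp)
    convert h2 using 1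
    ext j
    simp
    field_simp
    ring
  let K : Set (Fin d → ℝ) := {z | intVec p + z ∈ P ∧ intVec p - z ∈ P}
  have hKc : Convex ℝ K := by
    intro x hx y hy s r hs hr hsr
    constructor
    · convert hPc hx.1 hy.1 hs hr hsr using 1
      obtain rfl : r = 1 - s := by linarith
      module
    · convert hPc hx.2 hy.2 hs hr hsr using 1
      obtain rfl : r = 1 - s := by linarith
      module
  have hKsymm : ∀ x ∈ K, -x ∈ K := by
    intro x hx
    refine ⟨?_, ?_⟩
    · rw [← sub_eq_add_neg]; exact hx.2
    · rw [sub_neg_eq_add]; exact hx.1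
  have hKn : K ∈ nhds (0 : Fin d → ℝ) := by
    have hPn := mem_interior_iff_mem_nhds.1 hpint
    have c1 : ContinuousAt (fun z : Fin d → ℝ => intVec p + z) 0 := by fun_prop
    have c2 : ContinuousAt (fun z : Fin d → ℝ => intVec p - z) 0 := by fun_prop
    have h1 : ∀ᶠ z in nhds (0 : Fin d → ℝ), intVec p + z ∈ P := c1 (by simpa using hPn)
    have h2 : ∀ᶠ z in nhds (0 : Fin d → ℝ), intVec p - z ∈ P := c2 (by simpa using hPn)
    exact h1.and h2
  have hKabs : Absorbent ℝ K := absorbent_nhds_zero hKn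
  have hK0 : (0 : Fin d → ℝ) ∈ K := mem_of_mem_nhds hKn
  obtain ⟨r, hr, hKr⟩ : ∃ r > 0, K ⊆ Metric.closedBall 0 r := by
    obtain ⟨R, hR⟩ := (polytope_bdd V).exists_norm_le
    refine ⟨|R| + ‖intVec p‖ + 1, by positivity, ?_⟩
    intro z hz
    have := hR _ hz.1
    rw [mem_closedBall_zero_iff]
    have h2 := norm_sub_le (intVec p + z) (intVec p)
    rw [add_sub_cancel_left] at h2
    linarith [le_abs_self R]
  let N : (Fin d → ℤ) → ℝ := fun z => gauge K (intVec z)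
  have hN : LNorm N := by
    refine ⟨?_, ?_, ?_⟩
    · intro x y
      simp only [N, intVec_add]
      exact gauge_add_le hKc hKabs _ _
    · intro k x
      simp only [N, intVec_smul]
      rcases le_total 0 (k : ℝ) with hk | hk
      · rw [gauge_smul_of_nonneg hk, abs_of_nonneg hk]; rfl
      · rw [abs_of_nonpos hk, ← gauge_neg hKsymm, ← neg_smul, gauge_smul_of_nonneg (by linarith)]; rfl
    · intro R
      refine (intVec_norm_finite d (R * r)).subset ?_
      intro x hx
      have h1 := le_gauge_of_subset_closedBall (x := intVec x) hKabs hr.le hKr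
      have h2 : N x ≤ R := hx
      have h3 := h1.trans h2
      rwa [div_le_iff₀ hr] at h3
  obtain ⟨b, hbspan, hb⟩ := hred (Fin d → ℤ) N hN (by simp)
  have hb0 : ∀ i, b i ≠ 0 := by
    intro i hi
    obtain ⟨B, hB⟩ : ∃ B : Matrix (Fin d) (Fin d) ℤ, B * Matrix.of b = 1 := by
      have : ∀ k, ∃ c : Fin d → ℤ, ∑ i, c i • b i = Pi.single k 1 := by
        intro k
        have : (Pi.single k 1 : Fin d → ℤ) ∈ Submodule.span ℤ (Set.range b) := by rw [hbspan]; trivial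
        exact (Submodule.mem_span_range_iff_exists_fun ℤ).1 this
      choose c hc using this
      refine ⟨Matrix.of c, ?_⟩
      ext k l
      have := congrFun (hc k) l
      simp only [Finset.sum_apply, Pi.smul_apply, smul_eq_mul] at this
      rw [Matrix.mul_apply]
      simp only [Matrix.of_apply, this, Matrix.one_apply, Pi.single_apply, eq_comm]
    have h2 := congrArg Matrix.det hB
    rw [Matrix.det_mul, Matrix.det_eq_zero_of_row_eq_zero (A := Matrix.of b) i (by intro j; simp [hi])] at h2
    simp at h2
  have hNb : ∀ i, 0 < N (b i) := fun i => hN.pos _ (hb0 i)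
  refine ⟨p, b, fun i => ⌈C1 / N (b i)⌉₊, hbspan, ?_, ?_, ?_⟩
  · intro i
    rw [Nat.one_le_ceil_iff]
    have := hNb i
    positivity
  · let k : Fin d → ℕ := fun i => ⌊1 / N (b i) / (d + 1)⌋₊
    have hcount : ∏ i, (2 * k i + 1) ≤ (latticePts d P).ncard := by
      have hinj : Function.Injective (fun x : Fin d → ℤ => p + ∑ i, x i • b i) := by
        intro x y hxy
        simp only [add_right_inj] at hxy
        have h1 : ∑ i, (x - y) i • b i = 0 := by
          simp only [Pi.sub_apply, sub_smul, Finset.sum_sub_distrib, hxy, sub_self]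
        have h2 := hb (x - y)
        rw [h1, hN.zero] at h2
        have h3 : ∑ i, |((x - y) i : ℝ)| * N (b i) ≤ 0 := by
          by_contra h; push Not at h; nlinarith [mul_pos hc h]
        have h4 := (Finset.sum_eq_zero_iff_of_nonneg (fun i _ => mul_nonneg (abs_nonneg _) (hNb i).le)).1
          (le_antisymm h3 (Finset.sum_nonneg (fun i _ => mul_nonneg (abs_nonneg _) (hNb i).le)))
        ext i
        have h5 := h4 i (Finset.mem_univ i)
        have h6 := (hNb i).ne'
        have h7 : |((x - y) i : ℝ)| = 0 := by
          rcases mul_eq_zero.1 h5 with h | h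
          · exact h
          · exact absurd h h6
        rw [abs_eq_zero] at h7
        have : (x - y) i = 0 := by exact_mod_cast h7
        simpa [sub_eq_zero] using this
      let F : Finset (Fin d → ℤ) := (Fintype.piFinset fun i => Finset.Icc (-(k i : ℤ)) (k i)).image
        (fun x : Fin d → ℤ => p + ∑ i, x i • b i)
      have hF : F.card = ∏ i, (2 * k i + 1) := by
        rw [Finset.card_image_of_injective _ hinj, Fintype.card_piFinset]
        apply Finset.prod_congr rfl
        intro i _
        rw [Int.card_Icc]
        omega
      rw [← hF, ← Set.ncard_coe_finset]
      apply Set.ncard_le_ncard _ (latticePts_finite V)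
      intro z hz
      obtain ⟨x, hx, rfl⟩ := Finset.mem_image.1 (Finset.mem_coe.1 hz)
      rw [Fintype.mem_piFinset] at hx
      have hlt : N (∑ i, x i • b i) < 1 := by
        refine lt_of_le_of_lt (hN.sum_le _ _) ?_
        have : ∀ i ∈ Finset.univ, N (x i • b i) ≤ 1 / (d + 1 : ℝ) := by
          intro i _
          rw [hN.smul]
          have h1 : |(x i : ℝ)| ≤ k i := by
            have := Finset.mem_Icc.1 (hx i)
            rw [abs_le]; exact ⟨by exact_mod_cast this.1, by exact_mod_cast this.2⟩
          have h2 : (k i : ℝ) ≤ 1 / N (b i) / (d + 1) := Nat.floor_le (by have := hNb i; positivity)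
          calc _ ≤ 1 / N (b i) / (d + 1) * N (b i) := by
                have := (hNb i).le
                gcongr; exact h1.trans h2
            _ = _ := by have := (hNb i).ne'; field_simp
        refine lt_of_le_of_lt (Finset.sum_le_sum this) ?_
        simp
        rw [← div_eq_mul_inv, div_lt_one (by positivity)]
        linarith
      have hmem : intVec (∑ i, x i • b i) ∈ K := setOfPred_gauge_lt_one_subset_self hKc hK0 hKabs hlt
      show intVec _ ∈ P
      rw [intVec_add]
      exact hmem.1
    have hprod : ∏ i, ((⌈C1 / N (b i)⌉₊ : ℕ) : ℝ) ≤ ∏ i, ((C1 * (d + 1) + 1) * (2 * k i + 1 : ℝ)) := by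
      apply Finset.prod_le_prod
      · intro i _; positivity
      · intro i _
        have h1 := (Nat.ceil_lt_add_one (a := C1 / N (b i)) (by have := hNb i; positivity)).le
        have h2 := (Nat.lt_floor_add_one (1 / N (b i) / (d + 1))).le
        change 1 / N (b i) / (d + 1) ≤ (k i : ℝ) + 1 at h2
        rw [div_le_iff₀ (by positivity)] at h2
        by_cases hk : k i = 0
        · rw [hk] at h2 ⊢
          have h3 : C1 / N (b i) ≤ C1 * (d + 1) := by
            rw [div_eq_mul_one_div]; gcongr; simpa using h2
          push_cast
          linarith
        · have hk1 : (1 : ℝ) ≤ k i := by exact_mod_cast Nat.one_le_iff_ne_zero.2 hk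
          have h3 : C1 / N (b i) ≤ C1 * (((k i : ℝ) + 1) * (d + 1)) := by
            rw [div_eq_mul_one_div]; gcongr
          refine h1.trans ((add_le_add_left h3 1).trans ?_)
          have : 0 ≤ C1 * ((d:ℝ) + 1) := by positivity
          nlinarith
    refine hprod.trans ?_
    rw [Finset.prod_mul_distrib]
    simp only [Finset.prod_const, Finset.card_univ, Fintype.card_fin]
    gcongr
    exact_mod_cast hcount
  · intro x hx i
    have hyP : intVec (p + ∑ i, x i • b i) ∈ P := subset_convexHull ℝ _ ⟨_, hx, rfl⟩
    set z := ∑ i, x i • b i with hz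
    have hmem : δ' • intVec z ∈ K := by
      have e1 : intVec (p + z) - intVec p = intVec z := by rw [intVec_add]; simp
      have h1 := hp _ hyP
      rw [e1] at h1
      constructor
      · have := hPc hpP hyP (a := 1 - δ') (b := δ') (by linarith [min_le_right δ 1]) hδ'0.le (by ring)
        convert this using 1
        rw [intVec_add]; module
      · have hle : δ' / δ ≤ 1 := by rw [div_le_one hδ]; exact min_le_left _ _
        have := hPc hpP h1 (a := 1 - δ' / δ) (b := δ' / δ) (by linarith) (by positivity) (by ring)
        convert this using 1
        ext j
        simp
        field_simp
        ring
    have hNz : N z ≤ 1 / δ' := by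
      apply gauge_le_of_mem (by positivity)
      refine ⟨_, hmem, ?_⟩
      simp only [smul_smul]
      rw [one_div, inv_mul_cancel₀ hδ'0.ne', one_smul]
    have h1 := (hb x).trans hNz
    have h2 : |(x i : ℝ)| * N (b i) ≤ ∑ i, |(x i : ℝ)| * N (b i) :=
      Finset.single_le_sum (f := fun i => |(x i : ℝ)| * N (b i)) (fun i _ => mul_nonneg (abs_nonneg _) (hNb i).le) (Finset.mem_univ i)
    have h3 : |(x i : ℝ)| ≤ C1 / N (b i) := by
      rw [le_div_iff₀ (hNb i), hC1, le_div_iff₀ (by positivity)]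
      have h4 : c * (|(x i : ℝ)| * N (b i)) ≤ 1 / δ' := le_trans (by gcongr) h1
      rw [le_div_iff₀ hδ'0] at h4
      linarith
    have h4 := h3.trans (Nat.le_ceil _)
    exact_mod_cast h4

end

-- part Box2

section

theorem equiv_box (n : ℕ) : ∃ C : ℝ, 0 < C ∧ ∀ (V : Finset (Fin (n+1) → ℤ)) (x0 : Fin (n+1) → ℤ),
    intVec x0 ∈ interior (convexHull ℝ (intVec '' (V : Set (Fin (n+1) → ℤ)))) →
    ∃ (V' : Finset (Fin (n+1) → ℤ)) (t : Fin (n+1) → ℕ),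
      LatticeEquiv (n+1) (convexHull ℝ (intVec '' (V : Set (Fin (n+1) → ℤ)))) (convexHull ℝ (intVec '' (V' : Set (Fin (n+1) → ℤ)))) ∧
      (∀ i, 1 ≤ t i) ∧ (∀ i, t i ≤ t 0) ∧
      (∏ i, (t i : ℝ) ≤ C * (latticePts (n+1) (convexHull ℝ (intVec '' (V : Set (Fin (n+1) → ℤ))))).ncard) ∧
      ∀ x ∈ V', ∀ i, |x i| ≤ t i := by
  classical
  obtain ⟨C, hC, hbox⟩ := box_lemma (n+1)
  refine ⟨C, hC, ?_⟩
  intro V x0 hx0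
  obtain ⟨p, b0, t0, hspan0, ht0, hprod0, hV0⟩ := hbox V x0 hx0
  obtain ⟨i0, -, hi0⟩ := Finset.exists_max_image (Finset.univ) t0 ⟨0, Finset.mem_univ _⟩
  let e : Equiv.Perm (Fin (n+1)) := Equiv.swap 0 i0
  let b := b0 ∘ e
  let t := t0 ∘ e
  have hspan : Submodule.span ℤ (Set.range b) = ⊤ := by
    rw [← hspan0]; congr 1; exact e.surjective.range_comp b0
  have hV : ∀ x : Fin (n+1) → ℤ, p + ∑ i, x i • b i ∈ V → ∀ i, |x i| ≤ t i := by
    intro x hx i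
    have := hV0 (x ∘ e.symm) (by
      convert hx using 2
      rw [← Equiv.sum_comp e]
      simp [b]) (e i)
    simpa [t] using this
  obtain ⟨A, hA⟩ : ∃ A : Matrix (Fin (n+1)) (Fin (n+1)) ℤ, A * Matrix.of b = 1 := by
    have : ∀ k, ∃ c : Fin (n+1) → ℤ, ∑ i, c i • b i = Pi.single k 1 := by
      intro k
      have : (Pi.single k 1 : Fin (n+1) → ℤ) ∈ Submodule.span ℤ (Set.range b) := by rw [hspan]; trivial
      exact (Submodule.mem_span_range_iff_exists_fun ℤ).1 this
    choose c hc using this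
    refine ⟨Matrix.of c, ?_⟩
    ext k l
    have := congrFun (hc k) l
    simp only [Finset.sum_apply, Pi.smul_apply, smul_eq_mul] at this
    rw [Matrix.mul_apply]
    simp only [Matrix.of_apply, this, Matrix.one_apply, Pi.single_apply, eq_comm]
  set B := Matrix.of b with hB
  have hA' : B * A = 1 := mul_eq_one_comm.1 hA
  let Ar : Matrix (Fin (n+1)) (Fin (n+1)) ℝ := A.map (Int.castRingHom ℝ)
  let Br : Matrix (Fin (n+1)) (Fin (n+1)) ℝ := B.map (Int.castRingHom ℝ)
  have hr1 : Ar * Br = 1 := by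
    rw [← Matrix.map_mul, hA, Matrix.map_one _ (by simp) (by simp)]
  have hr2 : Br * Ar = 1 := mul_eq_one_comm.1 hr1
  have hiv : ∀ (M : Matrix (Fin (n+1)) (Fin (n+1)) ℤ) (x : Fin (n+1) → ℤ),
      Matrix.vecMul (intVec x) (M.map (Int.castRingHom ℝ)) = intVec (Matrix.vecMul x M) := by
    intro M x
    ext j
    simp [Matrix.vecMul, dotProduct, intVec]
  let L : (Fin (n+1) → ℝ) ≃ₗ[ℝ] (Fin (n+1) → ℝ) := Matrix.toLinearEquivRight'OfInv hr2 hr1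
  have hL : ∀ x, L x = Matrix.vecMul x Ar := by
    intro x; rfl
  let σ : (Fin (n+1) → ℝ) ≃ᵃ[ℝ] (Fin (n+1) → ℝ) :=
    (AffineEquiv.constVAdd ℝ (Fin (n+1) → ℝ) (-intVec p)).trans L.toAffineEquiv
  have hσ : ∀ x, σ x = Matrix.vecMul (-intVec p + x) Ar := by intro x; rfl
  have hσi : ∀ x : Fin (n+1) → ℤ, σ (intVec x) = intVec (Matrix.vecMul (-p + x) A) := by
    intro x
    rw [hσ, ← hiv, intVec_add]
    congr 2
    have := intVec_smul (-1) p
    simpa using this.symm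
  refine ⟨V.image (fun x => Matrix.vecMul (-p + x) A), t, ⟨σ, ?_, ?_⟩, fun i => ht0 _, ?_, ?_, ?_⟩
  · ext y
    constructor
    · rintro ⟨_, ⟨x, rfl⟩, rfl⟩
      exact ⟨_, (hσi x).symm⟩
    · rintro ⟨x, rfl⟩
      refine ⟨intVec (p + Matrix.vecMul x B), ⟨_, rfl⟩, ?_⟩
      rw [hσi]
      simp [Matrix.vecMul_vecMul, hA']
  · have h1 := (σ : (Fin (n+1) → ℝ) →ᵃ[ℝ] (Fin (n+1) → ℝ)).image_convexHull (intVec '' (V : Set (Fin (n+1) → ℤ)))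
    simp only [AffineEquiv.coe_toAffineMap] at h1
    rw [h1, Finset.coe_image, Set.image_image, Set.image_image]
    congr 1
    apply Set.image_congr
    intro x _
    exact (hσi x).symm
  · intro i
    simp only [t, Function.comp, e, Equiv.swap_apply_left]
    exact hi0 _ (Finset.mem_univ _)
  · simp only [t, Function.comp]
    rw [Equiv.prod_comp e (fun i => (t0 i : ℝ))]
    exact hprod0
  · intro x hx
    obtain ⟨y, hy, rfl⟩ := Finset.mem_image.1 hx
    apply hV
    convert hy
    have h1 : ∀ x : Fin (n+1) → ℤ, ∑ i, x i • b i = Matrix.vecMul x B := by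
      intro x
      ext j
      simp [Matrix.vecMul, dotProduct, hB]
    rw [h1, Matrix.vecMul_vecMul, hA, Matrix.vecMul_one]
    simp

end

-- part Simp

section

/-- affine function with coefficient vector `q` -/
def lin {n : ℕ} (q : Fin (n+1) → ℝ) (x : Fin n → ℝ) : ℝ := q 0 + ∑ j, q j.succ * x j

/-- homogenised matrix of a tuple of points -/
def Mr {n : ℕ} {ι : Type} (pt : ι → Fin n → ℝ) (u : Fin (n+1) → ι) : Matrix (Fin (n+1)) (Fin (n+1)) ℝ :=
  Matrix.of fun k => (Fin.cons 1 (pt (u k)) : Fin (n+1) → ℝ)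

def qv {n : ℕ} {ι : Type} (pt : ι → Fin n → ℝ) (u : Fin (n+1) → ι) (h : ι → ℝ) : Fin (n+1) → ℝ :=
  Matrix.mulVec (Mr pt u)⁻¹ (h ∘ u)

def smx {n : ℕ} {ι : Type} (pt : ι → Fin n → ℝ) (u : Fin (n+1) → ι) : Set (Fin n → ℝ) :=
  convexHull ℝ (Set.range fun k => pt (u k))

theorem mem_convexHull_range' {ι : Type} [Fintype ι] {E : Type} [AddCommGroup E] [Module ℝ E] (f : ι → E) (x : E) :
    x ∈ convexHull ℝ (Set.range f) ↔ ∃ β : ι → ℝ, (∀ k, 0 ≤ β k) ∧ ∑ k, β k = 1 ∧ ∑ k, β k • f k = x := by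
  constructor
  · rw [convexHull_range_eq_exists_affineCombination]
    rintro ⟨s, w, hw, hw1, rfl⟩
    classical
    refine ⟨fun k => if k ∈ s then w k else 0, ?_, ?_, ?_⟩
    · intro k; dsimp only; split_ifs with h
      · exact hw k h
      · exact le_rfl
    · simpa using hw1
    · rw [Finset.affineCombination_eq_linear_combination _ _ _ hw1]
      simp [ite_smul]
  · rintro ⟨β, h0, h1, rfl⟩
    exact (convex_convexHull ℝ _).sum_mem (fun k _ => h0 k) h1 (fun k _ => subset_convexHull ℝ _ ⟨k, rfl⟩)

theorem lin_sum {n : ℕ} {κ : Type} [Fintype κ] (q : Fin (n+1) → ℝ) (β : κ → ℝ) (x : κ → Fin n → ℝ) (h : ∑ k, β k = 1) :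
    lin q (∑ k, β k • x k) = ∑ k, β k * lin q (x k) := by
  simp only [lin, mul_add, Finset.sum_add_distrib, ← Finset.sum_mul, h, one_mul, Finset.sum_apply, Pi.smul_apply, smul_eq_mul, Finset.mul_sum]
  congr 1
  rw [Finset.sum_comm]
  apply Finset.sum_congr rfl; intro k _
  apply Finset.sum_congr rfl; intro j _
  ring

section
variable {n : ℕ} {ι : Type} (pt : ι → Fin n → ℝ) (u : Fin (n+1) → ι)

theorem Mr_vecMul (β : Fin (n+1) → ℝ) :
    Matrix.vecMul β (Mr pt u) = (Fin.cons (∑ k, β k) (∑ k, β k • pt (u k)) : Fin (n+1) → ℝ) := by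
  ext j
  refine Fin.cases ?_ (fun j => ?_) j
  · simp [Matrix.vecMul, dotProduct, Mr]
  · simp [Matrix.vecMul, dotProduct, Mr, Finset.sum_apply]

theorem lin_qv (hD : (Mr pt u).det ≠ 0) (h : ι → ℝ) (k : Fin (n+1)) : lin (qv pt u h) (pt (u k)) = h (u k) := by
  have h1 : Matrix.mulVec (Mr pt u) (qv pt u h) = h ∘ u := by
    rw [qv, Matrix.mulVec_mulVec, Matrix.mul_nonsing_inv _ (isUnit_iff_ne_zero.2 hD), Matrix.one_mulVec]
  have h2 := congrFun h1 k
  simp only [Function.comp] at h2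
  rw [← h2]
  simp [Matrix.mulVec, dotProduct, Fin.sum_univ_succ, Mr, lin, mul_comm]

theorem bary_exists (hD : (Mr pt u).det ≠ 0) (x : Fin n → ℝ) :
    ∃ β : Fin (n+1) → ℝ, ∑ k, β k = 1 ∧ ∑ k, β k • pt (u k) = x := by
  refine ⟨Matrix.vecMul (Fin.cons 1 x) (Mr pt u)⁻¹, ?_⟩
  have h1 := Mr_vecMul pt u (Matrix.vecMul (Fin.cons 1 x) (Mr pt u)⁻¹)
  rw [Matrix.vecMul_vecMul, Matrix.nonsing_inv_mul _ (isUnit_iff_ne_zero.2 hD), Matrix.vecMul_one] at h1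
  rw [Fin.cons_inj] at h1
  exact ⟨h1.1.symm, h1.2.symm⟩

theorem det_update [DecidableEq ι] (i : ι) (k0 : Fin (n+1)) (γ : Fin (n+1) → ℝ) (h1 : ∑ k, γ k = 1) (h2 : ∑ k, γ k • pt (u k) = pt i) :
    (Mr pt (Function.update u k0 i)).det = γ k0 * (Mr pt u).det := by
  have : Mr pt (Function.update u k0 i) = (Mr pt u).updateRow k0 (∑ k, γ k • (Mr pt u) k) := by
    have e : (∑ k, γ k • (Mr pt u) k) = (Fin.cons 1 (pt i) : Fin (n+1) → ℝ) := by
      rw [← h1, ← h2, ← Mr_vecMul]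
      ext j
      simp [Matrix.vecMul, dotProduct, Finset.sum_apply]
    rw [e]
    ext k j
    by_cases hk : k = k0
    · subst hk; simp [Mr]
    · simp [Mr, Matrix.updateRow_ne hk, Function.update_of_ne hk]
  rw [this, Matrix.det_updateRow_sum, smul_eq_mul]

theorem inj_of_det [DecidableEq ι] (hD : (Mr pt u).det ≠ 0) : Function.Injective u := by
  intro a b hab
  by_contra hne
  exact hD (Matrix.det_zero_of_row_eq hne (by unfold Mr; ext j; simp [hab]))

/-- the null set of degenerate points -/
def nullN (pt : ι → Fin n → ℝ) : Set (Fin n → ℝ) :=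
  ⋃ s : {s : Finset ι // s.card ≤ n}, (affineSpan ℝ (pt '' (s.1 : Set ι)) : Set (Fin n → ℝ))

theorem nullN_null [Finite ι] : volume (nullN pt) = 0 := by
  classical
  have := Fintype.ofFinite ι
  apply measure_iUnion_null
  rintro ⟨s, hs⟩
  apply Measure.addHaar_affineSubspace
  intro htop
  obtain ⟨k, hk⟩ : ∃ k, s.card = k + 1 := by
    rcases Nat.eq_zero_or_pos s.card with h | h
    · rw [Finset.card_eq_zero] at h
      subst h
      simp at htop
    · exact ⟨s.card - 1, by omega⟩
  have h1 := finrank_vectorSpan_image_finset_le ℝ pt s hk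
  have h2 : vectorSpan ℝ ((s.image pt : Finset _) : Set (Fin n → ℝ)) = ⊤ := by
    rw [← direction_affineSpan, Finset.coe_image, htop, AffineSubspace.direction_top]
  rw [h2, finrank_top] at h1
  simp at h1
  omega

theorem pos_of_not_null [DecidableEq ι] (x : Fin n → ℝ) (hx : x ∉ nullN pt) (β : Fin (n+1) → ℝ) (h1 : ∑ k, β k = 1)
    (h2 : ∑ k, β k • pt (u k) = x) : ∀ k, β k ≠ 0 := by
  intro k hk
  apply hx
  refine Set.mem_iUnion.2 ⟨⟨(Finset.univ.erase k).image u, ?_⟩, ?_⟩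
  · refine Finset.card_image_le.trans ?_
    simp
  · have hs : ∑ i ∈ Finset.univ.erase k, β i = 1 := by
      rw [← h1, ← Finset.add_sum_erase _ _ (Finset.mem_univ k), hk, zero_add]
    have := affineCombination_mem_affineSpan_image (k := ℝ) (s := Finset.univ.erase k) (w := β) hs (s' := {k}ᶜ) (by intro i hi hi'; simp at hi'; simp [hi'] at hi) (fun k => pt (u k))
    rw [Finset.affineCombination_eq_linear_combination _ _ _ hs] at this
    have e : ∑ i ∈ Finset.univ.erase k, β i • pt (u i) = x := by
      rw [← h2, ← Finset.add_sum_erase _ _ (Finset.mem_univ k), hk, zero_smul, zero_add]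
    rw [e] at this
    have e2 : pt '' (((Finset.univ.erase k).image u : Finset ι) : Set ι) = (fun k => pt (u k)) '' {k}ᶜ := by
      rw [Finset.coe_image, Set.image_image]
      congr 1
      ext; simp
    rw [e2]
    exact this
end

theorem exists_simplex {n : ℕ} {ι : Type} [Fintype ι] (pt : ι → Fin n → ℝ) (x : Fin n → ℝ)
    (hx : x ∈ convexHull ℝ (Set.range pt)) (hxN : x ∉ nullN pt) : ∃ u : Fin (n+1) → ι, (Mr pt u).det ≠ 0 ∧ x ∈ smx pt u := by
  classical
  obtain ⟨κ, _, z, w, hz, hind, hw, hw1, hwx⟩ := eq_pos_convex_span_of_mem_convexHull hx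
  have hcard : Fintype.card κ ≤ n + 1 := by
    have := hind.card_le_finrank_succ
    refine this.trans ?_
    gcongr
    exact (Submodule.finrank_le _).trans (by simp)
  have hch : ∀ k, ∃ i, pt i = z k := fun k => hz ⟨k, rfl⟩
  choose r hr using hch
  have hxs : x ∈ convexHull ℝ (Set.range fun k => pt (r k)) := by
    rw [mem_convexHull_range']
    exact ⟨w, fun k => (hw k).le, hw1, by simpa [hr] using hwx⟩
  have hcard2 : Fintype.card κ = n + 1 := by
    by_contra hne
    apply hxN
    refine Set.mem_iUnion.2 ⟨⟨Finset.univ.image r, ?_⟩, ?_⟩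
    · refine Finset.card_image_le.trans ?_
      rw [Finset.card_univ]; omega
    · apply convexHull_subset_affineSpan
      convert hxs using 2
      rw [Finset.coe_image, Set.image_image]; simp
  let e : Fin (n+1) ≃ κ := (Fintype.equivFinOfCardEq hcard2).symm
  refine ⟨r ∘ e, ?_, ?_⟩
  · intro hdet
    obtain ⟨g, hg, hg0⟩ := Matrix.exists_vecMul_eq_zero_iff.2 hdet
    rw [Mr_vecMul] at hg0
    have hind2 : AffineIndependent ℝ (fun i => (z (e i) : Fin n → ℝ)) := hind.comp_embedding e.toEmbedding
    rw [affineIndependent_iff] at hind2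
    apply hg
    ext i
    refine hind2 Finset.univ g ?_ ?_ i (Finset.mem_univ i)
    · simpa using congrFun hg0 0
    · ext j
      have := congrFun hg0 j.succ
      simpa [hr, Function.comp] using this
  · unfold smx
    convert hxs using 2
    exact e.surjective.range_comp (fun k => pt (r k))

/-- pivoting -/
theorem cover_exists {n : ℕ} {ι : Type} [Fintype ι] (pt : ι → Fin n → ℝ) (h : ι → ℝ) (x : Fin n → ℝ)
    (hx : x ∈ convexHull ℝ (Set.range pt)) (hxN : x ∉ nullN pt) :
    ∃ u : Fin (n+1) → ι, (Mr pt u).det ≠ 0 ∧ x ∈ smx pt u ∧ ∀ i, h i ≤ lin (qv pt u h) (pt i) := by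
  classical
  let T : Finset (Fin (n+1) → ι) := Finset.univ.filter fun u => (Mr pt u).det ≠ 0 ∧ x ∈ smx pt u
  obtain ⟨u0, hu0⟩ := exists_simplex pt x hx hxN
  obtain ⟨u, huT, hmax⟩ := Finset.exists_max_image T (fun u => lin (qv pt u h) x) ⟨u0, by simpa [T] using hu0⟩
  obtain ⟨hD, hxu⟩ : (Mr pt u).det ≠ 0 ∧ x ∈ smx pt u := by simpa [T] using huT
  refine ⟨u, hD, hxu, ?_⟩
  intro i
  by_contra hlt
  push Not at hlt
  obtain ⟨β, hβ0, hβ1, hβx⟩ := (mem_convexHull_range' _ _).1 hxu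
  have hβpos : ∀ k, 0 < β k := fun k => lt_of_le_of_ne (hβ0 k) (pos_of_not_null pt u x hxN β hβ1 hβx k).symm
  obtain ⟨γ, hγ1, hγx⟩ := bary_exists pt u hD (pt i)
  have hγ : ∃ k, 0 < γ k := by
    by_contra hc
    push Not at hc
    have : ∑ k, γ k ≤ 0 := Finset.sum_nonpos fun k _ => hc k
    linarith
  obtain ⟨k0, hk0, hmin⟩ := Finset.exists_min_image (Finset.univ.filter fun k => 0 < γ k) (fun k => β k / γ k)
    (by obtain ⟨k, hk⟩ := hγ; exact ⟨k, by simpa using hk⟩)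
  have hγ0 : 0 < γ k0 := by simpa using hk0
  set s := β k0 / γ k0 with hs
  have hspos : 0 < s := div_pos (hβpos k0) hγ0
  have hk00 : β k0 - s * γ k0 = 0 := by rw [hs]; field_simp; ring
  have hnn : ∀ k, 0 ≤ β k - s * γ k := by
    intro k
    rcases lt_or_ge 0 (γ k) with hk | hk
    · have := hmin k (by simpa using hk)
      rw [le_div_iff₀ hk] at this
      linarith
    · nlinarith [hβpos k]
  let u' := Function.update u k0 i
  have hD' : (Mr pt u').det ≠ 0 := by
    rw [det_update pt u i k0 γ hγ1 hγx]
    exact mul_ne_zero hγ0.ne' hD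
  let β' : Fin (n+1) → ℝ := Function.update (fun k => β k - s * γ k) k0 s
  have hsumf : ∀ (F : Type) [AddCommGroup F] [Module ℝ F] (g : ι → F),
      ∑ k, β' k • g (u' k) = ∑ k, (β k - s * γ k) • g (u k) + s • g i := by
    intro F _ _ g
    rw [← Finset.add_sum_erase _ _ (Finset.mem_univ k0), ← Finset.add_sum_erase _ (fun k => (β k - s * γ k) • g (u k)) (Finset.mem_univ k0), hk00, zero_smul, zero_add, add_comm]
    congr 1
    · apply Finset.sum_congr rfl
      intro k hk
      have : k ≠ k0 := Finset.ne_of_mem_erase hk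
      simp [β', u', Function.update_of_ne this]
    · simp [β', u']
  have hβ'1 : ∑ k, β' k = 1 := by
    have := hsumf ℝ (fun _ => 1)
    simp only [smul_eq_mul, mul_one] at this
    rw [this, Finset.sum_sub_distrib, ← Finset.mul_sum, hβ1, hγ1]; ring
  have hβ'x : ∑ k, β' k • pt (u' k) = x := by
    rw [hsumf _ pt]
    simp only [sub_smul, Finset.sum_sub_distrib, mul_smul, ← Finset.smul_sum, hβx, hγx]
    simp
  have hval : lin (qv pt u' h) x = lin (qv pt u h) x + s * (h i - lin (qv pt u h) (pt i)) := by
    rw [← hβ'x, lin_sum _ _ _ hβ'1]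
    simp only [lin_qv pt u' hD']
    have := hsumf ℝ h
    simp only [smul_eq_mul] at this
    rw [this, hβ'x, ← hβx, lin_sum _ _ _ hβ1, ← hγx, lin_sum _ _ _ hγ1]
    simp only [lin_qv pt u hD]
    simp only [sub_mul, Finset.sum_sub_distrib, mul_assoc, ← Finset.mul_sum]
    ring
  have h1 := hmax u' (by
    simp only [T, Finset.mem_filter, Finset.mem_univ, true_and]
    refine ⟨hD', (mem_convexHull_range' _ _).2 ⟨β', ?_, hβ'1, hβ'x⟩⟩
    intro k
    by_cases hk : k = k0
    · subst hk; simp [β', hspos.le]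
    · simp [β', Function.update_of_ne hk]; linarith [hnn k])
  rw [hval] at h1
  nlinarith [mul_pos hspos (sub_pos.2 hlt)]

end

-- part Simp2

section

def stdS (n : ℕ) : Set (Fin n → ℝ) := {y | (∀ k, 0 ≤ y k) ∧ ∑ k, y k ≤ 1}

def vS (n : ℕ) : ℝ := (volume (stdS n)).toReal

theorem stdS_sub (n : ℕ) : stdS n ⊆ Set.Icc 0 1 := by
  intro y hy
  refine ⟨fun k => hy.1 k, fun k => ?_⟩
  exact (Finset.single_le_sum (f := y) (fun k _ => hy.1 k) (Finset.mem_univ k)).trans hy.2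

theorem stdS_fin (n : ℕ) : volume (stdS n) ≠ ⊤ := by
  refine ((measure_mono (stdS_sub n)).trans_lt ?_).ne
  rw [Real.volume_Icc_pi]
  simp

theorem vS_pos (n : ℕ) : 0 < vS n := by
  refine ENNReal.toReal_pos ?_ (stdS_fin n)
  have hsub : Set.Icc (0 : Fin n → ℝ) (fun _ => 1 / (n + 1 : ℝ)) ⊆ stdS n := by
    intro y hy
    refine ⟨fun k => hy.1 k, ?_⟩
    refine (Finset.sum_le_sum fun k _ => hy.2 k).trans ?_
    simp
    rw [← div_eq_mul_inv, div_le_one (by positivity)]; linarith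
  have : 0 < volume (Set.Icc (0 : Fin n → ℝ) (fun _ => 1 / (n + 1 : ℝ))) := by
    rw [Real.volume_Icc_pi]
    rw [pos_iff_ne_zero, Finset.prod_ne_zero_iff]
    intro i _
    simp
    positivity
  exact (this.trans_le (measure_mono hsub)).ne'

theorem det_Mr {n : ℕ} {ι : Type} (pt : ι → Fin n → ℝ) (u : Fin (n+1) → ι) :
    (Mr pt u).det = (Matrix.of fun k : Fin n => pt (u k.succ) - pt (u 0)).det := by
  let B : Matrix (Fin (n+1)) (Fin (n+1)) ℝ := Matrix.of
    (Fin.cons (Fin.cons 1 (pt (u 0)) : Fin (n+1) → ℝ) (fun k : Fin n => (Fin.cons 0 (pt (u k.succ) - pt (u 0)) : Fin (n+1) → ℝ)))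
  have h1 : (Mr pt u).det = B.det := by
    refine Matrix.det_eq_of_forall_row_eq_smul_add_const (Fin.cons 0 (fun _ => 1)) 0 (by simp) ?_
    intro i j
    refine Fin.cases ?_ (fun i => ?_) i
    · simp [Mr, B]
    · refine Fin.cases ?_ (fun j => ?_) j
      · simp [Mr, B]
      · simp [Mr, B]
  rw [h1, Matrix.det_succ_column_zero, Fin.sum_univ_succ]
  simp only [B, Matrix.of_apply, Fin.cons_zero, Fin.cons_succ, mul_zero, zero_mul, Finset.sum_const_zero, add_zero]
  simp
  congr 1

theorem volume_smx {n : ℕ} {ι : Type} (pt : ι → Fin n → ℝ) (u : Fin (n+1) → ι) :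
    volume (smx pt u) = ENNReal.ofReal (|(Mr pt u).det| * vS n) := by
  set A : Matrix (Fin n) (Fin n) ℝ := Matrix.of fun k : Fin n => pt (u k.succ) - pt (u 0) with hA
  have hAy : ∀ y, Matrix.toLin' A.transpose y = ∑ k, y k • (pt (u k.succ) - pt (u 0)) := by
    intro y
    ext j
    simp [Matrix.mulVec, dotProduct, hA, Finset.sum_apply, mul_comm]
  have hset : smx pt u = (fun z => pt (u 0) + z) '' (Matrix.toLin' A.transpose '' stdS n) := by
    ext x
    unfold smx
    rw [mem_convexHull_range', Set.image_image]
    constructor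
    · rintro ⟨β, h0, h1, rfl⟩
      rw [Fin.sum_univ_succ] at h1
      refine ⟨fun k => β k.succ, ⟨fun k => h0 _, by linarith [h0 0]⟩, ?_⟩
      simp only [hAy]
      rw [Fin.sum_univ_succ]
      simp only [smul_sub, Finset.sum_sub_distrib, ← Finset.sum_smul]
      rw [show β 0 = 1 - ∑ i : Fin n, β i.succ by linarith]
      module
    · rintro ⟨y, hy, rfl⟩
      refine ⟨Fin.cons (1 - ∑ k, y k) y, ?_, ?_, ?_⟩
      · intro k
        refine Fin.cases ?_ (fun k => ?_) k
        · simpa using hy.2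
        · simpa using hy.1 k
      · simp [Fin.sum_univ_succ]
      · simp only [hAy]
        rw [Fin.sum_univ_succ]
        simp only [Fin.cons_zero, Fin.cons_succ, smul_sub, Finset.sum_sub_distrib, ← Finset.sum_smul]
        module
  rw [hset, Set.image_add_left, measure_preimage_add, Measure.addHaar_image_linearMap, LinearMap.det_toLin', Matrix.det_transpose,
    det_Mr, ENNReal.ofReal_mul (abs_nonneg _), vS, ENNReal.ofReal_toReal (stdS_fin n)]

theorem exists_generic {n : ℕ} {ι : Type} [Fintype ι] (pt : ι → Fin n → ℝ) (h : ι → ℝ) :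
    ∃ h' : ι → ℝ, (∀ u : Fin (n+1) → ι, ∀ i, i ∉ Set.range u → lin (qv pt u h') (pt i) ≠ h' i) ∧
      (∀ u : Fin (n+1) → ι, (∀ i, h' i ≤ lin (qv pt u h') (pt i)) → ∀ i, h i ≤ lin (qv pt u h) (pt i)) := by
  classical
  have hcont : ∀ (u : Fin (n+1) → ι) (i : ι), Continuous fun g : ι → ℝ => lin (qv pt u g) (pt i) := by
    intro u i
    unfold lin qv
    simp only [Matrix.mulVec, dotProduct, Function.comp]
    fun_prop
  have hopen : ∀ᶠ g in nhds h, ∀ (u : Fin (n+1) → ι) (i : ι), lin (qv pt u h) (pt i) < h i → lin (qv pt u g) (pt i) < g i := by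
    rw [Filter.eventually_all]; intro u
    rw [Filter.eventually_all]; intro i
    by_cases hc : lin (qv pt u h) (pt i) < h i
    · have := (hcont u i).continuousAt.eventually_lt (continuous_apply i).continuousAt hc
      filter_upwards [this] with g hg _ using hg
    · exact Filter.Eventually.of_forall fun g hg => absurd hg hc
  have hnull : ∀ᵐ g : ι → ℝ, ∀ u : Fin (n+1) → ι, ∀ i, i ∉ Set.range u → lin (qv pt u g) (pt i) ≠ g i := by
    rw [ae_all_iff]; intro u
    rw [ae_all_iff]; intro i
    by_cases hi : i ∈ Set.range u
    · exact Filter.Eventually.of_forall fun g hg => absurd hi hg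
    let W : Submodule ℝ (ι → ℝ) :=
      { carrier := {g | lin (qv pt u g) (pt i) = g i}
        add_mem' := by
          intro a b ha hb
          simp only [Set.mem_ofPred_eq] at ha hb ⊢
          rw [Pi.add_apply, ← ha, ← hb]
          have : qv pt u (a + b) = qv pt u a + qv pt u b := by
            unfold qv; rw [← Matrix.mulVec_add]; rfl
          rw [this]
          simp only [lin, Pi.add_apply, add_mul, Finset.sum_add_distrib]
          ring
        zero_mem' := by
          have : qv pt u 0 = 0 := by
            unfold qv; exact Matrix.mulVec_zero _
          simp [this, lin]
        smul_mem' := by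
          intro c a ha
          simp only [Set.mem_ofPred_eq] at ha ⊢
          rw [Pi.smul_apply, ← ha]
          have : qv pt u (c • a) = c • qv pt u a := by
            unfold qv; rw [← Matrix.mulVec_smul]; rfl
          rw [this]
          simp only [lin, Pi.smul_apply, smul_eq_mul, mul_add, Finset.mul_sum, mul_assoc] }
    have hW : W ≠ ⊤ := by
      intro htop
      have : (Pi.single i 1 : ι → ℝ) ∈ W := by rw [htop]; trivial
      change lin (qv pt u (Pi.single i 1)) (pt i) = (Pi.single i 1 : ι → ℝ) i at this
      have h0 : (Pi.single i 1 : ι → ℝ) ∘ u = 0 := by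
        ext k
        have : u k ≠ i := fun e => hi ⟨k, e⟩
        simp [this]
      rw [qv, h0, Matrix.mulVec_zero] at this
      simp [lin] at this
    have := Measure.addHaar_submodule (volume : Measure (ι → ℝ)) W hW
    have h2 : ∀ᵐ g : ι → ℝ, g ∉ (W : Set (ι → ℝ)) := measure_eq_zero_iff_ae_notMem.1 this
    filter_upwards [h2] with g hg _ using hg
  have hpos : 0 < volume {g : ι → ℝ | ∀ (u : Fin (n+1) → ι) (i : ι), lin (qv pt u h) (pt i) < h i → lin (qv pt u g) (pt i) < g i} :=
    Measure.measure_pos_of_mem_nhds _ hopen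
  obtain ⟨g, hg1, hg2⟩ : ∃ g, (∀ (u : Fin (n+1) → ι) (i : ι), lin (qv pt u h) (pt i) < h i → lin (qv pt u g) (pt i) < g i) ∧
      ∀ u : Fin (n+1) → ι, ∀ i, i ∉ Set.range u → lin (qv pt u g) (pt i) ≠ g i := by
    have hfr : ∃ᵐ g : ι → ℝ, (∀ (u : Fin (n+1) → ι) (i : ι), lin (qv pt u h) (pt i) < h i → lin (qv pt u g) (pt i) < g i) :=
      frequently_ae_iff.2 hpos.ne'
    exact (hfr.and_eventually hnull).exists
  refine ⟨g, hg2, ?_⟩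
  intro u hu i
  by_contra hc
  push Not at hc
  exact absurd (hu i) (not_le.2 (hg1 u i hc))

/-- regular triangulation refining the upper hull of `h` -/
theorem triangulation {n : ℕ} {ι : Type} [Fintype ι] [DecidableEq ι] (pt : ι → Fin n → ℝ) (h : ι → ℝ) :
    ∃ T : Finset (Fin (n+1) → ι), (∀ u ∈ T, (Mr pt u).det ≠ 0 ∧ ∀ i, h i ≤ lin (qv pt u h) (pt i)) ∧
      (∀ u ∈ T, ∀ u' ∈ T, u ≠ u' → volume (smx pt u ∩ smx pt u') = 0) ∧
      volume (convexHull ℝ (Set.range pt) \ ⋃ u ∈ T, smx pt u) = 0 := by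
  classical
  obtain ⟨h', hgen, hgood⟩ := exists_generic pt h
  let G : Finset (Fin (n+1) → ι) := Finset.univ.filter fun u => (Mr pt u).det ≠ 0 ∧ ∀ i, h' i ≤ lin (qv pt u h') (pt i)
  have hG : ∀ u, u ∈ G ↔ (Mr pt u).det ≠ 0 ∧ ∀ i, h' i ≤ lin (qv pt u h') (pt i) := by intro u; simp [G]
  let F : Finset (Set ι) := G.image fun u => Set.range u
  have hrep : ∀ s : F, ∃ u ∈ G, Set.range u = s.1 := by
    rintro ⟨s, hs⟩
    obtain ⟨u, hu, rfl⟩ := Finset.mem_image.1 hs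
    exact ⟨u, hu, rfl⟩
  choose r hrG hr using hrep
  refine ⟨Finset.univ.image r, ?_, ?_, ?_⟩
  · intro u hu
    obtain ⟨s, -, rfl⟩ := Finset.mem_image.1 hu
    have := (hG _).1 (hrG s)
    exact ⟨this.1, hgood _ this.2⟩
  · intro u hu u' hu' hne
    obtain ⟨s, -, rfl⟩ := Finset.mem_image.1 hu
    obtain ⟨s', -, rfl⟩ := Finset.mem_image.1 hu'
    have hss : s ≠ s' := fun e => hne (by rw [e])
    refine measure_mono_null ?_ (nullN_null pt)
    rintro x ⟨hx, hx'⟩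
    by_contra hxN
    have key : ∀ a b : F, x ∈ smx pt (r a) → x ∈ smx pt (r b) → lin (qv pt (r b) h') x ≤ lin (qv pt (r a) h') x := by
      intro a b ha hb
      obtain ⟨β, hβ0, hβ1, hβx⟩ := (mem_convexHull_range' _ _).1 hb
      rw [← hβx, lin_sum _ _ _ hβ1, lin_sum _ _ _ hβ1]
      apply Finset.sum_le_sum
      intro k _
      rw [lin_qv _ _ ((hG _).1 (hrG b)).1]
      exact mul_le_mul_of_nonneg_left (((hG _).1 (hrG a)).2 _) (hβ0 k)
    have key2 : ∀ a b : F, x ∈ smx pt (r a) → x ∈ smx pt (r b) → Set.range (r b) ⊆ Set.range (r a) := by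
      intro a b ha hb
      have e := le_antisymm (key a b ha hb) (key b a hb ha)
      obtain ⟨β, hβ0, hβ1, hβx⟩ := (mem_convexHull_range' _ _).1 hb
      have hβpos : ∀ k, 0 < β k := fun k => lt_of_le_of_ne (hβ0 k) (pos_of_not_null pt _ x hxN β hβ1 hβx k).symm
      rw [← hβx, lin_sum _ _ _ hβ1, lin_sum _ _ _ hβ1] at e
      have e2 := (Finset.sum_eq_sum_iff_of_le (fun k _ => by
        rw [lin_qv _ _ ((hG _).1 (hrG b)).1]
        exact mul_le_mul_of_nonneg_left (((hG _).1 (hrG a)).2 _) (hβ0 k))).1 e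
      rintro _ ⟨k, rfl⟩
      by_contra hk
      have e3 := mul_left_cancel₀ (hβpos k).ne' (e2 k (Finset.mem_univ k))
      rw [lin_qv _ _ ((hG _).1 (hrG b)).1] at e3
      exact hgen _ _ hk e3.symm
    apply hss
    have := Set.Subset.antisymm (key2 s' s hx' hx) (key2 s s' hx hx')
    rw [hr, hr] at this
    exact Subtype.ext this
  · refine measure_mono_null ?_ (nullN_null pt)
    rintro x ⟨hx, hx'⟩
    by_contra hxN
    apply hx'
    obtain ⟨u, hD, hxu, hu⟩ := cover_exists pt h' x hx hxN
    have huG : u ∈ G := (hG u).2 ⟨hD, hu⟩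
    let s : F := ⟨Set.range u, Finset.mem_image.2 ⟨u, huG, rfl⟩⟩
    refine Set.mem_iUnion₂.2 ⟨r s, Finset.mem_image.2 ⟨s, Finset.mem_univ _, rfl⟩, ?_⟩
    have e : Set.range (fun k => pt (r s k)) = Set.range (fun k => pt (u k)) := by
      have h1 := hr s
      rw [Set.range_comp' pt (r s), Set.range_comp' pt u, h1]
    unfold smx at hxu ⊢
    rw [e]; exact hxu

end

-- part UData

section

structure UD {n : ℕ} (P : Set (Fin (n+1) → ℝ)) (S : Finset (Fin n → ℝ)) (a : (Fin n → ℝ) → Fin (n+1) → ℤ)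
    (c : (Fin n → ℝ) → ℝ) (C : (Fin n → ℝ) → Set (Fin n → ℝ)) : Prop where
  a0 : ∀ p ∈ S, 1 ≤ a p 0
  ap : ∀ p ∈ S, ∀ j : Fin n, (a p j.succ : ℝ) = a p 0 * p j
  vol : ∀ p ∈ S, volume (C p) = ENNReal.ofReal (vS n * a p 0)
  cpt : ∀ p ∈ S, IsCompact (C p)
  sup : ∀ p ∈ S, ∀ z ∈ P, z 0 ≤ c p + ∑ j : Fin n, p j * z j.succ
  mem : ∀ p ∈ S, ∀ x ∈ C p, (Fin.cons (c p + ∑ j, p j * x j) x : Fin (n+1) → ℝ) ∈ P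
  disj : ∀ p ∈ S, ∀ p' ∈ S, p ≠ p' → volume (C p ∩ C p') = 0
  cover : volume ((fun z => Fin.tail z) '' P \ ⋃ p ∈ S, C p) = 0

theorem exists_UD {n : ℕ} (V : Finset (Fin (n+1) → ℤ)) :
    ∃ S a c C, UD (convexHull ℝ (intVec '' (V : Set (Fin (n+1) → ℤ)))) S a c C := by
  classical
  let ι := {x // x ∈ V}
  let pt : ι → Fin n → ℝ := fun i => intVec (Fin.tail i.1)
  let h : ι → ℝ := fun i => (i.1 0 : ℝ)
  obtain ⟨T, hT, hdis, hcov⟩ := triangulation pt h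
  let g : (Fin (n+1) → ι) → Fin n → ℝ := fun u => Fin.tail (qv pt u h)
  let Mz : (Fin (n+1) → ι) → Matrix (Fin (n+1)) (Fin (n+1)) ℤ := fun u =>
    Matrix.of fun k => (Fin.cons 1 (Fin.tail (u k).1) : Fin (n+1) → ℤ)
  have hMz : ∀ u, (Mz u).map (Int.castRingHom ℝ) = Mr pt u := by
    intro u
    ext k j
    refine Fin.cases ?_ (fun j => ?_) j
    · simp [Mz, Mr]
    · simp [Mz, Mr, pt, intVec]
  have hdet : ∀ u, (Mr pt u).det = ((Mz u).det : ℝ) := by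
    intro u
    rw [← hMz]
    have := (RingHom.map_det (Int.castRingHom ℝ) (Mz u)).symm
    simpa using this
  have hint : ∀ u ∈ T, ∀ j, ∃ z : ℤ, (z : ℝ) = ((|(Mz u).det| : ℤ) : ℝ) * g u j := by
    intro u hu j
    have hD := (hT u hu).1
    refine ⟨((Mz u).det.sign) * (Matrix.mulVec (Mz u).adjugate (fun k => (u k).1 0) j.succ), ?_⟩
    have e1 : (Mr pt u).det * g u j = ((Matrix.mulVec (Mz u).adjugate (fun k => (u k).1 0) j.succ : ℤ) : ℝ) := by
      simp only [g, Fin.tail, qv, Matrix.inv_def, Ring.inverse_eq_inv', Matrix.smul_mulVec, Pi.smul_apply, smul_eq_mul]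
      rw [← mul_assoc, mul_inv_cancel₀ hD, one_mul, ← hMz]
      have := RingHom.map_adjugate (Int.castRingHom ℝ) (Mz u)
      rw [RingHom.mapMatrix_apply, RingHom.mapMatrix_apply] at this
      rw [← this]
      simp [Matrix.mulVec, dotProduct, h]
    push_cast
    rw [← e1, hdet, ← mul_assoc]
    congr 1
    have := Int.sign_mul_self_eq_abs (Mz u).det
    exact_mod_cast this
  choose! zi hzi using hint
  let S := T.image g
  let f : (Fin n → ℝ) → Finset (Fin (n+1) → ι) := fun p => T.filter fun u => g u = p
  have hf : ∀ p u, u ∈ f p ↔ u ∈ T ∧ g u = p := by intro p u; simp [f]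
  have hlin : ∀ u ∈ T, ∀ x, lin (qv pt u h) x = qv pt u h 0 + ∑ j, g u j * x j := by
    intro u _ x; rfl
  let c : (Fin n → ℝ) → ℝ := fun p => if hp : ∃ u, u ∈ f p then qv pt hp.choose h 0 else 0
  have hc : ∀ p u, u ∈ f p → c p = qv pt u h 0 := by
    intro p u hu
    have hp : ∃ u, u ∈ f p := ⟨u, hu⟩
    have hspec := hp.choose_spec
    simp only [c, dif_pos hp]
    have key : ∀ a b, a ∈ f p → b ∈ f p → qv pt a h 0 ≤ qv pt b h 0 := by
      intro a b ha hb
      obtain ⟨ha, hga⟩ := (hf _ _).1 ha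
      obtain ⟨hb, hgb⟩ := (hf _ _).1 hb
      have h1 := lin_qv pt a (hT a ha).1 h 0
      have h2 := (hT b hb).2 (a 0)
      rw [hlin a ha, hga] at h1
      rw [hlin b hb, hgb] at h2
      linarith
    exact le_antisymm (key _ _ hspec hu) (key _ _ hu hspec)
  let C : (Fin n → ℝ) → Set (Fin n → ℝ) := fun p => ⋃ u ∈ f p, smx pt u
  let a : (Fin n → ℝ) → Fin (n+1) → ℤ := fun p => Fin.cons (∑ u ∈ f p, |(Mz u).det|) (fun j => ∑ u ∈ f p, zi u j)
  have hne : ∀ p ∈ S, (f p).Nonempty := by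
    intro p hp
    obtain ⟨u, hu, rfl⟩ := Finset.mem_image.1 hp
    exact ⟨u, (hf _ _).2 ⟨hu, rfl⟩⟩
  have hVi : ∀ i : ι, (Fin.cons (h i) (pt i) : Fin (n+1) → ℝ) = intVec i.1 := by
    intro i
    ext j
    refine Fin.cases ?_ (fun j => ?_) j
    · simp [h, intVec]
    · simp [pt, intVec, Fin.tail]
  have hsc : ∀ u, IsCompact (smx pt u) := by
    intro u
    exact (Set.finite_range _).isCompact_convexHull ℝ
  have hcons : ∀ {κ : Type} [Fintype κ] (β : κ → ℝ) (x : κ → ℝ) (y : κ → Fin n → ℝ),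
      (Fin.cons (∑ k, β k * x k) (∑ k, β k • y k) : Fin (n+1) → ℝ) = ∑ k, β k • (Fin.cons (x k) (y k) : Fin (n+1) → ℝ) := by
    intro κ _ β x y
    ext j
    refine Fin.cases ?_ (fun j => ?_) j
    · simp [Finset.sum_apply]
    · simp [Finset.sum_apply]
  refine ⟨S, a, c, C, ?_, ?_, ?_, ?_, ?_, ?_, ?_, ?_⟩
  · intro p hp
    simp only [a, Fin.cons_zero]
    obtain ⟨u, hu⟩ := hne p hp
    have h1 : 1 ≤ |(Mz u).det| := by
      apply Int.one_le_abs
      intro h0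
      apply (hT u ((hf _ _).1 hu).1).1
      rw [hdet, h0]; simp
    exact h1.trans (Finset.single_le_sum (f := fun u => |(Mz u).det|) (fun _ _ => abs_nonneg _) hu)
  · intro p hp j
    simp only [a, Fin.cons_zero, Fin.cons_succ]
    push_cast
    rw [Finset.sum_mul]
    apply Finset.sum_congr rfl
    intro u hu
    obtain ⟨hu, hgu⟩ := (hf _ _).1 hu
    rw [hzi u hu j, hgu]
    push_cast; rfl
  · intro p hp
    simp only [C]
    rw [measure_biUnion_finset₀]
    · simp only [volume_smx, hdet]
      rw [← ENNReal.ofReal_sum_of_nonneg]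
      · congr 1
        simp only [a, Fin.cons_zero]
        push_cast
        rw [Finset.mul_sum]
        apply Finset.sum_congr rfl
        intro u _; ring
      · intro u _
        exact mul_nonneg (abs_nonneg _) (vS_pos n).le
    · intro u hu u' hu' hne
      exact hdis u ((hf _ _).1 hu).1 u' ((hf _ _).1 hu').1 hne
    · intro u _
      exact (hsc u).measurableSet.nullMeasurableSet
  · intro p hp
    exact (f p).isCompact_biUnion fun u _ => hsc u
  · intro p hp z hz
    obtain ⟨u, hu⟩ := hne p hp
    have hcu := hc p u hu
    obtain ⟨hu, hgu⟩ := (hf _ _).1 hu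
    have hconv : Convex ℝ {z : Fin (n+1) → ℝ | z 0 ≤ c p + ∑ j : Fin n, p j * z j.succ} := by
      intro x hx y hy s t hs ht hst
      simp only [Set.mem_ofPred_eq, Pi.add_apply, Pi.smul_apply, smul_eq_mul, mul_add, Finset.sum_add_distrib] at hx hy ⊢
      have e1 : ∑ j : Fin n, p j * (s * x j.succ) = s * ∑ j : Fin n, p j * x j.succ := by
        rw [Finset.mul_sum]; exact Finset.sum_congr rfl fun _ _ => by ring
      have e2 : ∑ j : Fin n, p j * (t * y j.succ) = t * ∑ j : Fin n, p j * y j.succ := by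
        rw [Finset.mul_sum]; exact Finset.sum_congr rfl fun _ _ => by ring
      rw [e1, e2]
      have : c p = s * c p + t * c p := by rw [← add_mul, hst, one_mul]
      nlinarith [mul_le_mul_of_nonneg_left hx hs, mul_le_mul_of_nonneg_left hy ht]
    refine convexHull_min ?_ hconv hz
    rintro _ ⟨v, hv, rfl⟩
    have h2 := (hT u hu).2 ⟨v, hv⟩
    rw [hlin u hu, hgu, ← hcu] at h2
    exact h2
  · intro p hp x hx
    obtain ⟨u, hu, hxu⟩ := Set.mem_iUnion₂.1 hx
    have hcu := hc p u hu
    obtain ⟨hu, hgu⟩ := (hf _ _).1 hu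
    obtain ⟨β, hβ0, hβ1, hβx⟩ := (mem_convexHull_range' _ _).1 hxu
    have e : c p + ∑ j, p j * x j = ∑ k, β k * h (u k) := by
      rw [hcu, ← hgu, ← hlin u hu, ← hβx, lin_sum _ _ _ hβ1]
      simp only [lin_qv pt u (hT u hu).1]
    rw [e, ← hβx, hcons]
    apply (convex_convexHull ℝ _).sum_mem (fun k _ => hβ0 k) hβ1
    intro k _
    rw [hVi]
    exact subset_convexHull ℝ _ ⟨(u k).1, (u k).2, rfl⟩
  · intro p hp p' hp' hne
    have : C p ∩ C p' ⊆ ⋃ u ∈ f p, ⋃ u' ∈ f p', smx pt u ∩ smx pt u' := by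
      rintro x ⟨hx, hx'⟩
      obtain ⟨u, hu, hxu⟩ := Set.mem_iUnion₂.1 hx
      obtain ⟨u', hu', hxu'⟩ := Set.mem_iUnion₂.1 hx'
      exact Set.mem_iUnion₂.2 ⟨u, hu, Set.mem_iUnion₂.2 ⟨u', hu', hxu, hxu'⟩⟩
    refine measure_mono_null this ?_
    refine (measure_biUnion_null_iff (Finset.countable_toSet (f p))).2 ?_
    intro u hu
    refine (measure_biUnion_null_iff (Finset.countable_toSet (f p'))).2 ?_
    intro u' hu'
    have h1 := (hf _ _).1 hu
    have h2 := (hf _ _).1 hu'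
    refine hdis u h1.1 u' h2.1 ?_
    rintro rfl
    exact hne (h1.2.symm.trans h2.2)
  · refine measure_mono_null ?_ hcov
    rintro x ⟨⟨z, hz, rfl⟩, hx⟩
    refine ⟨?_, ?_⟩
    · have hl : IsLinearMap ℝ (fun z : Fin (n+1) → ℝ => Fin.tail z) := ⟨fun _ _ => rfl, fun _ _ => rfl⟩
      have := hl.image_convexHull (intVec '' (V : Set (Fin (n+1) → ℤ)))
      have h2 : (fun z => Fin.tail z) z ∈ (fun z : Fin (n+1) → ℝ => Fin.tail z) '' convexHull ℝ (intVec '' (V : Set (Fin (n+1) → ℤ))) := ⟨z, hz, rfl⟩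
      rw [this] at h2
      refine convexHull_mono ?_ h2
      rintro _ ⟨_, ⟨v, hv, rfl⟩, rfl⟩
      exact ⟨⟨v, hv⟩, rfl⟩
    · intro hx'
      apply hx
      obtain ⟨u, hu, hxu⟩ := Set.mem_iUnion₂.1 hx'
      exact Set.mem_iUnion₂.2 ⟨g u, Finset.mem_image_of_mem _ hu, Set.mem_iUnion₂.2 ⟨u, (hf _ _).2 ⟨hu, rfl⟩, hxu⟩⟩

end

-- part UBound

section

theorem sum_vol_le {E : Type} [MeasurableSpace E] (μ : Measure E) {κ : Type} (S : Finset κ) (C : κ → Set E) (B : Set E)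
    (hm : ∀ p ∈ S, MeasurableSet (C p)) (hsub : ∀ p ∈ S, C p ⊆ B) (hd : ∀ p ∈ S, ∀ p' ∈ S, p ≠ p' → μ (C p ∩ C p') = 0) :
    ∑ p ∈ S, μ (C p) ≤ μ B := by
  rw [← measure_biUnion_finset₀ (fun p hp p' hp' hne => hd p hp p' hp' hne) (fun p hp => (hm p hp).nullMeasurableSet)]
  exact measure_mono (Set.iUnion₂_subset hsub)

theorem vol_box {n : ℕ} (t : Fin n → ℝ) (ht : ∀ i, 0 ≤ t i) :
    volume (Set.Icc (-t) t) = ENNReal.ofReal (∏ i, (2 * t i)) := by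
  rw [Real.volume_Icc_pi, ENNReal.ofReal_prod_of_nonneg (fun i _ => by have := ht i; positivity)]
  apply Finset.prod_congr rfl
  intro i _
  congr 1
  simp; ring

/-- the shear replacing coordinate `j` by `c + p·x` -/
def shear {n : ℕ} (j : Fin n) (p : Fin n → ℝ) (c : ℝ) (x : Fin n → ℝ) : Fin n → ℝ :=
  Function.update x j (c + ∑ i, p i * x i)

theorem vol_shear {n : ℕ} (j : Fin n) (p : Fin n → ℝ) (c : ℝ) (A : Set (Fin n → ℝ)) :
    volume (shear j p c '' A) = ENNReal.ofReal |p j| * volume A := by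
  have e : shear j p c '' A = (fun z => (Pi.single j c : Fin n → ℝ) + z) '' (Matrix.toLin' ((1 : Matrix (Fin n) (Fin n) ℝ).updateRow j p) '' A) := by
    rw [Set.image_image]
    apply Set.image_congr
    intro x _
    ext k
    by_cases hk : k = j
    · subst hk
      simp [shear, Matrix.mulVec, dotProduct]
    · simp [shear, hk, Matrix.mulVec, dotProduct, Matrix.one_apply]
  rw [e, Set.image_add_left, measure_preimage_add, Measure.addHaar_image_linearMap, LinearMap.det_toLin',
    ← Matrix.cramer_transpose_apply, Matrix.transpose_one, Matrix.cramer_one]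
  rfl

theorem cont_shear {n : ℕ} (j : Fin n) (p : Fin n → ℝ) (c : ℝ) : Continuous (shear j p c) := by
  unfold shear
  fun_prop

section
variable {n : ℕ} {P : Set (Fin (n+1) → ℝ)} {S : Finset (Fin n → ℝ)} {a : (Fin n → ℝ) → Fin (n+1) → ℤ}
    {c : (Fin n → ℝ) → ℝ} {C : (Fin n → ℝ) → Set (Fin n → ℝ)}

theorem UD.mono (h : UD P S a c C) {p p' x} (hp : p ∈ S) (hp' : p' ∈ S) (hx : x ∈ C p) :
    c p + ∑ j, p j * x j ≤ c p' + ∑ j, p' j * x j := by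
  have := h.sup p' hp' _ (h.mem p hp x hx)
  simpa using this

theorem UD.half (h : UD P S a c C) (t : Fin (n+1) → ℝ) (ht : ∀ i, 0 ≤ t i) (hP : ∀ z ∈ P, ∀ i, |z i| ≤ t i) (j : Fin n) (s : ℝ)
    (hs : s ≠ 0) :
    vS n * ∑ p ∈ S.filter (fun p => 0 < s * p j), |(a p j.succ : ℝ)| ≤ ∏ i, (2 * (Function.update (Fin.tail t) j (t 0) : Fin n → ℝ) i) := by
  classical
  set t' : Fin n → ℝ := Function.update (Fin.tail t) j (t 0) with ht'
  have ht'0 : ∀ i, 0 ≤ t' i := by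
    intro i
    by_cases hi : i = j
    · subst hi; simp [ht', ht]
    · simp [ht', hi, Fin.tail, ht]
  have key := sum_vol_le volume (S.filter (fun p => 0 < s * p j)) (fun p => shear j p (c p) '' C p) (Set.Icc (-t') t') ?_ ?_ ?_
  · rw [vol_box t' ht'0] at key
    have e : ∀ p ∈ S.filter (fun p => 0 < s * p j), volume (shear j p (c p) '' C p) = ENNReal.ofReal (vS n * |(a p j.succ : ℝ)|) := by
      intro p hp
      have hp := (Finset.mem_filter.1 hp).1
      rw [vol_shear, h.vol p hp, ← ENNReal.ofReal_mul (abs_nonneg _), h.ap p hp j, abs_mul,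
        abs_of_nonneg (a := (a p 0 : ℝ)) (by exact_mod_cast (zero_le_one.trans (h.a0 p hp)))]
      congr 1; ring
    rw [Finset.sum_congr rfl e, ← ENNReal.ofReal_sum_of_nonneg (fun p _ => mul_nonneg (vS_pos n).le (abs_nonneg _)), ← Finset.mul_sum] at key
    exact (ENNReal.ofReal_le_ofReal_iff (Finset.prod_nonneg fun i _ => by have := ht'0 i; positivity)).1 key
  · intro p hp
    exact ((h.cpt p (Finset.mem_filter.1 hp).1).image (cont_shear j p (c p))).measurableSet
  · intro p hp
    have hp := (Finset.mem_filter.1 hp).1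
    rintro _ ⟨x, hx, rfl⟩
    have h1 := hP _ (h.mem p hp x hx)
    have h2 : ∀ i, |shear j p (c p) x i| ≤ t' i := by
      intro i
      by_cases hi : i = j
      · subst hi
        have := h1 0
        simpa [shear, ht'] using this
      · have := h1 i.succ
        simpa [shear, ht', hi, Fin.tail] using this
    exact ⟨fun i => (abs_le.1 (h2 i)).1, fun i => (abs_le.1 (h2 i)).2⟩
  · intro p hp p' hp' hne
    obtain ⟨hp, hsp⟩ := Finset.mem_filter.1 hp
    obtain ⟨hp', hsp'⟩ := Finset.mem_filter.1 hp'
    have hsub : shear j p (c p) '' C p ∩ shear j p' (c p') '' C p' ⊆ shear j p (c p) '' (C p ∩ C p') := by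
      rintro _ ⟨⟨x, hx, rfl⟩, ⟨x', hx', hxx⟩⟩
      have hoff : ∀ i, i ≠ j → x' i = x i := by
        intro i hi
        have := congrFun hxx i
        simpa [shear, hi] using this
      have hj : c p' + ∑ i, p' i * x' i = c p + ∑ i, p i * x i := by
        have := congrFun hxx j
        simpa [shear] using this
      have hm1 := h.mono hp hp' hx
      have hm2 := h.mono hp' hp hx'
      have hdiff : ∀ q : Fin n → ℝ, ∑ i, q i * x' i = ∑ i, q i * x i + q j * (x' j - x j) := by
        intro q
        rw [← Finset.add_sum_erase _ _ (Finset.mem_univ j), ← Finset.add_sum_erase _ (fun i => q i * x i) (Finset.mem_univ j)]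
        have : ∑ i ∈ Finset.univ.erase j, q i * x' i = ∑ i ∈ Finset.univ.erase j, q i * x i :=
          Finset.sum_congr rfl fun i hi => by rw [hoff i (Finset.ne_of_mem_erase hi)]
        rw [this]; ring
      have e1 := hdiff p
      have e2 := hdiff p'
      have k1 : 0 ≤ p j * (x' j - x j) := by linarith
      have k2 : p' j * (x' j - x j) ≤ 0 := by linarith
      have hz : x' j = x j := by
        by_contra hne
        have hs2 : 0 < s ^ 2 := by positivity
        have hd : x' j - x j ≠ 0 := sub_ne_zero.2 hne
        have hd2 : 0 < (x' j - x j) ^ 2 := by positivity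
        have h5 : 0 < (s * p j) * (s * p' j) := mul_pos hsp hsp'
        have h6 : (p j * (x' j - x j)) * (p' j * (x' j - x j)) ≤ 0 := mul_nonpos_of_nonneg_of_nonpos k1 k2
        have h7 : (s * p j) * (s * p' j) * (x' j - x j) ^ 2 ≤ 0 := by
          have : (s * p j) * (s * p' j) * (x' j - x j) ^ 2 = s ^ 2 * ((p j * (x' j - x j)) * (p' j * (x' j - x j))) := by ring
          rw [this]; exact mul_nonpos_of_nonneg_of_nonpos hs2.le h6
        have h8 := mul_pos h5 hd2
        linarith
      have hxe : x' = x := by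
        ext i
        by_cases hi : i = j
        · rw [hi, hz]
        · exact hoff i hi
      rw [hxe] at hx'
      exact ⟨x, ⟨hx, hx'⟩, rfl⟩
    refine measure_mono_null hsub ?_
    rw [vol_shear, h.disj p hp p' hp' hne, mul_zero]

theorem UD.bound (h : UD P S a c C) (t : Fin (n+1) → ℝ) (ht : ∀ i, 0 ≤ t i) (hP : ∀ z ∈ P, ∀ i, |z i| ≤ t i) (i : Fin (n+1)) :
    t i * (vS n * ∑ p ∈ S, |(a p i : ℝ)|) ≤ 2 ^ (n+1) * ∏ k, t k := by
  classical
  have hpr : 0 ≤ ∏ k, t k := Finset.prod_nonneg fun k _ => ht k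
  refine Fin.cases ?_ (fun j => ?_) i
  · have key := sum_vol_le volume S C (Set.Icc (-(Fin.tail t)) (Fin.tail t)) (fun p hp => (h.cpt p hp).measurableSet) ?_ h.disj
    · rw [vol_box (Fin.tail t) (fun i => ht _), Finset.sum_congr rfl h.vol, ← ENNReal.ofReal_sum_of_nonneg, ENNReal.ofReal_le_ofReal_iff, ← Finset.mul_sum] at key
      · have e : ∑ p ∈ S, |(a p 0 : ℝ)| = ∑ p ∈ S, (a p 0 : ℝ) := Finset.sum_congr rfl fun p hp => by
          rw [abs_of_nonneg]; exact_mod_cast (zero_le_one.trans (h.a0 p hp))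
        rw [e]
        refine (mul_le_mul_of_nonneg_left key (ht 0)).trans ?_
        rw [Finset.prod_mul_distrib]
        simp only [Finset.prod_const, Finset.card_univ, Fintype.card_fin]
        rw [Fin.prod_univ_succ] at hpr ⊢
        simp only [Fin.tail]
        rw [pow_succ]
        nlinarith [mul_nonneg (pow_nonneg zero_le_two n : (0:ℝ) ≤ 2 ^ n) hpr]
      · exact Finset.prod_nonneg fun i _ => mul_nonneg zero_le_two (ht _)
      · intro p hp
        refine mul_nonneg (vS_pos n).le ?_
        exact_mod_cast (zero_le_one.trans (h.a0 p hp))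
    · intro p hp x hx
      have h1 := hP _ (h.mem p hp x hx)
      have h2 : ∀ i, |x i| ≤ Fin.tail t i := by
        intro i
        have := h1 i.succ
        simpa [Fin.tail] using this
      exact ⟨fun i => (abs_le.1 (h2 i)).1, fun i => (abs_le.1 (h2 i)).2⟩
  · have h1 := h.half t ht hP j 1 one_ne_zero
    have h2 := h.half t ht hP j (-1) (by norm_num)
    have e : ∑ p ∈ S, |(a p j.succ : ℝ)| = ∑ p ∈ S.filter (fun p => 0 < 1 * p j), |(a p j.succ : ℝ)| + ∑ p ∈ S.filter (fun p => 0 < -1 * p j), |(a p j.succ : ℝ)| := by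
      rw [Finset.sum_filter, Finset.sum_filter, ← Finset.sum_add_distrib]
      apply Finset.sum_congr rfl
      intro p hp
      rcases lt_trichotomy (p j) 0 with hh | hh | hh
      · rw [if_neg (by linarith), if_pos (by linarith), zero_add]
      · rw [if_neg (by linarith), if_neg (by linarith), h.ap p hp, hh]; simp
      · rw [if_pos (by linarith), if_neg (by linarith), add_zero]
    have e2 : t j.succ * ∏ i, (2 * (Function.update (Fin.tail t) j (t 0) : Fin n → ℝ) i) = 2 ^ n * ∏ k, t k := by
      rw [Finset.prod_mul_distrib, Finset.prod_update_of_mem (Finset.mem_univ j), Fin.prod_univ_succ]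
      simp only [Finset.prod_const, Finset.card_univ, Fintype.card_fin]
      rw [← Finset.mul_prod_erase Finset.univ (fun i : Fin n => t i.succ) (Finset.mem_univ j), Finset.sdiff_singleton_eq_erase]
      simp only [Fin.tail]
      ring
    rw [e, mul_add, mul_add]
    have h3 := mul_le_mul_of_nonneg_left h1 (ht j.succ)
    have h4 := mul_le_mul_of_nonneg_left h2 (ht j.succ)
    rw [e2] at h3 h4
    rw [pow_succ]
    linarith
end

end

-- part Det

section

section
variable {n : ℕ} 

theorem int_union {S : Finset (Fin n → ℝ)} {C : (Fin n → ℝ) → Set (Fin n → ℝ)} (hC : ∀ p ∈ S, IsCompact (C p))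
    (hd : ∀ p ∈ S, ∀ p' ∈ S, p ≠ p' → volume (C p ∩ C p') = 0) {f : (Fin n → ℝ) → ℝ} (hf : Continuous f) :
    ∫ x in ⋃ p ∈ S, C p, f x = ∑ p ∈ S, ∫ x in C p, f x := by
  classical
  have e : (⋃ p ∈ S, C p) = ⋃ p : S, C p.1 := by
    ext x; simp
  rw [e, integral_iUnion_ae (s := fun p : S => C p.1) (μ := volume) (fun p => (hC p.1 p.2).measurableSet.nullMeasurableSet)
    (fun p p' hne => hd p.1 p.2 p'.1 p'.2 (fun h => hne (Subtype.ext h)))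
    (by
      have : IsCompact (⋃ p : S, C p.1) := isCompact_iUnion (fun p => hC p.1 p.2)
      exact hf.continuousOn.integrableOn_compact this)]
  rw [tsum_fintype]
  exact Finset.sum_coe_sort S (fun p => ∫ x in C p, f x)

theorem det_int {S : Finset (Fin n → ℝ)} {C C' : (Fin n → ℝ) → Set (Fin n → ℝ)} (hC : ∀ p ∈ S, IsCompact (C p))
    (hC' : ∀ p ∈ S, IsCompact (C' p))
    (hd : ∀ p ∈ S, ∀ p' ∈ S, p ≠ p' → volume (C p ∩ C p') = 0)
    (hd' : ∀ p ∈ S, ∀ p' ∈ S, p ≠ p' → volume (C' p ∩ C' p') = 0)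
    (hu : (⋃ p ∈ S, C p) =ᵐ[volume] (⋃ p ∈ S, C' p))
    (hv : ∀ p ∈ S, volume (C p) = volume (C' p))
    (L : (Fin n → ℝ) → (Fin n → ℝ) → ℝ) (hL : ∀ p, Continuous (L p)) (c : (Fin n → ℝ) → ℝ)
    (f : (Fin n → ℝ) → ℝ) (hf : Continuous f) (h1 : ∀ p ∈ S, ∀ x, f x ≤ c p + L p x)
    (h2 : ∀ p ∈ S, ∀ x ∈ C p, f x = c p + L p x) :
    ∑ p ∈ S, ∫ x in C p, L p x ≤ ∑ p ∈ S, ∫ x in C' p, L p x ∧ 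
    (∑ p ∈ S, ∫ x in C p, L p x = ∑ p ∈ S, ∫ x in C' p, L p x → 
      ∀ p ∈ S, volume {x | x ∈ C' p ∧ f x ≠ c p + L p x} = 0) := by
  have e1 : ∑ p ∈ S, ∫ x in C p, f x = ∑ p ∈ S, ∫ x in C' p, f x := by
    rw [← int_union hC hd hf, ← int_union hC' hd' hf]
    exact setIntegral_congr_set hu
  have i1 : ∀ p ∈ S, ∫ x in C p, f x = c p * (volume (C p)).toReal + ∫ x in C p, L p x := by
    intro p hp
    rw [setIntegral_congr_fun (hC p hp).measurableSet (fun x hx => h2 p hp x hx), integral_add, setIntegral_const]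
    · simp [Measure.real, mul_comm]
    · exact continuousOn_const.integrableOn_compact (hC p hp)
    · exact (hL p).continuousOn.integrableOn_compact (hC p hp)
  have i2 : ∀ p ∈ S, ∫ x in C' p, (c p + L p x - f x) = (c p * (volume (C p)).toReal + ∫ x in C' p, L p x) - ∫ x in C' p, f x := by
    intro p hp
    rw [integral_sub, integral_add, setIntegral_const, hv p hp]
    · simp [Measure.real, mul_comm]
    · exact continuousOn_const.integrableOn_compact (hC' p hp)
    · exact (hL p).continuousOn.integrableOn_compact (hC' p hp)
    · exact (continuous_const.add (hL p)).continuousOn.integrableOn_compact (hC' p hp)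
    · exact hf.continuousOn.integrableOn_compact (hC' p hp)
  have i3 : ∀ p ∈ S, 0 ≤ ∫ x in C' p, (c p + L p x - f x) := by
    intro p hp
    apply integral_nonneg
    intro x
    have := h1 p hp x
    simp; linarith
  have key : ∑ p ∈ S, ∫ x in C' p, (c p + L p x - f x) = ∑ p ∈ S, (∫ x in C' p, L p x) - ∑ p ∈ S, ∫ x in C p, L p x := by
    rw [Finset.sum_congr rfl i2, Finset.sum_sub_distrib, ← e1, Finset.sum_congr rfl i1, Finset.sum_add_distrib, Finset.sum_add_distrib]
    ring
  refine ⟨?_, ?_⟩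
  · have := Finset.sum_nonneg i3
    linarith
  · intro he p hp
    rw [he, sub_self, Finset.sum_eq_zero_iff_of_nonneg i3] at key
    have := key p hp
    rw [setIntegral_eq_zero_iff_of_nonneg_ae] at this
    · rw [Filter.EventuallyEq, ae_restrict_iff' (hC' p hp).measurableSet, ae_iff] at this
      refine measure_mono_null ?_ this
      rintro x ⟨hx, hne⟩
      simp only [Set.mem_ofPred_eq, Classical.not_imp]
      refine ⟨hx, fun h0 => hne ?_⟩
      simp at h0; linarith
    · filter_upwards with x
      have := h1 p hp x
      simp; linarith
    · exact ((continuous_const.add (hL p)).sub hf).continuousOn.integrableOn_compact (hC' p hp)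

theorem dense_lemma {Ω Z : Set (Fin n → ℝ)} (hΩ : Convex ℝ Ω) (hi : (interior Ω).Nonempty) (hZ : IsClosed Z)
    (h0 : volume (Ω \ Z) = 0) : Ω ⊆ Z := by
  have h1 : interior Ω ⊆ Z := by
    by_contra hcon
    rw [Set.not_subset] at hcon
    obtain ⟨x, hx, hxZ⟩ := hcon
    have : 0 < volume (interior Ω \ Z) := by
      apply IsOpen.measure_pos
      · exact isOpen_interior.sdiff hZ
      · exact ⟨x, hx, hxZ⟩
    have h2 : volume (interior Ω \ Z) ≤ volume (Ω \ Z) := measure_mono (Set.sdiff_subset_sdiff_left interior_subset)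
    rw [h0] at h2
    exact absurd h2 (not_le.2 this)
  calc Ω ⊆ closure Ω := subset_closure
    _ = closure (interior Ω) := (hΩ.closure_interior_eq_closure_of_nonempty_interior hi).symm
    _ ⊆ Z := closure_minimal h1 hZ

variable {P P' : Set (Fin (n+1) → ℝ)} {S S' : Finset (Fin n → ℝ)} {a a' : (Fin n → ℝ) → Fin (n+1) → ℤ}
    {c c' : (Fin n → ℝ) → ℝ} {C C' : (Fin n → ℝ) → Set (Fin n → ℝ)}

/-- the upper envelope function -/
def env (S : Finset (Fin n → ℝ)) (hS : S.Nonempty) (c : (Fin n → ℝ) → ℝ) (x : Fin n → ℝ) : ℝ :=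
  S.inf' hS (fun p => c p + ∑ j, p j * x j)

theorem env_cont (S : Finset (Fin n → ℝ)) (hS : S.Nonempty) (c : (Fin n → ℝ) → ℝ) : Continuous (env S hS c) := by
  apply Continuous.finset_inf'_apply
  intro p _
  fun_prop

theorem env_le {S : Finset (Fin n → ℝ)} (hS : S.Nonempty) (c : (Fin n → ℝ) → ℝ) {p} (hp : p ∈ S) (x) :
    env S hS c x ≤ c p + ∑ j, p j * x j := Finset.inf'_le _ hp

theorem UD.env_eq (h : UD P S a c C) (hS : S.Nonempty) {p} (hp : p ∈ S) {x} (hx : x ∈ C p) :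
    env S hS c x = c p + ∑ j, p j * x j := by
  apply le_antisymm (env_le hS c hp x)
  apply Finset.le_inf'
  intro p' hp'
  exact h.mono hp hp' hx

theorem UD.le_env (h : UD P S a c C) (hS : S.Nonempty) {z} (hz : z ∈ P) : z 0 ≤ env S hS c (Fin.tail z) := by
  apply Finset.le_inf'
  intro p hp
  exact h.sup p hp z hz

theorem UD.ne (h : UD P S a c C) (hi : (interior ((fun z => Fin.tail z) '' P : Set (Fin n → ℝ))).Nonempty) : S.Nonempty := by
  by_contra hS
  rw [Finset.not_nonempty_iff_eq_empty] at hS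
  have := h.cover
  rw [hS] at this
  simp only [Finset.notMem_empty, Set.iUnion_of_empty, Set.iUnion_empty, Set.sdiff_empty] at this
  have h2 := (isOpen_interior.measure_pos volume hi)
  have h3 := measure_mono (μ := volume) (interior_subset (s := ((fun z => Fin.tail z) '' P : Set (Fin n → ℝ))))
  rw [this] at h3
  exact absurd h3 (not_le.2 h2)

theorem UD.env_mem (h : UD P S a c C) (hP : IsCompact P) (hc : Convex ℝ P)
    (hi : (interior ((fun z => Fin.tail z) '' P : Set (Fin n → ℝ))).Nonempty) (hS : S.Nonempty) {x} 
    (hx : x ∈ ((fun z => Fin.tail z) '' P : Set (Fin n → ℝ))) : (Fin.cons (env S hS c x) x : Fin (n+1) → ℝ) ∈ P := by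
  have hconv : Convex ℝ ((fun z => Fin.tail z) '' P : Set (Fin n → ℝ)) := by
    have : IsLinearMap ℝ (fun z : Fin (n+1) → ℝ => (Fin.tail z : Fin n → ℝ)) := ⟨fun _ _ => rfl, fun _ _ => rfl⟩
    exact hc.is_linear_image this
  have hcont : Continuous (fun x : Fin n → ℝ => (Fin.cons (env S hS c x) x : Fin (n+1) → ℝ)) := by
    have := env_cont S hS c
    apply continuous_pi
    intro i
    refine Fin.cases ?_ ?_ i
    · simpa using this
    · intro j
      simpa using continuous_apply j
  refine dense_lemma hconv hi (hP.isClosed.preimage hcont) ?_ hx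
  refine measure_mono_null ?_ h.cover
  rintro y ⟨hy, hy2⟩
  refine ⟨hy, fun hy3 => hy2 ?_⟩
  simp only [Set.mem_iUnion] at hy3
  obtain ⟨p, hp, hyp⟩ := hy3
  simp only [Set.mem_preimage]
  rw [h.env_eq hS hp hyp]
  exact h.mem p hp y hyp

theorem UD.union_ae (h : UD P S a c C) : (⋃ p ∈ S, C p) =ᵐ[volume] ((fun z => Fin.tail z) '' P : Set (Fin n → ℝ)) := by
  have hsub : (⋃ p ∈ S, C p) ⊆ ((fun z => Fin.tail z) '' P : Set (Fin n → ℝ)) := by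
    apply Set.iUnion₂_subset
    intro p hp x hx
    exact ⟨_, h.mem p hp x hx, by simp⟩
  exact Filter.EventuallyLE.antisymm hsub.eventuallyLE (ae_le_set.2 h.cover)

theorem UD.a_inj (h : UD P S a c C) (h' : UD P' S' a' c' C') {p p'} (hp : p ∈ S) (hp' : p' ∈ S') (e : a p = a' p') : p = p' := by
  ext j
  have h1 := h.ap p hp j
  have h2 := h'.ap p' hp' j
  have h3 := h.a0 p hp
  rw [e] at h1 h3
  rw [h1] at h2
  have : ((a' p' 0 : ℤ) : ℝ) ≠ 0 := by
    have : a' p' 0 ≠ 0 := by omega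
    exact_mod_cast this
  exact mul_left_cancel₀ this h2

theorem UD.det (h : UD P S a c C) (h' : UD P' S' a' c' C') (hP : IsCompact P) (hc : Convex ℝ P) (hP' : IsCompact P') (hc' : Convex ℝ P')
    (hΩ : ((fun z => Fin.tail z) '' P : Set (Fin n → ℝ)) = (fun z => Fin.tail z) '' P')
    (hi : (interior ((fun z => Fin.tail z) '' P : Set (Fin n → ℝ))).Nonempty)
    (ha : a '' (S : Set _) = a' '' (S' : Set _))
    (hm : ∀ m : ℝ, (∀ z ∈ P, z 0 ≤ m) ↔ (∀ z ∈ P', z 0 ≤ m)) :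
    ∀ z ∈ P, ∃ w ∈ P', Fin.tail w = Fin.tail z ∧ z 0 ≤ w 0 := by
  classical
  have hi' := hi
  rw [hΩ] at hi'
  have key : ∀ p, p ∈ S → p ∈ S' ∧ a p = a' p := by
    intro p hp
    have : a p ∈ a' '' (S' : Set _) := ha ▸ ⟨p, hp, rfl⟩
    obtain ⟨p', hp', e⟩ := this
    have := h.a_inj h' hp hp' e.symm
    subst this
    exact ⟨hp', e.symm⟩
  have key' : ∀ p, p ∈ S' → p ∈ S := by
    intro p hp
    have : a' p ∈ a '' (S : Set _) := ha ▸ ⟨p, hp, rfl⟩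
    obtain ⟨p', hp', e⟩ := this
    have := h.a_inj h' hp' hp e
    subst this
    exact hp'
  have hSS : S = S' := by
    ext p; exact ⟨fun hp => (key p hp).1, key' p⟩
  subst hSS
  have hS := h.ne hi
  have hu : (⋃ p ∈ S, C p) =ᵐ[volume] (⋃ p ∈ S, C' p) := by
    refine h.union_ae.trans ?_
    rw [hΩ]
    exact h'.union_ae.symm
  have hv : ∀ p ∈ S, volume (C p) = volume (C' p) := by
    intro p hp
    rw [h.vol p hp, h'.vol p hp, (key p hp).2]
  let L : (Fin n → ℝ) → (Fin n → ℝ) → ℝ := fun p x => ∑ j, p j * x j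
  have hL : ∀ p, Continuous (L p) := by intro p; simp only [L]; fun_prop
  have d1 := det_int h.cpt h'.cpt h.disj h'.disj hu hv L hL c (env S hS c) (env_cont S hS c) (fun p hp x => env_le hS c hp x)
    (fun p hp x hx => h.env_eq hS hp hx)
  have d2 := det_int h'.cpt h.cpt h'.disj h.disj hu.symm (fun p hp => (hv p hp).symm) L hL c' (env S hS c') (env_cont S hS c') 
    (fun p hp x => env_le hS c' hp x) (fun p hp x hx => h'.env_eq hS hp hx)
  have d3 := d1.2 (le_antisymm d1.1 d2.1)
  set Ω : Set (Fin n → ℝ) := (fun z => Fin.tail z) '' P with hΩd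
  have hconv : Convex ℝ Ω := by
    have : IsLinearMap ℝ (fun z : Fin (n+1) → ℝ => (Fin.tail z : Fin n → ℝ)) := ⟨fun _ _ => rfl, fun _ _ => rfl⟩
    exact hc.is_linear_image this
  set g : (Fin n → ℝ) → ℝ := fun x => env S hS c x - env S hS c' x with hg
  have hgc : Continuous g := (env_cont S hS c).sub (env_cont S hS c')
  set K : Finset ℝ := S.image (fun p => c p - c' p) with hK
  have hgK : ∀ x ∈ Ω, g x ∈ (K : Set ℝ) := by
    apply dense_lemma hconv hi (Z := g ⁻¹' (K : Set ℝ)) (K.finite_toSet.isClosed.preimage hgc)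
    have hcov' := h'.cover
    rw [← hΩ] at hcov'
    have hnull : volume (⋃ p ∈ S, {x | x ∈ C' p ∧ env S hS c x ≠ c p + L p x}) = 0 := by
      exact (measure_biUnion_null_iff S.countable_toSet).2 d3
    refine measure_mono_null ?_ (measure_union_null hcov' hnull)
    rintro x ⟨hx, hx2⟩
    by_contra hcon
    simp only [Set.mem_union, not_or] at hcon
    obtain ⟨q1, q2⟩ := hcon
    have : x ∈ ⋃ p ∈ S, C' p := by
      by_contra hh; exact q1 ⟨hx, hh⟩
    simp only [Set.mem_iUnion] at this
    obtain ⟨p, hp, hxp⟩ := this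
    apply hx2
    simp only [Set.mem_preimage, hK, Finset.coe_image, Set.mem_image]
    refine ⟨p, hp, ?_⟩
    have e1 : env S hS c x = c p + L p x := by
      by_contra hh
      apply q2
      simp only [Set.mem_iUnion]
      exact ⟨p, hp, hxp, hh⟩
    have e2 := h'.env_eq hS hp hxp
    simp only [hg, e1, e2, L]
    ring
  obtain ⟨x0, hx0⟩ := hi
  have hconst : ∀ x ∈ Ω, g x = g x0 := by
    apply dense_lemma hconv ⟨x0, hx0⟩ (Z := {x | g x = g x0}) (isClosed_eq hgc continuous_const)
    have hz : Ω \ {x | g x = g x0} = ∅ := by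
      rw [Set.sdiff_eq_empty]
      intro x hx
      exact IsPreconnected.constant_of_mapsTo hconv.isPreconnected K.finite_toSet.isDiscrete hgc.continuousOn hgK hx (interior_subset hx0)
    rw [hz]; simp
  have hx0Ω := interior_subset hx0
  have hk0 : g x0 = 0 := by
    have hPne : P.Nonempty := by
      obtain ⟨z, hz, _⟩ := hx0Ω; exact ⟨z, hz⟩
    have hPne' : P'.Nonempty := by
      rw [hΩ] at hx0Ω
      obtain ⟨z, hz, _⟩ := hx0Ω; exact ⟨z, hz⟩
    apply le_antisymm
    · -- attained max of P'
      obtain ⟨z, hz, hmax⟩ := hP'.exists_isMaxOn hPne' (continuous_apply (0 : Fin (n+1))).continuousOn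
      have hb := (hm (z 0)).2 (fun y hy => hmax hy)
      have hzΩ : Fin.tail z ∈ Ω := by rw [hΩ]; exact ⟨z, hz, rfl⟩
      have := hb _ (h.env_mem hP hc ⟨x0, hx0⟩ hS hzΩ)
      simp only [Fin.cons_zero] at this
      have h2 := h'.le_env hS hz
      have h3 := hconst _ hzΩ
      simp only [hg] at h3 ⊢
      linarith
    · obtain ⟨z, hz, hmax⟩ := hP.exists_isMaxOn hPne (continuous_apply (0 : Fin (n+1))).continuousOn
      have hb := (hm (z 0)).1 (fun y hy => hmax hy)
      have hzΩ : Fin.tail z ∈ Ω := ⟨z, hz, rfl⟩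
      have := hb _ (h'.env_mem hP' hc' hi' hS (hΩ ▸ hzΩ))
      simp only [Fin.cons_zero] at this
      have h2 := h.le_env hS hz
      have h3 := hconst _ hzΩ
      simp only [hg] at h3 ⊢
      linarith
  intro z hz
  have hzΩ : Fin.tail z ∈ Ω := ⟨z, hz, rfl⟩
  refine ⟨_, h'.env_mem hP' hc' hi' hS (hΩ ▸ hzΩ), by simp, ?_⟩
  have h2 := h.le_env hS hz
  have h3 := hconst _ hzΩ
  rw [hk0] at h3
  simp only [hg, Fin.cons_zero] at h3 ⊢
  linarith

end

end

-- part Det2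

section

/-- convex hull of integer points -/
def cv {d : ℕ} (V : Finset (Fin d → ℤ)) : Set (Fin d → ℝ) := convexHull ℝ (intVec '' (V : Set (Fin d → ℤ)))

theorem cv_compact {d : ℕ} (V : Finset (Fin d → ℤ)) : IsCompact (cv V) :=
  (V.finite_toSet.image _).isCompact_convexHull (𝕜 := ℝ)

theorem cv_convex {d : ℕ} (V : Finset (Fin d → ℤ)) : Convex ℝ (cv V) := convex_convexHull _ _

section
variable {n : ℕ}

def reflR : (Fin (n+1) → ℝ) →ₗ[ℝ] (Fin (n+1) → ℝ) where
  toFun z := Fin.cons (- z 0) (Fin.tail z)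
  map_add' x y := by
    ext i; refine Fin.cases ?_ ?_ i
    · simp; ring
    · intro j; simp [Fin.tail]
  map_smul' r x := by
    ext i; refine Fin.cases ?_ ?_ i
    · simp
    · intro j; simp [Fin.tail]

theorem reflR_apply (z : Fin (n+1) → ℝ) : reflR z = Fin.cons (- z 0) (Fin.tail z) := rfl

theorem reflR_refl (z : Fin (n+1) → ℝ) : reflR (reflR z) = z := by
  simp [reflR_apply]

def reflZ (x : Fin (n+1) → ℤ) : Fin (n+1) → ℤ := Fin.cons (- x 0) (Fin.tail x)

theorem intVec_reflZ (x : Fin (n+1) → ℤ) : intVec (reflZ x) = reflR (intVec x) := by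
  ext i; refine Fin.cases ?_ ?_ i
  · simp [reflR_apply, intVec, reflZ]
  · intro j; simp [reflR_apply, intVec, reflZ, Fin.tail]

open Classical in
def rflV (V : Finset (Fin (n+1) → ℤ)) : Finset (Fin (n+1) → ℤ) := V.image reflZ

theorem cv_refl (V : Finset (Fin (n+1) → ℤ)) : cv (rflV V) = reflR '' cv V := by
  classical
  unfold cv rflV
  rw [LinearMap.image_convexHull, Finset.coe_image, Set.image_image, Set.image_image]
  simp only [intVec_reflZ]

def tailL : (Fin (n+1) → ℝ) →ₗ[ℝ] (Fin n → ℝ) where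
  toFun z := Fin.tail z
  map_add' _ _ := rfl
  map_smul' _ _ := rfl

theorem tail_refl (V : Finset (Fin (n+1) → ℤ)) : ((fun z => Fin.tail z) '' cv (rflV V) : Set (Fin n → ℝ)) = (fun z => Fin.tail z) '' cv V := by
  rw [cv_refl, Set.image_image]
  simp [reflR_apply]

/-- lattice points of the projection -/
def Qs (V : Finset (Fin (n+1) → ℤ)) : Set (Fin n → ℤ) := {x | intVec x ∈ ((fun z => Fin.tail z) '' cv V : Set (Fin n → ℝ))}

theorem tail_cv (V : Finset (Fin (n+1) → ℤ)) : ((fun z => Fin.tail z) '' cv V : Set (Fin n → ℝ)) = 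
    convexHull ℝ (intVec '' ((fun x => (Fin.tail x : Fin n → ℤ)) '' (V : Set (Fin (n+1) → ℤ)))) := by
  have := LinearMap.image_convexHull (tailL (n := n)) (intVec '' (V : Set (Fin (n+1) → ℤ)))
  change (tailL (n := n)) '' cv V = _
  unfold cv
  rw [this, Set.image_image, Set.image_image]
  rfl

theorem Qs_hull (V : Finset (Fin (n+1) → ℤ)) : ((fun z => Fin.tail z) '' cv V : Set (Fin n → ℝ)) = convexHull ℝ (intVec '' Qs V) := by
  apply Set.Subset.antisymm
  · rw [tail_cv]
    apply convexHull_mono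
    apply Set.image_mono
    intro x hx
    change intVec x ∈ ((fun z => Fin.tail z) '' cv V : Set (Fin n → ℝ))
    rw [tail_cv]
    exact subset_convexHull _ _ ⟨x, hx, rfl⟩
  · apply convexHull_min
    · rintro _ ⟨x, hx, rfl⟩
      exact hx
    · rw [tail_cv]; exact convex_convexHull _ _

open Classical in
def Mx (V : Finset (Fin (n+1) → ℤ)) : ℤ := if h : V.Nonempty then V.sup' h (fun x => x 0) else 0

theorem Mx_le {V : Finset (Fin (n+1) → ℤ)} (h : V.Nonempty) (m : ℝ) : (∀ z ∈ cv V, z 0 ≤ m) ↔ (Mx V : ℝ) ≤ m := by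
  rw [Mx, dif_pos h]
  constructor
  · intro hz
    obtain ⟨x, hx, e⟩ := V.exists_mem_eq_sup' h (fun x => x 0)
    rw [e]
    exact hz (intVec x) (subset_convexHull _ _ ⟨x, hx, rfl⟩)
  · intro hm z hz
    have hsub : cv V ⊆ {z | z 0 ≤ m} := by
      apply convexHull_min
      · rintro _ ⟨x, hx, rfl⟩
        refine le_trans ?_ hm
        have := Finset.le_sup' (fun x : Fin (n+1) → ℤ => x 0) hx
        change ((x 0 : ℤ) : ℝ) ≤ _
        exact_mod_cast this
      · exact convex_halfSpace_le (𝕜 := ℝ) (f := fun z : Fin (n+1) → ℝ => z 0) ⟨fun _ _ => rfl, fun _ _ => rfl⟩ m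
    exact hsub hz

theorem Mx_abs {V : Finset (Fin (n+1) → ℤ)} (t : Fin (n+1) → ℕ) (ht : ∀ x ∈ V, ∀ i, |x i| ≤ t i) : |Mx V| ≤ t 0 := by
  unfold Mx
  split_ifs with h
  · obtain ⟨x, hx, e⟩ := V.exists_mem_eq_sup' h (fun x => x 0)
    rw [e]; exact ht x hx 0
  · simp

open Classical in
/-- the set of normal data of the upper hull -/
def As (V : Finset (Fin (n+1) → ℤ)) : Finset (Fin (n+1) → ℤ) :=
  ((exists_UD V).choose).image (exists_UD V).choose_spec.choose

theorem As_spec (V : Finset (Fin (n+1) → ℤ)) : ∃ S a c C, UD (cv V) S a c C ∧ (As V : Set _) = a '' (S : Set _) := by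
  classical
  obtain ⟨c, C, h⟩ := (exists_UD V).choose_spec.choose_spec
  exact ⟨_, _, c, C, h, by simp [As]⟩

theorem tail_int {P : Set (Fin (n+1) → ℝ)} (hi : (interior P).Nonempty) :
    (interior ((fun z => Fin.tail z) '' P : Set (Fin n → ℝ))).Nonempty := by
  obtain ⟨z, hz⟩ := hi
  have hs : Function.Surjective (LinearMap.toContinuousLinearMap (tailL (n := n))) := fun x => ⟨Fin.cons 0 x, Fin.tail_cons (α := fun _ => ℝ) 0 x⟩
  have ho := ContinuousLinearMap.isOpenMap _ hs
  exact ⟨Fin.tail z, interior_maximal (Set.image_mono interior_subset) (ho _ isOpen_interior) ⟨z, hz, rfl⟩⟩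

theorem upper_det {V V' : Finset (Fin (n+1) → ℤ)} (hV : V.Nonempty) (hV' : V'.Nonempty)
    (hi : (interior ((fun z => Fin.tail z) '' cv V : Set (Fin n → ℝ))).Nonempty)
    (hΩ : ((fun z => Fin.tail z) '' cv V : Set (Fin n → ℝ)) = (fun z => Fin.tail z) '' cv V')
    (hA : As V = As V') (hM : Mx V = Mx V') : ∀ z ∈ cv V, ∃ w ∈ cv V', Fin.tail w = Fin.tail z ∧ z 0 ≤ w 0 := by
  obtain ⟨S, a, c, C, h, e⟩ := As_spec V
  obtain ⟨S', a', c', C', h', e'⟩ := As_spec V'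
  refine h.det h' (cv_compact V) (cv_convex V) (cv_compact V') (cv_convex V') hΩ hi ?_ ?_
  · rw [← e, ← e', hA]
  · intro m
    rw [Mx_le hV, Mx_le hV', hM]

theorem vert {P : Set (Fin (n+1) → ℝ)} (hc : Convex ℝ P) {w u z : Fin (n+1) → ℝ} (hw : w ∈ P) (hu : u ∈ P) (e1 : Fin.tail w = Fin.tail z)
    (e2 : Fin.tail u = Fin.tail z) (h1 : z 0 ≤ w 0) (h2 : u 0 ≤ z 0) : z ∈ P := by
  by_cases h : w 0 = u 0
  · have : z = w := by
      rw [← Fin.cons_self_tail z, ← Fin.cons_self_tail w, e1]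
      congr 1; linarith
    rw [this]; exact hw
  · have hlt : 0 < w 0 - u 0 := by
      have : u 0 ≤ w 0 := by linarith
      have := lt_of_le_of_ne this (Ne.symm h)
      linarith
    have hm := hc hw hu (a := (z 0 - u 0) / (w 0 - u 0)) (b := (w 0 - z 0) / (w 0 - u 0)) (div_nonneg (by linarith) hlt.le)
      (div_nonneg (by linarith) hlt.le) (by rw [← add_div, div_eq_one_iff_eq hlt.ne']; ring)
    convert hm using 1
    ext i
    refine Fin.cases ?_ ?_ i
    · simp only [Pi.add_apply, Pi.smul_apply, smul_eq_mul]
      field_simp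
      ring
    · intro j
      have q1 := congrFun e1 j
      have q2 := congrFun e2 j
      simp only [Fin.tail] at q1 q2
      simp only [Pi.add_apply, Pi.smul_apply, smul_eq_mul, q1, q2]
      field_simp
      ring

theorem sub_det {V V' : Finset (Fin (n+1) → ℤ)} (hi : (interior (cv V)).Nonempty) (hi' : (interior (cv V')).Nonempty)
    (hQ : Qs V = Qs V') (hA : As V = As V') (hM : Mx V = Mx V') (hA' : As (rflV V) = As (rflV V')) (hM' : Mx (rflV V) = Mx (rflV V')) :
    cv V ⊆ cv V' := by
  classical
  have ne : ∀ W : Finset (Fin (n+1) → ℤ), (interior (cv W)).Nonempty → W.Nonempty := by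
    intro W hW
    rw [Finset.nonempty_iff_ne_empty]
    rintro rfl
    simp [cv] at hW
  have hV := ne V hi
  have hV' := ne V' hi'
  have hΩ : ((fun z => Fin.tail z) '' cv V : Set (Fin n → ℝ)) = (fun z => Fin.tail z) '' cv V' := by
    rw [Qs_hull, Qs_hull, hQ]
  have hti := tail_int hi
  intro z hz
  obtain ⟨w, hw, e1, h1⟩ := upper_det hV hV' hti hΩ hA hM z hz
  have hΩ' : ((fun z => Fin.tail z) '' cv (rflV V) : Set (Fin n → ℝ)) = (fun z => Fin.tail z) '' cv (rflV V') := by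
    rw [tail_refl, tail_refl, hΩ]
  rw [← tail_refl] at hti
  have hz' : reflR z ∈ cv (rflV V) := by rw [cv_refl]; exact ⟨z, hz, rfl⟩
  obtain ⟨u, hu, e2, h2⟩ := upper_det (V := rflV V) (V' := rflV V') (hV.image _) (hV'.image _) hti hΩ' hA' hM' _ hz'
  rw [cv_refl] at hu
  obtain ⟨u', hu', rfl⟩ := hu
  simp [reflR_apply] at e2 h2
  exact vert (cv_convex V') hw hu' e1 e2 h1 h2

theorem cv_det {V V' : Finset (Fin (n+1) → ℤ)} (hi : (interior (cv V)).Nonempty) (hi' : (interior (cv V')).Nonempty)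
    (hQ : Qs V = Qs V') (hA : As V = As V') (hM : Mx V = Mx V') (hA' : As (rflV V) = As (rflV V')) (hM' : Mx (rflV V) = Mx (rflV V')) :
    cv V = cv V' :=
  Set.Subset.antisymm (sub_det hi hi' hQ hA hM hA' hM') (sub_det hi' hi hQ.symm hA.symm hM.symm hA'.symm hM'.symm)

theorem cv_box {d : ℕ} {V : Finset (Fin d → ℤ)} (t : Fin d → ℕ) (ht : ∀ x ∈ V, ∀ i, |x i| ≤ t i) : ∀ z ∈ cv V, ∀ i, |z i| ≤ (t i : ℝ) := by
  have hsub : cv V ⊆ Set.Icc (fun i => - (t i : ℝ)) (fun i => (t i : ℝ)) := by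
    apply convexHull_min
    · rintro _ ⟨x, hx, rfl⟩
      have := ht x hx
      refine ⟨fun i => ?_, fun i => ?_⟩
      · have := (abs_le.1 (this i)).1
        simp only [intVec]; exact_mod_cast this
      · have := (abs_le.1 (this i)).2
        simp only [intVec]; exact_mod_cast this
    · exact convex_Icc _ _
  intro z hz i
  exact abs_le.2 ⟨(hsub hz).1 i, (hsub hz).2 i⟩

theorem As_bound {V : Finset (Fin (n+1) → ℤ)} (t : Fin (n+1) → ℕ) (ht : ∀ x ∈ V, ∀ i, |x i| ≤ t i) :
    (∀ a ∈ As V, 1 ≤ a 0) ∧ ∀ i, (t i : ℝ) * (vS n * ∑ a ∈ As V, |(a i : ℝ)|) ≤ 2^(n+1) * ∏ k, (t k : ℝ) := by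
  classical
  obtain ⟨S, a, c, C, h, e⟩ := As_spec V
  have e' : As V = S.image a := by
    apply Finset.coe_injective; rw [e]; simp
  rw [e']
  refine ⟨?_, ?_⟩
  · intro b hb
    obtain ⟨p, hp, rfl⟩ := Finset.mem_image.1 hb
    exact h.a0 p hp
  · intro i
    rw [Finset.sum_image (fun p hp p' hp' e => h.a_inj h hp hp' e)]
    exact h.bound (fun i => (t i : ℝ)) (fun i => Nat.cast_nonneg _) (cv_box t ht) i

theorem refl_box {V : Finset (Fin (n+1) → ℤ)} (t : Fin (n+1) → ℕ) (ht : ∀ x ∈ V, ∀ i, |x i| ≤ t i) : 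
    ∀ x ∈ rflV V, ∀ i, |x i| ≤ t i := by
  classical
  intro x hx
  obtain ⟨y, hy, rfl⟩ := Finset.mem_image.1 hx
  intro i
  refine Fin.cases ?_ ?_ i
  · simpa [reflZ] using ht y hy 0
  · intro j; simpa [reflZ, Fin.tail] using ht y hy j.succ

end

end

-- part CntA

section

theorem weight_count {α : Type} [DecidableEq α] (B : Finset α) (φ : α → ℝ) (M : ℝ) :
    ((B.powerset.filter (fun A => ∑ a ∈ A, φ a ≤ M)).card : ℝ) ≤ Real.exp (M + ∑ a ∈ B, Real.exp (- φ a)) := by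
  have h1 : ((B.powerset.filter (fun A => ∑ a ∈ A, φ a ≤ M)).card : ℝ) ≤ ∑ A ∈ B.powerset, Real.exp M * ∏ a ∈ A, Real.exp (- φ a) := by
    calc ((B.powerset.filter (fun A => ∑ a ∈ A, φ a ≤ M)).card : ℝ) = ∑ A ∈ B.powerset.filter (fun A => ∑ a ∈ A, φ a ≤ M), (1:ℝ) := by simp
      _ ≤ ∑ A ∈ B.powerset.filter (fun A => ∑ a ∈ A, φ a ≤ M), Real.exp M * ∏ a ∈ A, Real.exp (- φ a) := by
        apply Finset.sum_le_sum
        intro A hA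
        rw [← Real.exp_sum, ← Real.exp_add]
        apply Real.one_le_exp
        have := (Finset.mem_filter.1 hA).2
        rw [Finset.sum_neg_distrib]
        linarith
      _ ≤ _ := by
        apply Finset.sum_le_sum_of_subset_of_nonneg (Finset.filter_subset _ _)
        intros
        positivity
  refine h1.trans ?_
  rw [← Finset.mul_sum, ← Finset.prod_one_add, Real.exp_add, Real.exp_sum]
  gcongr with a ha
  rw [add_comm]
  exact Real.add_one_le_exp _

theorem geo1 (l : ℝ) (hl : 0 < l) (N : ℕ) : ∑ k ∈ Finset.Icc (1:ℤ) N, Real.exp (- (l * |(k:ℝ)|)) ≤ 1 / (Real.exp l - 1) := by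
  have he : 0 < Real.exp l - 1 := by
    have := Real.add_one_lt_exp hl.ne'
    linarith
  have h : ∀ N : ℕ, ∑ k ∈ Finset.Icc (1:ℤ) N, Real.exp (- (l * |(k:ℝ)|)) = (1 - Real.exp (-(l * N))) / (Real.exp l - 1) := by
    intro N
    induction N with
    | zero => simp
    | succ N ih =>
      have e : Finset.Icc (1:ℤ) ((N+1 : ℕ) : ℤ) = insert ((N:ℤ)+1) (Finset.Icc (1:ℤ) N) := by
        ext k; simp only [Finset.mem_Icc, Finset.mem_insert]; push_cast; omega
      rw [e, Finset.sum_insert (by simp), ih]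
      have e2 : |(((N:ℤ)+1 : ℤ) : ℝ)| = (N:ℝ)+1 := by
        push_cast; exact abs_of_nonneg (by positivity)
      rw [e2]
      have e3 : Real.exp (-(l * N)) = Real.exp (-(l * ((N:ℝ)+1))) * Real.exp l := by
        rw [← Real.exp_add]; congr 1; ring
      rw [e3]
      push_cast
      field_simp
      ring
  rw [h]
  gcongr
  have := Real.exp_pos (-(l * N))
  linarith

theorem geo2 (l : ℝ) (hl : 0 < l) (N : ℕ) : ∑ k ∈ Finset.Icc (-(N:ℤ)) N, Real.exp (- (l * |(k:ℝ)|)) ≤ (l + 2) / l := by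
  classical
  have hsub : Finset.Icc (-(N:ℤ)) N ⊆ (insert 0 (Finset.Icc (1:ℤ) N)) ∪ (Finset.Icc (1:ℤ) N).image (fun k => -k) := by
    intro k hk
    simp only [Finset.mem_Icc, Finset.mem_union, Finset.mem_insert, Finset.mem_image] at hk ⊢
    rcases lt_trichotomy k 0 with h | h | h
    · right; exact ⟨-k, by omega, by omega⟩
    · left; left; exact h
    · left; right; omega
  have g := geo1 l hl N
  have h2 : 1 / (Real.exp l - 1) ≤ 1 / l := by
    apply one_div_le_one_div_of_le hl
    have := Real.add_one_le_exp l
    linarith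
  calc ∑ k ∈ Finset.Icc (-(N:ℤ)) N, Real.exp (- (l * |(k:ℝ)|)) 
      ≤ ∑ k ∈ (insert 0 (Finset.Icc (1:ℤ) N)) ∪ (Finset.Icc (1:ℤ) N).image (fun k => -k), Real.exp (- (l * |(k:ℝ)|)) :=
        Finset.sum_le_sum_of_subset_of_nonneg hsub (fun _ _ _ => (Real.exp_pos _).le)
    _ ≤ ∑ k ∈ (insert 0 (Finset.Icc (1:ℤ) N)), Real.exp (- (l * |(k:ℝ)|)) + ∑ k ∈ (Finset.Icc (1:ℤ) N).image (fun k => -k), Real.exp (- (l * |(k:ℝ)|)) := by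
        rw [← Finset.sum_union_inter]
        have : 0 ≤ ∑ k ∈ (insert 0 (Finset.Icc (1:ℤ) N)) ∩ (Finset.Icc (1:ℤ) N).image (fun k => -k), Real.exp (- (l * |(k:ℝ)|)) :=
          Finset.sum_nonneg (fun _ _ => (Real.exp_pos _).le)
        linarith
    _ = (1 + ∑ k ∈ Finset.Icc (1:ℤ) N, Real.exp (- (l * |(k:ℝ)|))) + ∑ k ∈ Finset.Icc (1:ℤ) N, Real.exp (- (l * |(k:ℝ)|)) := by
        rw [Finset.sum_insert (by simp), Finset.sum_image (by intro a _ b _ h; simpa using h)]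
        simp
    _ ≤ (l + 2) / l := by
        have : (l+2)/l = 1 + 1/l + 1/l := by field_simp; ring
        linarith

theorem exp_aux (n : ℕ) (x : ℝ) (hx : 0 < x) : (x + 2)^n / (Real.exp x - 1) ≤ ((n.factorial : ℝ) * 2^n * Real.exp 1) / x := by
  have h1 : x * Real.exp (x/2) ≤ Real.exp x - 1 := by
    have := Real.self_le_sinh_iff.2 (by positivity : 0 ≤ x/2)
    rw [Real.sinh_eq] at this
    have e1 : Real.exp x = Real.exp (x/2) * Real.exp (x/2) := by rw [← Real.exp_add]; congr 1; ring
    have e2 : Real.exp (x/2) * Real.exp (-(x/2)) = 1 := by rw [← Real.exp_add]; simp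
    have := mul_le_mul_of_nonneg_left this (Real.exp_pos (x/2)).le
    nlinarith
  have h2 : (x+2)^n ≤ (n.factorial : ℝ) * 2^n * Real.exp 1 * Real.exp (x/2) := by
    have := Real.pow_div_factorial_le_exp ((x+2)/2) (by positivity) n
    rw [div_le_iff₀ (by positivity), div_pow, div_le_iff₀ (by positivity)] at this
    have e : Real.exp ((x+2)/2) = Real.exp 1 * Real.exp (x/2) := by rw [← Real.exp_add]; congr 1; ring
    rw [e] at this
    linarith
  have hp : 0 < x * Real.exp (x/2) := by positivity
  rw [div_le_div_iff₀ (by linarith) hx]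
  calc (x+2)^n * x ≤ ((n.factorial : ℝ) * 2^n * Real.exp 1 * Real.exp (x/2)) * x := by gcongr
    _ = ((n.factorial : ℝ) * 2^n * Real.exp 1) * (x * Real.exp (x/2)) := by ring
    _ ≤ _ := by gcongr

/-- the box of vectors -/
def Bx (n N : ℕ) : Finset (Fin (n+1) → ℤ) :=
  Fintype.piFinset (Fin.cons (Finset.Icc (1:ℤ) N) (fun _ => Finset.Icc (-(N:ℤ)) N) : Fin (n+1) → Finset ℤ)

theorem sum_Bx (n N : ℕ) (l : Fin (n+1) → ℝ) (hl : ∀ i, 0 < l i) (hmax : ∀ i, l i ≤ l 0) :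
    ∑ a ∈ Bx n N, Real.exp (- ∑ i, l i * |(a i : ℝ)|) ≤ ((n.factorial : ℝ) * 2^n * Real.exp 1) / ∏ i, l i := by
  have e : ∑ a ∈ Bx n N, Real.exp (- ∑ i, l i * |(a i : ℝ)|) = 
      ∏ i, ∑ k ∈ (Fin.cons (Finset.Icc (1:ℤ) N) (fun _ => Finset.Icc (-(N:ℤ)) N) : Fin (n+1) → Finset ℤ) i, Real.exp (- (l i * |(k:ℝ)|)) := by
    rw [Finset.prod_univ_sum]
    apply Finset.sum_congr rfl
    intro a _
    rw [← Real.exp_sum, Finset.sum_neg_distrib]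
  rw [e, Fin.prod_univ_succ, Fin.prod_univ_succ]
  simp only [Fin.cons_zero, Fin.cons_succ]
  have h0 := hl 0
  have he : 0 < Real.exp (l 0) - 1 := by
    have := Real.add_one_lt_exp h0.ne'
    linarith
  calc _ ≤ (1 / (Real.exp (l 0) - 1)) * ∏ i : Fin n, ((l 0 + 2) / l i.succ) := by
        gcongr with i
        · exact geo1 _ h0 N
        · refine (geo2 _ (hl i.succ) N).trans ?_
          have := hmax i.succ
          have := hl i.succ
          gcongr
    _ = ((l 0 + 2)^n / (Real.exp (l 0) - 1)) / ∏ i : Fin n, l i.succ := by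
        rw [Finset.prod_div_distrib]; simp; ring
    _ ≤ (((n.factorial : ℝ) * 2^n * Real.exp 1) / l 0) / ∏ i : Fin n, l i.succ := by
        have : 0 < ∏ i : Fin n, l i.succ := Finset.prod_pos (fun i _ => hl _)
        exact div_le_div_of_nonneg_right (exp_aux n _ h0) this.le
    _ = _ := by rw [div_div]

theorem count_A (n : ℕ) (v : ℝ) (hv : 0 < v) : ∃ K : ℝ, 0 < K ∧ ∀ t : Fin (n+1) → ℕ, (∀ i, 1 ≤ t i) → (∀ i, t i ≤ t 0) → 
    ∃ F : Finset (Finset (Fin (n+1) → ℤ)), (∀ A : Finset (Fin (n+1) → ℤ), (∀ a ∈ A, 1 ≤ a 0) → 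
      (∀ i, (t i : ℝ) * (v * ∑ a ∈ A, |(a i : ℝ)|) ≤ 2^(n+1) * ∏ k, (t k : ℝ)) → A ∈ F) ∧
      (F.card : ℝ) ≤ Real.exp (K * (∏ k, (t k : ℝ)) ^ ((n:ℝ) / ((n:ℝ)+2))) := by
  classical
  refine ⟨(n+1) * (2^(n+1) / v) + (n.factorial : ℝ) * 2^n * Real.exp 1, by positivity, ?_⟩
  intro t ht hmax
  set V : ℝ := ∏ k, (t k : ℝ) with hV
  have htp : ∀ i, (0:ℝ) < t i := fun i => by exact_mod_cast ht i
  have hVp : 0 < V := Finset.prod_pos (fun i _ => htp i)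
  set R : ℝ := V ^ ((n:ℝ) / ((n:ℝ)+2)) with hR
  have hRp : 0 < R := Real.rpow_pos_of_pos hVp _
  set T : ℝ := V ^ (2 / ((n:ℝ)+2)) with hT
  have hTp : 0 < T := Real.rpow_pos_of_pos hVp _
  have hn2 : (n:ℝ) + 2 ≠ 0 := by positivity
  have hTR : V = T * R := by
    rw [hT, hR, ← Real.rpow_add hVp]
    have : 2 / ((n:ℝ)+2) + (n:ℝ) / ((n:ℝ)+2) = 1 := by field_simp; ring
    rw [this, Real.rpow_one]
  have hTn : T^(n+1) = V * R := by
    rw [hT, hR, ← Real.rpow_natCast, ← Real.rpow_mul hVp.le]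
    nth_rw 2 [← Real.rpow_one V]
    rw [← Real.rpow_add hVp]
    congr 1
    push_cast
    field_simp
    ring
  obtain ⟨N, hN⟩ := exists_nat_ge (2^(n+1) * V / v)
  set φ : (Fin (n+1) → ℤ) → ℝ := fun a => ∑ i, (t i / T) * |(a i : ℝ)| with hφ
  refine ⟨(Bx n N).powerset.filter (fun A => ∑ a ∈ A, φ a ≤ (n+1) * (2^(n+1) / v) * R), ?_, ?_⟩
  · intro A h1 h2
    rw [Finset.mem_filter, Finset.mem_powerset]
    refine ⟨?_, ?_⟩
    · intro a ha
      have hb : ∀ i, |a i| ≤ N := by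
        intro i
        have q1 : |(a i : ℝ)| ≤ ∑ a ∈ A, |(a i : ℝ)| := Finset.single_le_sum (f := fun a : Fin (n+1) → ℤ => |(a i : ℝ)|) (fun _ _ => abs_nonneg _) ha
        have q2 := h2 i
        have q3 : v * |(a i : ℝ)| ≤ 2^(n+1) * V := by
          refine le_trans ?_ q2
          have : (1:ℝ) ≤ t i := by exact_mod_cast ht i
          calc v * |(a i : ℝ)| ≤ v * ∑ a ∈ A, |(a i : ℝ)| := by gcongr
            _ = 1 * (v * ∑ a ∈ A, |(a i : ℝ)|) := by ring
            _ ≤ _ := by gcongr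
        have q4 : |(a i : ℝ)| ≤ N := by
          refine le_trans ?_ hN
          rw [le_div_iff₀ hv]; linarith
        exact_mod_cast q4
      rw [Bx, Fintype.mem_piFinset]
      intro i
      have h0 := h1 a ha
      refine Fin.cases ?_ ?_ i
      · simp only [Fin.cons_zero, Finset.mem_Icc]
        exact ⟨h0, (abs_le.1 (hb 0)).2⟩
      · intro j
        simp only [Fin.cons_succ, Finset.mem_Icc]
        exact abs_le.1 (hb j.succ)
    · have : ∑ a ∈ A, φ a = ∑ i, (t i / T) * ∑ a ∈ A, |(a i : ℝ)| := by
        simp only [hφ]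
        rw [Finset.sum_comm]
        apply Finset.sum_congr rfl
        intro i _
        rw [Finset.mul_sum]
      rw [this]
      calc ∑ i, (t i / T) * ∑ a ∈ A, |(a i : ℝ)| ≤ ∑ i : Fin (n+1), (2^(n+1) / v) * R := by
            apply Finset.sum_le_sum
            intro i _
            have := h2 i
            rw [hTR] at this
            rw [div_mul_eq_mul_div, div_le_iff₀ hTp, div_mul_eq_mul_div, div_mul_eq_mul_div, le_div_iff₀ hv]
            linarith
        _ = _ := by simp; ring
  · refine (weight_count _ _ _).trans ?_
    apply Real.exp_le_exp.2
    have hs := sum_Bx n N (fun i => t i / T) (fun i => div_pos (htp i) hTp) (fun i => by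
      have : (t i : ℝ) ≤ t 0 := by exact_mod_cast hmax i
      gcongr)
    have e2 : ∏ i, ((t i : ℝ) / T) = 1 / R := by
      rw [Finset.prod_div_distrib, ← hV, Finset.prod_const, Finset.card_univ, Fintype.card_fin, hTn]
      field_simp
    rw [e2] at hs
    rw [add_mul]
    simp only [hφ]
    have e3 : ((n.factorial : ℝ) * 2^n * Real.exp 1) / (1 / R) = ((n.factorial : ℝ) * 2^n * Real.exp 1) * R := by
      field_simp
    rw [e3] at hs
    linarith

end

-- part CntQ

section

theorem Q_est (m : ℕ) (W s t0 : ℝ) (hW : 0 < W) (hs : 1 ≤ s) (hst : s ≤ t0) (hWs : W ≤ s^m) :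
    W * Real.log (3 * s) ≤ (3 * ((m:ℝ)+3) / 2) * (W * t0 * s) ^ (((m:ℝ)+1) / ((m:ℝ)+3)) := by
  have hs0 : 0 < s := by linarith
  set ε : ℝ := 2 / ((m:ℝ)+3) with hε
  set e : ℝ := ((m:ℝ)+1) / ((m:ℝ)+3) with he
  have hm3 : (0:ℝ) < (m:ℝ)+3 := by positivity
  have hε0 : 0 < ε := by positivity
  have he0 : 0 < e := by positivity
  have hε1 : ε ≤ 1 := by
    rw [hε, div_le_one hm3]; have : (0:ℝ) ≤ m := by positivity
    linarith
  have h1 : Real.log (3 * s) ≤ 3 * s^ε / ε := by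
    refine (Real.log_le_rpow_div (by positivity) hε0).trans ?_
    rw [Real.mul_rpow (by norm_num) hs0.le]
    gcongr
    calc (3:ℝ)^ε ≤ 3^(1:ℝ) := Real.rpow_le_rpow_of_exponent_le (by norm_num) hε1
      _ = 3 := by simp
  have h2 : W * s^ε ≤ (W * t0 * s)^e := by
    have hsum : e + ε = 1 := by rw [he, hε]; field_simp; ring
    have w1 : W = W^e * W^ε := by rw [← Real.rpow_add hW, hsum, Real.rpow_one]
    have w2 : W^ε ≤ s^((m:ℝ)*ε) := by
      calc W^ε ≤ (s^m)^ε := by gcongr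
        _ = s^((m:ℝ)*ε) := by rw [Real.rpow_mul hs0.le, Real.rpow_natCast]
    calc W * s^ε = W^e * W^ε * s^ε := by rw [← w1]
      _ ≤ W^e * s^((m:ℝ)*ε) * s^ε := by gcongr
      _ = W^e * s^(2 * e) := by
          rw [mul_assoc, ← Real.rpow_add hs0]
          congr 2
          rw [he, hε]; field_simp
      _ = (W * (s*s))^e := by
          rw [Real.mul_rpow hW.le (by positivity), Real.rpow_mul hs0.le, Real.rpow_two, sq]
      _ ≤ (W * t0 * s)^e := by
          apply Real.rpow_le_rpow (by positivity) _ he0.le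
          rw [mul_assoc]
          gcongr
  calc W * Real.log (3 * s) ≤ W * (3 * s^ε / ε) := by gcongr
    _ = (3/ε) * (W * s^ε) := by ring
    _ ≤ (3/ε) * (W * t0 * s)^e := by gcongr
    _ = _ := by
      congr 1
      rw [hε]; field_simp

theorem count_Q (m : ℕ) : ∃ K : ℝ, 0 < K ∧ ∀ t : Fin (m+2) → ℕ, (∀ i, 1 ≤ t i) → (∀ i, t i ≤ t 0) → 
    ∃ F : Finset (Set (Fin (m+1) → ℤ)), (∀ Q : Set (Fin (m+1) → ℤ), (∀ x ∈ Q, ∀ i, |x i| ≤ t i.succ) → 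
      (∀ j, ∀ x ∈ Q, ∀ y ∈ Q, (∀ i, i ≠ j → x i = y i) → ∀ k, x j ≤ k → k ≤ y j → Function.update x j k ∈ Q) → Q ∈ F) ∧
      (F.card : ℝ) ≤ Real.exp (K * (∏ k, (t k : ℝ)) ^ (((m+1 : ℕ):ℝ) / (((m+1 : ℕ):ℝ)+2))) := by
  classical
  refine ⟨2 * 3^m * (3 * ((m:ℝ)+3) / 2), by positivity, ?_⟩
  intro t ht hmax
  obtain ⟨j, -, hj⟩ := Finset.exists_max_image (Finset.univ : Finset (Fin (m+1))) (fun j => t j.succ) ⟨0, Finset.mem_univ _⟩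
  set s : ℕ := t j.succ with hs
  set s' : Fin m → ℕ := fun i => t (j.succAbove i).succ with hs'
  let U : Finset (Fin m → ℤ) := Fintype.piFinset (fun i => Finset.Icc (-(s' i : ℤ)) (s' i))
  let J : Finset (ℤ × ℤ) := Finset.Icc (-(s:ℤ)) s ×ˢ Finset.Icc (-(s:ℤ)) s
  let dec : (U → ℤ × ℤ) → Set (Fin (m+1) → ℤ) := fun g => {x | ∃ u : U, (∀ i, x (j.succAbove i) = u.1 i) ∧ (g u).1 ≤ x j ∧ x j ≤ (g u).2}
  refine ⟨(Fintype.piFinset (fun _ : U => J)).image dec, ?_, ?_⟩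
  · intro Q hQ hline
    have hs1 : (1:ℤ) ≤ s := by exact_mod_cast ht j.succ
    -- intervals
    have hint : ∀ u : U, ∃ p : ℤ × ℤ, p ∈ J ∧ ∀ k : ℤ, (j.insertNth k u.1 : Fin (m+1) → ℤ) ∈ Q ↔ p.1 ≤ k ∧ k ≤ p.2 := by
      intro u
      by_cases hne : ∃ k : ℤ, (j.insertNth k u.1 : Fin (m+1) → ℤ) ∈ Q
      · let I : Finset ℤ := (Finset.Icc (-(s:ℤ)) s).filter (fun k => (j.insertNth k u.1 : Fin (m+1) → ℤ) ∈ Q)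
        have hI : ∀ k : ℤ, k ∈ I ↔ (j.insertNth k u.1 : Fin (m+1) → ℤ) ∈ Q := by
          intro k
          simp only [I, Finset.mem_filter, Finset.mem_Icc, and_iff_right_iff_imp]
          intro hk
          have := hQ _ hk j
          rw [Fin.insertNth_apply_same] at this
          exact abs_le.1 this
        have hIne : I.Nonempty := by
          obtain ⟨k, hk⟩ := hne
          exact ⟨k, (hI k).2 hk⟩
        refine ⟨(I.min' hIne, I.max' hIne), ?_, ?_⟩
        · have h1 := I.min'_mem hIne
          have h2 := I.max'_mem hIne
          exact Finset.mem_product.2 ⟨(Finset.mem_filter.1 h1).1, (Finset.mem_filter.1 h2).1⟩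
        · intro k
          constructor
          · intro hk
            exact ⟨I.min'_le _ ((hI k).2 hk), I.le_max' _ ((hI k).2 hk)⟩
          · rintro ⟨h1, h2⟩
            have hm1 := (hI _).1 (I.min'_mem hIne)
            have hm2 := (hI _).1 (I.max'_mem hIne)
            have := hline j _ hm1 _ hm2 (by
              intro i hi
              obtain ⟨i', rfl⟩ := Fin.exists_succAbove_eq hi
              simp) k (by simpa using h1) (by simpa using h2)
            rwa [Fin.update_insertNth] at this
      · refine ⟨(1, 0), ?_, ?_⟩
        · simp only [J, Finset.mem_product, Finset.mem_Icc]; omega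
        · intro k
          refine ⟨fun hk => absurd ⟨k, hk⟩ hne, fun h => ?_⟩
          simp only at h; omega
    choose g hgJ hg using hint
    rw [Finset.mem_image]
    refine ⟨g, Fintype.mem_piFinset.2 hgJ, ?_⟩
    ext x
    have key : ∀ u : U, (∀ i, x (j.succAbove i) = u.1 i) → (j.insertNth (x j) u.1 : Fin (m+1) → ℤ) = x := by
      intro u hu
      rw [Fin.insertNth_eq_iff]
      exact ⟨rfl, by ext i; simp [Fin.removeNth, hu]⟩
    constructor
    · rintro ⟨u, hu, h1, h2⟩
      have := (hg u (x j)).2 ⟨h1, h2⟩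
      rwa [key u hu] at this
    · intro hx
      have hu : (fun i => x (j.succAbove i)) ∈ U := by
        rw [Fintype.mem_piFinset]
        intro i
        rw [Finset.mem_Icc]
        exact abs_le.1 (hQ x hx (j.succAbove i))
      refine ⟨⟨_, hu⟩, fun i => rfl, ?_⟩
      apply (hg ⟨_, hu⟩ (x j)).1
      rw [key ⟨_, hu⟩ (fun i => rfl)]
      exact hx
  · have hs1 : (1:ℝ) ≤ s := by exact_mod_cast ht j.succ
    have hcard : (((Fintype.piFinset (fun _ : U => J)).image dec).card : ℝ) ≤ ((2 * s + 1 : ℝ)^2) ^ U.card := by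
      have h1 := Finset.card_image_le (s := Fintype.piFinset (fun _ : U => J)) (f := dec)
      rw [Fintype.card_piFinset, Finset.prod_const, Finset.card_univ, Fintype.card_coe] at h1
      have hJ : J.card = (2 * s + 1)^2 := by
        simp only [J, Finset.card_product, Int.card_Icc]
        have : ((s:ℤ) + 1 - -(s:ℤ)).toNat = 2 * s + 1 := by omega
        rw [this]; ring
      rw [hJ] at h1
      exact_mod_cast h1
    refine hcard.trans ?_
    have hUc : (U.card : ℝ) ≤ 3^m * ∏ i, (s' i : ℝ) := by
      simp only [U, Fintype.card_piFinset, Int.card_Icc]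
      push_cast
      calc ∏ i, ((((s' i : ℤ) + 1 - -(s' i : ℤ)).toNat : ℕ) : ℝ) ≤ ∏ i, (3 * (s' i : ℝ)) := by
            apply Finset.prod_le_prod
            · intros; positivity
            · intro i _
              have h1 : ((s' i : ℤ) + 1 - -(s' i : ℤ)).toNat ≤ 3 * s' i := by
                have := ht (j.succAbove i).succ
                simp only [hs'] at *
                omega
              exact_mod_cast h1
        _ = _ := by rw [Finset.prod_mul_distrib]; simp
    have hW : 0 < ∏ i, (s' i : ℝ) := Finset.prod_pos (fun i _ => by exact_mod_cast ht _)
    have est := Q_est m (∏ i, (s' i : ℝ)) s (t 0) hW hs1 (by exact_mod_cast hmax _) (by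
      calc ∏ i, (s' i : ℝ) ≤ ∏ i : Fin m, (s : ℝ) := by
            apply Finset.prod_le_prod
            · intros; positivity
            · intro i _
              exact_mod_cast hj (j.succAbove i) (Finset.mem_univ _)
        _ = _ := by simp)
    have hprod : ∏ k, (t k : ℝ) = (∏ i, (s' i : ℝ)) * t 0 * s := by
      rw [Fin.prod_univ_succ, Fin.prod_univ_succAbove _ j]
      ring
    rw [hprod]
    have hpos : (0:ℝ) < 2 * s + 1 := by positivity
    have hlog : 0 ≤ Real.log (3 * s) := Real.log_nonneg (by linarith)
    have e1 : ((2 * s + 1 : ℝ)^2) ^ U.card = Real.exp (U.card * (2 * Real.log (2 * s + 1))) := by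
      rw [← Real.exp_log (pow_pos (pow_pos hpos 2) U.card), Real.log_pow, Real.log_pow]
      norm_num
    rw [e1]
    apply Real.exp_le_exp.2
    have hll : Real.log (2 * s + 1) ≤ Real.log (3 * s) := Real.log_le_log hpos (by linarith)
    have ee : (((m+1 : ℕ):ℝ) / (((m+1 : ℕ):ℝ)+2)) = ((m:ℝ)+1) / ((m:ℝ)+3) := by push_cast; congr 1; ring
    rw [ee]
    calc (U.card : ℝ) * (2 * Real.log (2 * s + 1)) ≤ (3^m * ∏ i, (s' i : ℝ)) * (2 * Real.log (3 * s)) := by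
            have : 0 ≤ Real.log (2 * s + 1) := Real.log_nonneg (by linarith)
            gcongr
      _ = 2 * 3^m * ((∏ i, (s' i : ℝ)) * Real.log (3 * s)) := by ring
      _ ≤ 2 * 3^m * ((3 * ((m:ℝ)+3) / 2) * ((∏ i, (s' i : ℝ)) * t 0 * s) ^ (((m:ℝ)+1) / ((m:ℝ)+3))) := by gcongr
      _ = _ := by ring

end

theorem Qs_line {n : ℕ} (V : Finset (Fin (n+1) → ℤ)) (j : Fin n) (x y : Fin n → ℤ) (hx : x ∈ Qs V) (hy : y ∈ Qs V)
    (hxy : ∀ i, i ≠ j → x i = y i) (k : ℤ) (h1 : x j ≤ k) (h2 : k ≤ y j) : Function.update x j k ∈ Qs V := by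
  have hconv : Convex ℝ ((fun z => Fin.tail z) '' cv V : Set (Fin n → ℝ)) := by
    rw [tail_cv]; exact convex_convexHull _ _
  by_cases h : x j = y j
  · have : k = x j := by omega
    rw [this, Function.update_eq_self]; exact hx
  · have hlt : (0:ℝ) < (y j : ℝ) - x j := by
      have : x j < y j := by omega
      have : (x j : ℝ) < y j := by exact_mod_cast this
      linarith
    have h1' : (x j : ℝ) ≤ k := by exact_mod_cast h1
    have h2' : (k : ℝ) ≤ y j := by exact_mod_cast h2
    have hm := hconv hx hy (a := ((y j : ℝ) - k) / ((y j : ℝ) - x j)) (b := ((k : ℝ) - x j) / ((y j : ℝ) - x j)) 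
      (div_nonneg (by linarith) hlt.le)
      (div_nonneg (by linarith) hlt.le) (by rw [← add_div, div_eq_one_iff_eq hlt.ne']; ring)
    change intVec (Function.update x j k) ∈ ((fun z => Fin.tail z) '' cv V : Set (Fin n → ℝ))
    convert hm using 1
    ext i
    simp only [intVec, Pi.add_apply, Pi.smul_apply, smul_eq_mul]
    by_cases hi : i = j
    · subst hi
      rw [Function.update_self]
      field_simp
      ring
    · rw [Function.update_of_ne hi, hxy i hi]
      field_simp
      ring

theorem log_absorb (e : ℝ) (he : 0 < e) (x : ℝ) (hx : 1 ≤ x) : x ≤ Real.exp (x^e / e) := by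
  rw [← Real.log_le_iff_le_exp (by linarith)]
  exact Real.log_le_rpow_div (by linarith) he

theorem count_P (m : ℕ) : ∃ K : ℝ, 0 < K ∧ ∀ t : Fin (m+2) → ℕ, (∀ i, 1 ≤ t i) → (∀ i, t i ≤ t 0) → 
    ∃ F : Finset (Set (Fin (m+2) → ℝ)), (∀ V : Finset (Fin (m+2) → ℤ), (∀ x ∈ V, ∀ i, |x i| ≤ t i) → 
      (interior (cv V)).Nonempty → cv V ∈ F) ∧
      (F.card : ℝ) ≤ Real.exp (K * (∏ k, (t k : ℝ)) ^ (((m+1 : ℕ):ℝ) / (((m+1 : ℕ):ℝ)+2))) := by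
  classical
  obtain ⟨KA, hKA, hA⟩ := count_A (m+1) (vS (m+1)) (vS_pos (m+1))
  obtain ⟨KQ, hKQ, hQ⟩ := count_Q m
  set e : ℝ := (((m+1 : ℕ):ℝ) / (((m+1 : ℕ):ℝ)+2)) with he
  have he0 : 0 < e := by positivity
  refine ⟨KQ + KA + KA + (9 + 2 / e), by positivity, ?_⟩
  intro t ht hmax
  obtain ⟨FA, hFA, hFAc⟩ := hA t ht hmax
  obtain ⟨FQ, hFQ, hFQc⟩ := hQ t ht hmax
  let I : Finset ℤ := Finset.Icc (-(t 0 : ℤ)) (t 0)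
  let G := FQ ×ˢ FA ×ˢ FA ×ˢ I ×ˢ I
  let code : Finset (Fin (m+2) → ℤ) → Set (Fin (m+1) → ℤ) × Finset (Fin (m+2) → ℤ) × Finset (Fin (m+2) → ℤ) × ℤ × ℤ :=
    fun V => (Qs V, As V, As (rflV V), Mx V, Mx (rflV V))
  let dec : Set (Fin (m+1) → ℤ) × Finset (Fin (m+2) → ℤ) × Finset (Fin (m+2) → ℤ) × ℤ × ℤ → Set (Fin (m+2) → ℝ) :=
    fun g => if h : ∃ V, (interior (cv V)).Nonempty ∧ code V = g then cv h.choose else ∅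
  refine ⟨G.image dec, ?_, ?_⟩
  · intro V hV hi
    rw [Finset.mem_image]
    refine ⟨code V, ?_, ?_⟩
    · simp only [G, code, Finset.mem_product]
      refine ⟨?_, ?_, ?_, ?_, ?_⟩
      · apply hFQ
        · rintro x ⟨z, hz, e⟩ i
          have := cv_box t hV z hz i.succ
          have e2 := congrFun e i
          simp only [Fin.tail, intVec] at e2
          rw [e2] at this
          exact_mod_cast this
        · intro j x hx y hy
          exact Qs_line V j x y hx hy
      · exact hFA _ (As_bound t hV).1 (As_bound t hV).2
      · exact hFA _ (As_bound t (refl_box t hV)).1 (As_bound t (refl_box t hV)).2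
      · exact Finset.mem_Icc.2 (abs_le.1 (Mx_abs t hV))
      · exact Finset.mem_Icc.2 (abs_le.1 (Mx_abs t (refl_box t hV)))
    · have h : ∃ V', (interior (cv V')).Nonempty ∧ code V' = code V := ⟨V, hi, rfl⟩
      have hs := h.choose_spec
      simp only [dec, dif_pos h]
      have h2 := hs.2
      exact cv_det hs.1 hi (congrArg (fun g => g.1) h2) (congrArg (fun g => g.2.1) h2) (congrArg (fun g => g.2.2.2.1) h2)
        (congrArg (fun g => g.2.2.1) h2) (congrArg (fun g => g.2.2.2.2) h2)
  · set V : ℝ := ∏ k, (t k : ℝ) with hV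
    have ht1 : ∀ i, (1:ℝ) ≤ t i := fun i => by exact_mod_cast ht i
    have ht0V : (t 0 : ℝ) ≤ V := by
      rw [hV, Fin.prod_univ_succ]
      have : (1:ℝ) ≤ ∏ i : Fin (m+1), (t i.succ : ℝ) := Finset.one_le_prod (fun i _ => ht1 _)
      have := ht1 0
      nlinarith
    have hV1 : 1 ≤ V := le_trans (ht1 0) ht0V
    have hVe : 1 ≤ V^e := Real.one_le_rpow hV1 he0.le
    have hI : (I.card : ℝ) * I.card ≤ Real.exp ((9 + 2 / e) * V^e) := by
      have h1 : (I.card : ℝ) ≤ 3 * V := by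
        simp only [I, Int.card_Icc]
        have : (((t 0 : ℤ) + 1 - -(t 0 : ℤ)).toNat : ℕ) ≤ 3 * t 0 := by
          have := ht 0
          omega
        have : ((((t 0 : ℤ) + 1 - -(t 0 : ℤ)).toNat : ℕ) : ℝ) ≤ 3 * t 0 := by exact_mod_cast this
        linarith
      have h9 : (9:ℝ) ≤ Real.exp (9 * V^e) := by
        have := Real.add_one_le_exp (9 * V^e)
        linarith
      have h2 := log_absorb e he0 V hV1
      calc (I.card : ℝ) * I.card ≤ (3 * V) * (3 * V) := by gcongr
        _ = 9 * (V * V) := by ring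
        _ ≤ Real.exp (9 * V^e) * (Real.exp (V^e/e) * Real.exp (V^e/e)) := by gcongr
        _ = _ := by rw [← Real.exp_add, ← Real.exp_add]; congr 1; ring
    have hc : ((G.image dec).card : ℝ) ≤ FQ.card * (FA.card * (FA.card * (I.card * I.card))) := by
      have := Finset.card_image_le (s := G) (f := dec)
      simp only [G, Finset.card_product] at this
      exact_mod_cast this
    refine hc.trans ?_
    calc (FQ.card : ℝ) * (FA.card * (FA.card * (I.card * I.card))) 
        ≤ Real.exp (KQ * V^e) * (Real.exp (KA * V^e) * (Real.exp (KA * V^e) * Real.exp ((9 + 2 / e) * V^e))) := by gcongr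
      _ = _ := by rw [← Real.exp_add, ← Real.exp_add, ← Real.exp_add]; congr 1; ring

theorem LE_symm {d : ℕ} {P Q : Set (Fin d → ℝ)} (h : LatticeEquiv d P Q) : LatticeEquiv d Q P := by
  obtain ⟨σ, h1, h2⟩ := h
  refine ⟨σ.symm, ?_, ?_⟩
  · nth_rw 1 [← h1]
    rw [Set.image_image]; simp
  · rw [h2, Set.image_image]; simp

theorem LE_trans {d : ℕ} {P Q R : Set (Fin d → ℝ)} (h : LatticeEquiv d P Q) (h' : LatticeEquiv d Q R) : LatticeEquiv d P R := by
  obtain ⟨σ, h1, h2⟩ := h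
  obtain ⟨τ, h3, h4⟩ := h'
  refine ⟨σ.trans τ, ?_, ?_⟩
  · rw [AffineEquiv.coe_trans, Set.image_comp, h1, h3]
  · rw [AffineEquiv.coe_trans, Set.image_comp, ← h2, h4]

theorem LE_int {d : ℕ} {P Q : Set (Fin d → ℝ)} (h : LatticeEquiv d P Q) (hi : (interior P).Nonempty) : (interior Q).Nonempty := by
  obtain ⟨σ, h1, rfl⟩ := h
  have e : σ '' P = (AffineEquiv.toContinuousAffineEquiv σ).toHomeomorph '' P := by rfl
  rw [e, ← Homeomorph.image_interior]
  exact hi.image _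

theorem main_succ (m : ℕ) : ∃ c : ℝ, 0 < c ∧ ∀ w : ℕ, 0 < w →
      Finite (ClassesType (m+2) (fun P => (latticePts (m+2) P).ncard = w ∧
        ∃ x : Fin (m+2) → ℤ, intVec x ∈ interior P)) ∧
      (Nat.card (ClassesType (m+2) (fun P => (latticePts (m+2) P).ncard = w ∧
          ∃ x : Fin (m+2) → ℤ, intVec x ∈ interior P)) : ℝ) ≤
        Real.exp (c * (w : ℝ) ^ (((m+1 : ℕ):ℝ) / (((m+1 : ℕ):ℝ)+2))) := by
  classical
  obtain ⟨K, hK, hP⟩ := count_P m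
  obtain ⟨C, hC, hbox⟩ := equiv_box (m+1)
  set e : ℝ := (((m+1 : ℕ):ℝ) / (((m+1 : ℕ):ℝ)+2)) with he
  have he0 : 0 < e := by positivity
  refine ⟨((m+2 : ℕ):ℝ) * ((C+1)^e / e) + K * C^e, by positivity, ?_⟩
  intro w hw
  set N : ℕ := ⌈C * w⌉₊ with hN
  have hw1 : (1:ℝ) ≤ w := by exact_mod_cast hw
  let T : Finset (Fin (m+2) → ℕ) := (Fintype.piFinset (fun _ => Finset.Icc 1 N)).filter (fun t => (∀ i, t i ≤ t 0) ∧ ∏ i, (t i : ℝ) ≤ C * w)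
  have hF : ∀ t ∈ T, ∃ F : Finset (Set (Fin (m+2) → ℝ)), (∀ V : Finset (Fin (m+2) → ℤ), (∀ x ∈ V, ∀ i, |x i| ≤ t i) → 
      (interior (cv V)).Nonempty → cv V ∈ F) ∧ (F.card : ℝ) ≤ Real.exp (K * (C * w)^e) := by
    intro t ht
    obtain ⟨h1, h2, h3⟩ := Finset.mem_filter.1 ht
    obtain ⟨F, hF1, hF2⟩ := hP t (fun i => (Finset.mem_Icc.1 (Fintype.mem_piFinset.1 h1 i)).1) h2
    refine ⟨F, hF1, hF2.trans ?_⟩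
    apply Real.exp_le_exp.2
    gcongr
  choose! F hF1 hF2 using hF
  let G := T.biUnion F
  have hGc : (G.card : ℝ) ≤ Real.exp ((((m+2 : ℕ):ℝ) * ((C+1)^e / e) + K * C^e) * (w:ℝ)^e) := by
    have c1 : (G.card : ℝ) ≤ T.card * Real.exp (K * (C * w)^e) := by
      calc (G.card : ℝ) ≤ ∑ t ∈ T, ((F t).card : ℝ) := by exact_mod_cast Finset.card_biUnion_le
        _ ≤ ∑ t ∈ T, Real.exp (K * (C * w)^e) := Finset.sum_le_sum hF2
        _ = _ := by simp
    have c2 : (T.card : ℝ) ≤ (N:ℝ)^(m+2) := by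
      have : T.card ≤ N^(m+2) := by
        refine (Finset.card_filter_le _ _).trans ?_
        rw [Fintype.card_piFinset]; simp
      exact_mod_cast this
    have c3 : (N:ℝ) ≤ (C+1) * w := by
      have := (Nat.ceil_lt_add_one (by positivity : 0 ≤ C * w)).le
      rw [← hN] at this
      linarith
    have c4 : (N:ℝ)^(m+2) ≤ Real.exp (((m+2 : ℕ):ℝ) * (((C+1) * w)^e / e)) := by
      rw [Real.exp_nat_mul]
      have := log_absorb e he0 ((C+1) * w) (by nlinarith)
      gcongr
      linarith
    calc (G.card : ℝ) ≤ Real.exp (((m+2 : ℕ):ℝ) * (((C+1) * w)^e / e)) * Real.exp (K * (C * w)^e) := by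
          refine c1.trans ?_
          gcongr
          exact c2.trans c4
      _ = _ := by
          rw [← Real.exp_add, Real.mul_rpow (by positivity) (by positivity), Real.mul_rpow (by positivity) (by positivity)]
          congr 1; ring
  have hrep : ∀ q : ClassesType (m+2) (fun P => (latticePts (m+2) P).ncard = w ∧
        ∃ x : Fin (m+2) → ℤ, intVec x ∈ interior P), ∃ g : G, LatticeEquiv (m+2) (Quot.out q).1 g.1 := by
    intro q
    obtain ⟨⟨V, hV⟩, hfull, hw', x0, hx0⟩ := (Quot.out q).2
    have hx1 := hx0
    rw [hV] at hx0
    obtain ⟨V', t, hLE, ht1, ht0, htp, hbx⟩ := hbox V x0 hx0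
    rw [← hV] at hLE htp
    rw [hw'] at htp
    have hint : (interior (cv V')).Nonempty := LE_int hLE ⟨_, hx1⟩
    have hti : ∀ i, (t i : ℝ) ≤ ∏ k, (t k : ℝ) := by
      intro i
      have h1 : ∀ k, (1:ℝ) ≤ t k := fun k => by exact_mod_cast ht1 k
      rw [Fin.prod_univ_succAbove _ i]
      have : (1:ℝ) ≤ ∏ k, (t (i.succAbove k) : ℝ) := Finset.one_le_prod (fun k _ => h1 _)
      have := h1 i
      nlinarith
    have htT : t ∈ T := by
      rw [Finset.mem_filter]
      refine ⟨Fintype.mem_piFinset.2 (fun i => Finset.mem_Icc.2 ⟨ht1 i, ?_⟩), ht0, htp⟩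
      have := (hti i).trans htp
      exact_mod_cast this.trans (Nat.le_ceil _)
    exact ⟨⟨cv V', Finset.mem_biUnion.2 ⟨t, htT, hF1 t htT V' hbx hint⟩⟩, hLE⟩
  choose g hg using hrep
  have hinj : Function.Injective g := by
    intro q q' hqq
    have h1 := hg q
    have h2 := hg q'
    rw [← hqq] at h2
    rw [← Quot.out_eq q, ← Quot.out_eq q']
    exact Quot.sound (LE_trans h1 (LE_symm h2))
  refine ⟨Finite.of_injective g hinj, ?_⟩
  refine le_trans ?_ hGc
  have := Nat.card_le_card_of_injective g hinj
  rw [Nat.card_eq_fintype_card (α := G), Fintype.card_coe] at this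
  exact_mod_cast this

/-- For every `d ≥ 2`, the number `κ'(d,w)` of equivalence classes of
`d`-dimensional convex lattice polytopes with `w` lattice points and a lattice
point in the interior is finite, and `κ'(d,w) ≤ exp(c w^{(d-1)/(d+1)})`. -/
theorem kappa_prime_upper (d : ℕ) (hd : 2 ≤ d) :
    ∃ c : ℝ, 0 < c ∧ ∀ w : ℕ, 0 < w →
      Finite (ClassesType d (fun P => (latticePts d P).ncard = w ∧
        ∃ x : Fin d → ℤ, intVec x ∈ interior P)) ∧
      (Nat.card (ClassesType d (fun P => (latticePts d P).ncard = w ∧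
          ∃ x : Fin d → ℤ, intVec x ∈ interior P)) : ℝ) ≤
        Real.exp (c * (w : ℝ) ^ (((d : ℝ) - 1) / ((d : ℝ) + 1))) := by
  obtain ⟨m, rfl⟩ : ∃ m, d = m + 2 := ⟨d - 2, by omega⟩
  obtain ⟨c, hc, h⟩ := main_succ m
  refine ⟨c, hc, fun w hw => ?_⟩
  have e : (((m + 2 : ℕ) : ℝ) - 1) / (((m + 2 : ℕ) : ℝ) + 1) = (((m+1 : ℕ):ℝ) / (((m+1 : ℕ):ℝ)+2)) := by
    push_cast; congr 1 <;> ring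
  rw [e]
  exact h w hw

end
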